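/- For every integer N ≥ 1, all real numbers a_1 < b_1 < a_2 < b_2 < ⋯ < a_N < b_N, all real numbers α_1, …, α_{N−1}, and every integer n, there exists a solution M of the model Riemann–Hilbert problem. -/

import Mathlib

open Complex Filter Topology Asymptotics Bornology

noncomputable section

/-- The cut interval `[a₁, b_N]` viewed as a subset of the complex plane.
Here `a b : ℕ → ℝ` are 0-indexed, so `a 0 = a₁` and `b (N-1) = b_N`. -/
def cutSet (N : ℕ) (a b : ℕ → ℝ) : Set ℂ :=
  Complex.ofReal '' Set.Icc (a 0) (b (N - 1))

/-- The diagonal jump matrix `diag(e^{-2πiθ}, e^{2πiθ})` on the gaps. -/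
def gapJump (θ : ℝ) : Matrix (Fin 2) (Fin 2) ℂ :=
  !![Complex.exp (-(2 * Real.pi * θ) * Complex.I), 0;
     0, Complex.exp ((2 * Real.pi * θ) * Complex.I)]

/-- `M` is a solution of the model Riemann-Hilbert problem with data
`N`, endpoints `a 0 < b 0 < a 1 < b 1 < ⋯ < a (N-1) < b (N-1)`, and gap jump
parameters `β k` (the jump on the gap `(b k, a (k+1))` is `diag(e^{-2πiβₖ}, e^{2πiβₖ})`;
for the model problem of the paper one takes `β k = n * α k`). The conditions:
(a) every entry of `M` is analytic on `ℂ \ [a₁, b_N]`;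
(b) `M` has continuous boundary values `M₊` (from the upper half-plane) and `M₋`
(from the lower half-plane) on each open cut `(a k, b k)` and each open gap
`(b k, a (k+1))`, with `M₊ = M₋ * [[0,1],[-1,0]]` on the cuts and
`M₊ = M₋ * diag(e^{-2πiβₖ}, e^{2πiβₖ})` on the gaps;
(c) `M(z) = I + O(1/z)` as `z → ∞`;
(d) each entry of `M` is `O(|z - p|^{-1/4})` as `z → p` for each endpoint `p`. -/
def IsModelRHSolution (N : ℕ) (a b β : ℕ → ℝ)
    (M : ℂ → Matrix (Fin 2) (Fin 2) ℂ) : Prop :=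
  (∀ i j, AnalyticOnNhd ℂ (fun z => M z i j) (cutSet N a b)ᶜ) ∧
  (∀ k < N, ∀ x ∈ Set.Ioo (a k) (b k),
    ∃ Mp Mm : Matrix (Fin 2) (Fin 2) ℂ,
      Tendsto M (𝓝[{z : ℂ | 0 < z.im}] (x : ℂ)) (𝓝 Mp) ∧
      Tendsto M (𝓝[{z : ℂ | z.im < 0}] (x : ℂ)) (𝓝 Mm) ∧
      Mp = Mm * !![0, 1; -1, 0]) ∧
  (∀ k, k + 1 < N → ∀ x ∈ Set.Ioo (b k) (a (k + 1)),
    ∃ Mp Mm : Matrix (Fin 2) (Fin 2) ℂ,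
      Tendsto M (𝓝[{z : ℂ | 0 < z.im}] (x : ℂ)) (𝓝 Mp) ∧
      Tendsto M (𝓝[{z : ℂ | z.im < 0}] (x : ℂ)) (𝓝 Mm) ∧
      Mp = Mm * gapJump (β k)) ∧
  (∀ i j, (fun z : ℂ => M z i j - (1 : Matrix (Fin 2) (Fin 2) ℂ) i j)
      =O[Bornology.cobounded ℂ] fun z => z⁻¹) ∧
  (∀ k < N, ∀ p ∈ ({a k, b k} : Set ℝ), ∀ i j,
      (fun z => M z i j) =O[𝓝[(cutSet N a b)ᶜ] ((p : ℝ) : ℂ)]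
        fun z => ‖z - (p : ℂ)‖ ^ (-(1 / 4) : ℝ))

lemma rh_morera {U : Set ℂ} (hU : IsOpen U) {f : ℂ → ℂ} (hc : ContinuousOn f U)
    (hd : DifferentiableOn ℂ f (U ∩ {z : ℂ | z.im ≠ 0})) : DifferentiableOn ℂ f U := by
  refine (isConservativeOn_and_continuousOn_iff_isDifferentiableOn hU).1 ⟨?_, hc⟩
  intro z w hzw
  have key : ∀ z w : ℂ, Rectangle z w ⊆ U →
      (0 : ℝ) ∉ Set.Ioo (min z.im w.im) (max z.im w.im) →
      (∫ x : ℝ in z.re..w.re, f (x + z.im * I)) - (∫ x : ℝ in z.re..w.re, f (x + w.im * I)) +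
      I • (∫ y : ℝ in z.im..w.im, f (w.re + y * I)) -
      I • (∫ y : ℝ in z.im..w.im, f (z.re + y * I)) = 0 := by
    intro z w hzw h0
    refine integral_boundary_rect_eq_zero_of_continuousOn_of_differentiableOn f z w
      (hc.mono hzw) (hd.mono ?_)
    intro u hu
    refine ⟨hzw ⟨Set.Ioo_subset_Icc_self hu.1, Set.Ioo_subset_Icc_self hu.2⟩, ?_⟩
    intro h
    apply h0
    rw [← h]
    exact hu.2
  rw [← add_eq_zero_iff_eq_neg, wedgeIntegral_add_wedgeIntegral_eq]
  by_cases h0 : (0 : ℝ) ∈ Set.Ioo (min z.im w.im) (max z.im w.im)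
  · have h0' : (0 : ℝ) ∈ Set.uIcc z.im w.im := Set.Ioo_subset_Icc_self h0
    have sub1 : Set.uIcc z.im 0 ⊆ Set.uIcc z.im w.im := Set.uIcc_subset_uIcc_left h0'
    have sub2 : Set.uIcc 0 w.im ⊆ Set.uIcc z.im w.im := Set.uIcc_subset_uIcc_right h0'
    have h1 := key z ⟨w.re, 0⟩ (fun u hu => hzw ⟨hu.1, sub1 hu.2⟩) (by
      simp only [Set.mem_Ioo, not_and, not_lt]
      intro h
      rcases min_lt_iff.1 h with h | h
      · simp [h.le]
      · exact absurd h (lt_irrefl _))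
    have h2 := key ⟨z.re, 0⟩ w (fun u hu => hzw ⟨hu.1, sub2 hu.2⟩) (by
      simp only [Set.mem_Ioo, not_and, not_lt]
      intro h
      rcases min_lt_iff.1 h with h | h
      · exact absurd h (lt_irrefl _)
      · simp [h.le])
    have int : ∀ x : ℝ, x ∈ Set.uIcc z.re w.re → ∀ c d : ℝ, Set.uIcc c d ⊆ Set.uIcc z.im w.im →
        IntervalIntegrable (fun y : ℝ => f (x + y * I)) MeasureTheory.volume c d := by
      intro x hx c d hcd
      apply ContinuousOn.intervalIntegrable
      apply hc.comp (by fun_prop)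
      intro y hy
      apply hzw
      exact ⟨by simpa using hx, by simpa using hcd hy⟩
    have e1 := intervalIntegral.integral_add_adjacent_intervals
      (int w.re Set.right_mem_uIcc _ _ sub1) (int w.re Set.right_mem_uIcc _ _ sub2)
    have e2 := intervalIntegral.integral_add_adjacent_intervals
      (int z.re Set.left_mem_uIcc _ _ sub1) (int z.re Set.left_mem_uIcc _ _ sub2)
    rw [← e1, ← e2]
    simp only [smul_eq_mul] at *
    linear_combination h1 + h2
  · exact key z w hzw h0

lemma rh_continuousOn_dslope {U : Set ℂ} (hU : IsOpen U) {f : ℂ → ℂ}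
    (hf : DifferentiableOn ℂ f U) :
    ContinuousOn (fun p : ℂ × ℂ => dslope f p.1 p.2) (U ×ˢ U) := by
  rintro ⟨s, z⟩ ⟨hs, hz⟩
  apply ContinuousAt.continuousWithinAt
  simp only at hs hz
  by_cases h : z = s
  · subst h
    have han : AnalyticAt ℂ f z := hf.analyticAt (hU.mem_nhds hz)
    have hstr : HasStrictDerivAt f (deriv f z) z := han.hasStrictDerivAt
    have hcd : ContinuousAt (deriv f) z := han.deriv.continuousAt
    rw [ContinuousAt, Metric.tendsto_nhds]
    intro ε hε
    have h1 := (hasStrictDerivAt_iff_hasStrictFDerivAt.1 hstr).isLittleO.def (half_pos hε)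
    have h2 : ∀ᶠ p : ℂ × ℂ in 𝓝 (z, z), dist (deriv f p.1) (deriv f z) < ε :=
      (hcd.tendsto.comp (continuous_fst.tendsto (z, z))).eventually (Metric.ball_mem_nhds _ hε)
    have h1' : ∀ᶠ p : ℂ × ℂ in 𝓝 (z, z), ‖f p.2 - f p.1 - (p.2 - p.1) * deriv f z‖ ≤
        ε / 2 * ‖p.2 - p.1‖ := by
      have hsw : Tendsto (fun p : ℂ × ℂ => (p.2, p.1)) (𝓝 (z, z)) (𝓝 (z, z)) :=
        (continuous_swap.tendsto (z, z))
      filter_upwards [hsw.eventually h1] with p hp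
      simpa using hp
    filter_upwards [h1', h2] with p hp1 hp2
    by_cases hp : p.2 = p.1
    · rw [hp]; simpa using hp2
    · have hp' : p.2 - p.1 ≠ 0 := sub_ne_zero.2 hp
      rw [dslope_of_ne _ hp, dslope_same, slope_def_field, dist_eq_norm]
      have : (f p.2 - f p.1) / (p.2 - p.1) - deriv f z =
          (f p.2 - f p.1 - (p.2 - p.1) * deriv f z) / (p.2 - p.1) := by
        field_simp
      rw [this, norm_div, div_lt_iff₀ (norm_pos_iff.2 hp')]
      have := norm_pos_iff.2 hp'
      nlinarith
  · have hev : (fun p : ℂ × ℂ => dslope f p.1 p.2) =ᶠ[𝓝 (s, z)]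
        fun p => (f p.2 - f p.1) / (p.2 - p.1) := by
      have : ∀ᶠ p : ℂ × ℂ in 𝓝 (s, z), p.2 ≠ p.1 :=
        (isOpen_ne_fun continuous_snd continuous_fst).mem_nhds h
      filter_upwards [this] with p hp
      rw [dslope_of_ne _ hp, slope_def_field]
    refine ContinuousAt.congr ?_ hev.symm
    have c1 : ContinuousAt f s := (hf.differentiableAt (hU.mem_nhds hs)).continuousAt
    have c2 : ContinuousAt f z := (hf.differentiableAt (hU.mem_nhds hz)).continuousAt
    have c1' : ContinuousAt (fun p : ℂ × ℂ => f p.1) (s, z) := c1.comp continuousAt_fst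
    have c2' : ContinuousAt (fun p : ℂ × ℂ => f p.2) (s, z) :=
      ContinuousAt.comp (f := Prod.snd) c2 continuousAt_snd
    exact (c2'.sub c1').div (by fun_prop) (sub_ne_zero.2 h)

lemma rh_param {U : Set ℂ} (hU : IsOpen U) {c d : ℝ} {w : ℝ → ℂ}
    (hw : IntervalIntegrable w MeasureTheory.volume c d) {k : ℂ → ℝ → ℂ}
    (hk : ContinuousOn (fun p : ℂ × ℝ => k p.1 p.2) (U ×ˢ Set.uIcc c d))
    (hd : ∀ s ∈ Set.uIcc c d, DifferentiableOn ℂ (fun z => k z s) U) :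
    DifferentiableOn ℂ (fun z => ∫ s in c..d, w s * k z s) U := by
  intro z0 hz0
  apply DifferentiableAt.differentiableWithinAt
  obtain ⟨r, hr, hrU⟩ := Metric.isOpen_iff.1 hU z0 hz0
  have hsub : Metric.closedBall z0 (r/2) ⊆ U := fun z hz => hrU (by
    rw [Metric.mem_closedBall] at hz; rw [Metric.mem_ball]; linarith)
  have hcomp : IsCompact (Metric.closedBall z0 (r/2) ×ˢ Set.uIcc c d) :=
    (isCompact_closedBall _ _).prod isCompact_uIcc
  obtain ⟨C, hC⟩ := hcomp.exists_bound_of_continuousOn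
    (hk.mono (Set.prod_mono hsub subset_rfl))
  have hkc : ∀ z ∈ U, ContinuousOn (fun s => k z s) (Set.uIcc c d) := by
    intro z hz
    exact hk.comp (f := fun s : ℝ => (z, s)) (by fun_prop) (fun s hs => ⟨hz, hs⟩)
  have hIntg : ∀ z ∈ U, IntervalIntegrable (fun s => w s * k z s) MeasureTheory.volume c d :=
    fun z hz => hw.mul_continuousOn (hkc z hz)
  have hder : ∀ s ∈ Set.uIcc c d, ∀ z ∈ Metric.ball z0 (r/4), ‖deriv (fun z => k z s) z‖ ≤ C/(r/4) := by
    intro s hs z hz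
    have hzz : Metric.closedBall z (r/4) ⊆ Metric.closedBall z0 (r/2) := by
      intro u hu
      rw [Metric.mem_closedBall] at *
      rw [Metric.mem_ball] at hz
      linarith [dist_triangle u z z0]
    apply Complex.norm_deriv_le_of_forall_mem_sphere_norm_le (by positivity)
    · have : DifferentiableOn ℂ (fun z => k z s) (Metric.closedBall z (r/4)) :=
        (hd s hs).mono (hzz.trans hsub)
      exact DifferentiableOn.diffContOnCl_ball (this) subset_rfl
    · intro u hu
      exact hC (u, s) ⟨hzz (Metric.sphere_subset_closedBall hu), hs⟩
  have huIoc : ∀ s ∈ Set.uIoc c d, s ∈ Set.uIcc c d := fun s hs => Set.uIoc_subset_uIcc hs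
  have hderlim : MeasureTheory.AEStronglyMeasurable (fun s => w s * deriv (fun z => k z s) z0)
      (MeasureTheory.volume.restrict (Set.uIoc c d)) := by
    apply MeasureTheory.AEStronglyMeasurable.mul hw.def'.aestronglyMeasurable
    -- limit of difference quotients
    have hseq : ∀ n : ℕ, z0 + ((r/4)/(n+1) : ℝ) ∈ U := by
      intro n
      apply hrU
      rw [Metric.mem_ball, dist_eq_norm]
      simp only [add_sub_cancel_left, Complex.norm_real, Real.norm_eq_abs]
      rw [abs_of_pos (by positivity)]
      have : (r/4)/((n:ℝ)+1) ≤ r/4 := div_le_self (by positivity) (by linarith [Nat.cast_nonneg (α := ℝ) n])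
      linarith
    refine aestronglyMeasurable_of_tendsto_ae atTop
      (f := fun (n:ℕ) s => ((((r/4)/(n+1) : ℝ) : ℂ))⁻¹ * (k (z0 + ((r/4)/(n+1) : ℝ)) s - k z0 s)) ?_ ?_
    · intro n
      have hm : ∀ z ∈ U, MeasureTheory.AEStronglyMeasurable (fun s => k z s)
          (MeasureTheory.volume.restrict (Set.uIoc c d)) := fun z hz =>
        ((hkc z hz).mono Set.uIoc_subset_uIcc).aestronglyMeasurable measurableSet_uIoc
      exact ((hm _ (hseq n)).sub (hm _ hz0)).const_mul _
    · rw [MeasureTheory.ae_restrict_iff' measurableSet_uIoc]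
      refine Filter.Eventually.of_forall fun s hs => ?_
      have hda : HasDerivAt (fun z => k z s) (deriv (fun z => k z s) z0) z0 :=
        ((hd s (huIoc s hs)).differentiableAt (hU.mem_nhds hz0)).hasDerivAt
      have := hda.tendsto_slope_zero
      have ht : Tendsto (fun n : ℕ => ((((r/4)/(n+1) : ℝ) : ℂ))) atTop (𝓝[≠] 0) := by
        rw [tendsto_nhdsWithin_iff]
        constructor
        · rw [← Complex.ofReal_zero]
          apply (Complex.continuous_ofReal.tendsto _).comp
          exact tendsto_const_div_atTop_nhds_zero_nat (r/4) |>.comp (tendsto_add_atTop_nat 1) |>.congr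
            (fun n => by simp)
        · refine Filter.Eventually.of_forall fun n => ?_
          simp only [Set.mem_compl_iff, Set.mem_singleton_iff, Complex.ofReal_eq_zero]
          positivity
      simpa [Function.comp_def] using this.comp ht
  refine (intervalIntegral.hasDerivAt_integral_of_dominated_loc_of_deriv_le
    (F := fun z s => w s * k z s) (F' := fun z s => w s * deriv (fun z => k z s) z)
    (bound := fun s => ‖w s‖ * (C/(r/4))) (Metric.ball_mem_nhds z0 (ε := r/4) (by positivity))
    ?_ (hIntg z0 hz0) hderlim ?_ ?_ ?_).2.differentiableAt
  · filter_upwards [hU.mem_nhds hz0] with z hz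
    exact (hIntg z hz).def'.aestronglyMeasurable
  · refine Filter.Eventually.of_forall fun s hs z hz => ?_
    rw [norm_mul]
    exact mul_le_mul_of_nonneg_left (hder s (huIoc s hs) z hz) (norm_nonneg _)
  · exact hw.norm.mul_const _
  · refine Filter.Eventually.of_forall fun s hs z hz => ?_
    apply HasDerivAt.const_mul
    apply DifferentiableAt.hasDerivAt
    apply (hd s (huIoc s hs)).differentiableAt (hU.mem_nhds (hrU _))
    rw [Metric.mem_ball] at *
    linarith

lemma rh_dense_im : Dense {z : ℂ | z.im ≠ 0} := by
  have : {z : ℂ | z.im ≠ 0} = Complex.im ⁻¹' ({0}ᶜ) := rfl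
  rw [this]
  exact (dense_compl_singleton (0:ℝ)).preimage Complex.isOpenMap_im

lemma rh_isOpen_im : IsOpen {z : ℂ | z.im ≠ 0} :=
  isOpen_ne_fun Complex.continuous_im continuous_const

lemma rh_neBot_im (z : ℂ) : (𝓝[{z : ℂ | z.im ≠ 0}] z).NeBot :=
  mem_closure_iff_nhdsWithin_neBot.1 (rh_dense_im z)

lemma rh_entire {q : ℂ → ℂ} {E : Set ℝ} (hE : E.Finite)
    (hd : DifferentiableOn ℂ q {z : ℂ | z.im ≠ 0})
    (hl : ∀ x : ℝ, x ∉ E → ∃ L, Tendsto q (𝓝[{z : ℂ | z.im ≠ 0}] (x : ℂ)) (𝓝 L))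
    (hb : ∀ x ∈ E, q =O[𝓝[{z : ℂ | z.im ≠ 0}] (x : ℂ)] (fun _ => (1 : ℝ))) :
    ∃ Q : ℂ → ℂ, Differentiable ℂ Q ∧ ∀ z : ℂ, z.im ≠ 0 → Q z = q z := by
  set A : Set ℂ := {z : ℂ | z.im ≠ 0} with hA
  have hAo : IsOpen A := rh_isOpen_im
  have hAd : Dense A := rh_dense_im
  set S : Set ℂ := Complex.ofReal '' E with hS
  have hSf : S.Finite := hE.image _
  have hBo : IsOpen Sᶜ := hSf.isClosed.isOpen_compl
  have hAB : A ⊆ Sᶜ := by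
    rintro z hz ⟨x, _, rfl⟩
    exact hz (Complex.ofReal_im x)
  have hlim : ∀ z ∈ Sᶜ, ∃ y, Tendsto q (𝓝[A] z) (𝓝 y) := by
    intro z hz
    by_cases h : z.im = 0
    · have hz' : z = (z.re : ℂ) := by apply Complex.ext <;> simp [h]
      rw [hz']
      apply hl
      intro h'
      exact hz ⟨_, h', hz'.symm⟩
    · exact ⟨q z, (hd z h).continuousWithinAt⟩
  have hc := continuousOn_extendFrom (hAd.closure_eq ▸ Set.subset_univ Sᶜ) hlim
  set q1 := extendFrom A q with hq1
  have heq : ∀ z ∈ A, q1 z = q z := fun z hz =>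
    extendFrom_eq (subset_closure hz) (hd z hz).continuousWithinAt
  have hd1 : DifferentiableOn ℂ q1 Sᶜ := by
    apply rh_morera hBo hc
    intro z hz
    exact ((hd z hz.2).mono Set.inter_subset_right).congr (fun y hy => heq y hy.2) (heq z hz.2)
  have hBd : Dense Sᶜ := hAd.mono hAB
  have hpunct : ∀ e : ℂ, ∀ᶠ z in 𝓝[≠] e, z ∈ Sᶜ := by
    intro e
    have : (S \ {e})ᶜ ∈ 𝓝 e := (hSf.subset Set.sdiff_subset).isClosed.isOpen_compl.mem_nhds (by simp)
    filter_upwards [mem_nhdsWithin_of_mem_nhds this, self_mem_nhdsWithin] with z h1 h2 h3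
    exact h1 ⟨h3, h2⟩
  have hlim2 : ∀ z, ∃ y, Tendsto q1 (𝓝[Sᶜ] z) (𝓝 y) := by
    intro z
    by_cases hz : z ∈ Sᶜ
    · exact ⟨q1 z, hc z hz⟩
    · rw [Set.mem_compl_iff, not_not] at hz
      obtain ⟨x, hx, rfl⟩ := hz
      refine ⟨_, (tendsto_limUnder_of_differentiable_on_punctured_nhds_of_bounded_under
        (f := q1) (c := (x:ℂ)) ?_ ?_).mono_left (nhdsWithin_mono _ ?_)⟩
      · filter_upwards [hpunct x] with z hz
        exact hd1.differentiableAt (hBo.mem_nhds hz)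
      · obtain ⟨C, hC⟩ := (hb x hx).bound
        rw [eventually_nhdsWithin_iff, eventually_nhds_iff] at hC
        obtain ⟨W, hW, hWo, hxW⟩ := hC
        refine ⟨C + ‖q1 x‖, ?_⟩
        rw [eventually_map]
        filter_upwards [hpunct x, mem_nhdsWithin_of_mem_nhds (hWo.mem_nhds hxW)] with z hz hzW
        refine (norm_sub_le _ _).trans (add_le_add_left ?_ _)
        have := rh_neBot_im z
        have ht : Tendsto (fun u => ‖q1 u‖) (𝓝[A] z) (𝓝 ‖q1 z‖) :=
          ((hc.continuousAt (hBo.mem_nhds hz)).norm.tendsto).mono_left nhdsWithin_le_nhds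
        refine le_of_tendsto ht ?_
        filter_upwards [self_mem_nhdsWithin, mem_nhdsWithin_of_mem_nhds (hWo.mem_nhds hzW)] with u hu hu2
        rw [heq u hu]
        simpa using hW u hu2 hu
      · intro u hu h
        exact hu ⟨x, hx, h.symm⟩
  have hc2 : Continuous (extendFrom Sᶜ q1) := continuous_extendFrom hBd hlim2
  have heq2 : ∀ z ∈ Sᶜ, extendFrom Sᶜ q1 z = q1 z := fun z hz =>
    extendFrom_eq (subset_closure hz) (hc z hz)
  have hdB : ∀ z ∈ Sᶜ, DifferentiableAt ℂ (extendFrom Sᶜ q1) z := by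
    intro z hz
    refine (hd1.differentiableAt (hBo.mem_nhds hz)).congr_of_eventuallyEq ?_
    filter_upwards [hBo.mem_nhds hz] with u hu using heq2 u hu
  refine ⟨extendFrom Sᶜ q1, ?_, fun z hz => ?_⟩
  · intro z
    by_cases hz : z ∈ Sᶜ
    · exact hdB z hz
    · refine (analyticAt_of_differentiable_on_punctured_nhds_of_continuousAt ?_
        hc2.continuousAt).differentiableAt
      filter_upwards [hpunct z] with u hu using hdB u hu
  · rw [heq2 z (hAB hz), heq z hz]

lemma rh_infty {f : ℂ → ℂ} (hd : ∀ᶠ z in cobounded ℂ, DifferentiableAt ℂ f z)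
    (hb : f =O[cobounded ℂ] (fun _ => (1:ℝ))) :
    ∃ c : ℂ, (fun z => f z - c) =O[cobounded ℂ] fun z => z⁻¹ := by
  set g : ℂ → ℂ := fun w => f w⁻¹ with hg
  have hinv : Tendsto (fun w : ℂ => w⁻¹) (𝓝[≠] 0) (cobounded ℂ) := tendsto_inv₀_nhdsNE_zero
  have hdg : ∀ᶠ w in 𝓝[≠] (0:ℂ), DifferentiableAt ℂ g w := by
    filter_upwards [hinv.eventually hd, self_mem_nhdsWithin] with w hw hw0
    exact DifferentiableAt.comp w hw (differentiableAt_inv hw0)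
  have hbg : IsBoundedUnder (· ≤ ·) (𝓝[≠] (0:ℂ)) (fun w => ‖g w - g 0‖) := by
    obtain ⟨C, hC⟩ := hb.bound
    refine ⟨C + ‖g 0‖, ?_⟩
    rw [eventually_map]
    filter_upwards [hinv.eventually hC] with w hw
    refine (norm_sub_le _ _).trans (add_le_add_left ?_ _)
    simpa using hw
  have ht := tendsto_limUnder_of_differentiable_on_punctured_nhds_of_bounded_under hdg hbg
  set c := limUnder (𝓝[≠] (0:ℂ)) g
  have han : AnalyticAt ℂ (Function.update g 0 c) 0 := by
    apply analyticAt_of_differentiable_on_punctured_nhds_of_continuousAt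
    · filter_upwards [hdg, self_mem_nhdsWithin] with w hw hw0
      refine hw.congr_of_eventuallyEq ?_
      filter_upwards [isOpen_ne.mem_nhds hw0] with u hu
      simp [Function.update_of_ne hu]
    · rwa [continuousAt_update_same]
  refine ⟨c, ?_⟩
  have hO := han.differentiableAt.hasDerivAt.isBigO_sub
  have hO2 := hO.comp_tendsto (tendsto_inv₀_cobounded (α := ℂ))
  have hne : ∀ᶠ z in cobounded ℂ, z ≠ 0 := eventually_ne_cobounded 0
  refine hO2.congr' ?_ ?_
  · filter_upwards [hne] with z hz
    simp [Function.update_of_ne (inv_ne_zero hz), hg]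
  · filter_upwards with z
    simp

lemma rh_entire_zero {Q : ℂ → ℂ} (hQ : Differentiable ℂ Q) (n : ℕ) (x : ℕ → ℝ)
    (hx : ∀ i < n, ∀ j < n, x i = x j → i = j) (h0 : ∀ i < n, Q (x i) = 0)
    (hO : Q =O[cobounded ℂ] fun z => z ^ ((n : ℤ) - 1)) : ∀ z, Q z = 0 := by
  induction n generalizing Q with
  | zero =>
    intro z
    apply hQ.apply_eq_of_tendsto_cocompact z
    rw [← Metric.cobounded_eq_cocompact]
    refine hO.trans_tendsto ?_
    simpa using tendsto_inv₀_cobounded (α := ℂ)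
  | succ n ih =>
    set Q' := dslope Q (x n) with hQ'
    have hd : Differentiable ℂ Q' := by
      rw [← differentiableOn_univ]
      exact (Complex.differentiableOn_dslope univ_mem).2 hQ.differentiableOn
    have hfac : ∀ z, Q z = (z - x n) * Q' z := by
      intro z
      have := sub_smul_dslope Q (x n) z
      rw [h0 n (Nat.lt_succ_self n), sub_zero, smul_eq_mul] at this
      exact this.symm
    have h1 := ih (Q := Q') hd (fun i hi j hj => hx i (by omega) j (by omega)) (by
      intro i hi
      have h2 := h0 i (by omega)
      rw [hfac] at h2
      rcases mul_eq_zero.1 h2 with h3 | h3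
      · have : x i = x n := by exact_mod_cast sub_eq_zero.1 h3
        have := hx i (by omega) n (by omega) this
        omega
      · exact h3) (by
      have h3 : (fun z : ℂ => (z - x n)⁻¹) =O[cobounded ℂ] fun z => z⁻¹ := by
        apply IsBigO.inv_rev
        · have hlit : (fun _ : ℂ => (x n : ℂ)) =o[cobounded ℂ] fun z : ℂ => z := by
            apply isLittleO_const_left.2; right
            exact tendsto_norm_cobounded_atTop
          have := hlit.right_isBigO_sub
          simpa using this
        · filter_upwards [eventually_ne_cobounded (0:ℂ)] with z hz h
          exact absurd h hz
      refine (h3.mul hO).congr' ?_ ?_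
      · filter_upwards [eventually_ne_cobounded (x n : ℂ)] with z hz
        rw [hfac z, inv_mul_cancel_left₀ (sub_ne_zero.2 hz)]
      · filter_upwards [eventually_ne_cobounded (0:ℂ)] with z hz
        rw [← zpow_neg_one, ← zpow_add₀ hz]
        congr 1
        push_cast; ring)
    intro z
    rw [hfac z, h1 z, mul_zero]

/-- fourth root of `(z-b)/(z-a)` -/
def rg (a b : ℝ) (z : ℂ) : ℂ := exp (log ((z - b) / (z - a)) / 4)

/-- real version -/
def rgR (a b : ℝ) (x : ℝ) : ℝ := Real.exp (Real.log ((x - b) / (x - a)) / 4)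

/-- square root of `(z-a)(z-b)` -/
def rr (a b : ℝ) (z : ℂ) : ℂ := (z - a) * rg a b z ^ 2

lemma rg_ne (a b : ℝ) (z : ℂ) : rg a b z ≠ 0 := exp_ne_zero _

lemma rg_quot_im {a b : ℝ} (z : ℂ) (hz : z ≠ a) :
    ((z - b) / (z - a)).im = (b - a) * z.im / normSq (z - a) := by
  have : (z - b) / (z - a) = 1 - ((b - a : ℝ) : ℂ) / (z - a) := by
    have := sub_ne_zero.2 hz
    field_simp
    push_cast
    ring
  rw [this]
  simp [Complex.div_im]

lemma rh_ne_of_im {z : ℂ} (hz : z.im ≠ 0) (a : ℝ) : z ≠ a := by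
  rintro rfl; simp at hz

lemma rg_slit {a b : ℝ} (hab : a < b) {z : ℂ} (hz : z ∉ Complex.ofReal '' Set.Icc a b) :
    (z - b) / (z - a) ∈ slitPlane := by
  by_cases h : z.im = 0
  · obtain ⟨x, rfl⟩ : ∃ x : ℝ, z = x := ⟨z.re, by apply Complex.ext <;> simp [h]⟩
    have : ((x:ℂ) - b) / (x - a) = (((x - b) / (x - a) : ℝ) : ℂ) := by push_cast; rfl
    rw [this, ofReal_mem_slitPlane]
    have hx : x < a ∨ b < x := by
      by_contra! h'
      exact hz ⟨x, h', rfl⟩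
    rcases hx with hx | hx
    · exact div_pos_of_neg_of_neg (by linarith) (by linarith)
    · exact div_pos (by linarith) (by linarith)
  · right
    rw [rg_quot_im z (rh_ne_of_im h a)]
    have : normSq (z - a) ≠ 0 := by
      rw [Ne, normSq_eq_zero]; exact sub_ne_zero.2 (rh_ne_of_im h a)
    have : b - a ≠ 0 := by linarith
    positivity

lemma rg_diff {a b : ℝ} (hab : a < b) {z : ℂ} (hz : z ∉ Complex.ofReal '' Set.Icc a b) :
    DifferentiableAt ℂ (rg a b) z := by
  have h1 := rg_slit hab hz
  have h2 : z - a ≠ 0 := by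
    intro h
    rw [h] at h1
    simp at h1
  unfold rg
  have h3 : DifferentiableAt ℂ (fun z : ℂ => (z - b) / (z - a)) z := by
    exact DifferentiableAt.fun_div (by fun_prop) (by fun_prop) h2
  exact ((h3.clog h1).div_const 4).cexp

lemma rr_diff {a b : ℝ} (hab : a < b) {z : ℂ} (hz : z ∉ Complex.ofReal '' Set.Icc a b) :
    DifferentiableAt ℂ (rr a b) z := by
  unfold rr
  exact (by fun_prop : DifferentiableAt ℂ (fun z : ℂ => z - a) z).mul ((rg_diff hab hz).pow 2)

lemma rg_pow4 {a b : ℝ} {z : ℂ} (ha : z ≠ a) (hb : z ≠ b) :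
    rg a b z ^ 4 = (z - b) / (z - a) := by
  unfold rg
  rw [← Complex.exp_nat_mul]
  push_cast
  rw [mul_div_cancel₀ _ (by norm_num : (4:ℂ) ≠ 0), exp_log]
  exact div_ne_zero (sub_ne_zero.2 hb) (sub_ne_zero.2 ha)

lemma rr_sq {a b : ℝ} {z : ℂ} (ha : z ≠ a) (hb : z ≠ b) :
    rr a b z ^ 2 = (z - a) * (z - b) := by
  have := rg_pow4 ha hb
  unfold rr
  have h : z - a ≠ 0 := sub_ne_zero.2 ha
  calc ((z - a) * rg a b z ^ 2) ^ 2 = (z-a)^2 * rg a b z ^ 4 := by ring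
    _ = _ := by rw [this]; field_simp

lemma rg_norm {a b : ℝ} {z : ℂ} (ha : z ≠ a) (hb : z ≠ b) :
    ‖rg a b z‖ = ‖z - b‖ ^ (1/4 : ℝ) * ‖z - a‖ ^ (-(1/4) : ℝ) := by
  have h1 : 0 < ‖z - a‖ := norm_pos_iff.2 (sub_ne_zero.2 ha)
  have h2 : 0 < ‖z - b‖ := norm_pos_iff.2 (sub_ne_zero.2 hb)
  unfold rg
  rw [Complex.norm_exp, Real.rpow_def_of_pos h1, Real.rpow_def_of_pos h2, ← Real.exp_add]
  congr 1
  have : (log ((z - b) / (z - a)) / 4).re = (log ((z - b) / (z - a))).re / 4 := by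
    have := Complex.div_ofReal_re (log ((z - b) / (z - a))) 4
    simp
  rw [this, Complex.log_re, norm_div, Real.log_div h2.ne' h1.ne']
  ring

lemma rg_norm_inv {a b : ℝ} {z : ℂ} (ha : z ≠ a) (hb : z ≠ b) :
    ‖(rg a b z)⁻¹‖ = ‖z - a‖ ^ (1/4 : ℝ) * ‖z - b‖ ^ (-(1/4) : ℝ) := by
  rw [norm_inv, rg_norm ha hb, mul_inv, ← Real.rpow_neg (norm_nonneg _),
    ← Real.rpow_neg (norm_nonneg _), neg_neg, mul_comm]

lemma rg_ofReal {a b x : ℝ} (hab : a < b) (hx : x < a ∨ b < x) :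
    rg a b x = (rgR a b x : ℂ) := by
  have hpos : 0 < (x - b) / (x - a) := by
    rcases hx with hx | hx
    · exact div_pos_of_neg_of_neg (by linarith) (by linarith)
    · exact div_pos (by linarith) (by linarith)
  unfold rg rgR
  push_cast [Complex.ofReal_log hpos.le]
  rfl

lemma rgR_pos (a b x : ℝ) : 0 < rgR a b x := Real.exp_pos _

lemma rg_conj {a b : ℝ} (hab : a < b) {z : ℂ} (hz : z ∉ Complex.ofReal '' Set.Icc a b) :
    rg a b (starRingEnd ℂ z) = starRingEnd ℂ (rg a b z) := by
  have h1 := rg_slit hab hz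
  unfold rg
  rw [← Complex.exp_conj, map_div₀, ← Complex.log_conj _ (slitPlane_arg_ne_pi h1)]
  simp [map_ofNat]

lemma rr_conj {a b : ℝ} (hab : a < b) {z : ℂ} (hz : z ∉ Complex.ofReal '' Set.Icc a b) :
    rr a b (starRingEnd ℂ z) = starRingEnd ℂ (rr a b z) := by
  unfold rr
  rw [rg_conj hab hz]
  simp

lemma rg_tendsto_infty (a b : ℝ) : Tendsto (rg a b) (cobounded ℂ) (𝓝 1) := by
  have h1 : Tendsto (fun z : ℂ => (z - b) / (z - a)) (cobounded ℂ) (𝓝 1) := by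
    have : Tendsto (fun z : ℂ => 1 - ((b - a : ℝ) : ℂ) * (z - a)⁻¹) (cobounded ℂ) (𝓝 (1 - ((b - a : ℝ) : ℂ) * 0)) := by
      apply tendsto_const_nhds.sub
      apply tendsto_const_nhds.mul
      apply (tendsto_inv₀_cobounded (α := ℂ)).comp
      exact tendsto_sub_const_cobounded (a:ℂ)
    simp only [mul_zero, sub_zero] at this
    refine this.congr' ?_
    filter_upwards [eventually_ne_cobounded (a : ℂ)] with z hz
    have := sub_ne_zero.2 hz
    field_simp
    push_cast
    ring
  have h2 : ContinuousAt (fun w : ℂ => exp (log w / 4)) 1 := by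
    have : ContinuousAt log 1 := continuousAt_clog (by simp)
    fun_prop
  have := h2.tendsto.comp h1
  have e : exp (log (1:ℂ) / 4) = 1 := by simp
  rw [e] at this
  exact this

/-- modulus of the boundary value -/
def rv (a b x : ℝ) : ℝ := Real.exp (Real.log ((b - x) / (x - a)) / 4)

lemma rv_pos (a b x : ℝ) : 0 < rv a b x := Real.exp_pos _

lemma rg_quot_tendsto {a b x : ℝ} (hx : x ∈ Set.Ioo a b) :
    Tendsto (fun z : ℂ => (z - b) / (z - a)) (𝓝 (x:ℂ)) (𝓝 ((((x - b) / (x - a) : ℝ)) : ℂ)) := by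
  have h : ((x:ℂ) - a) ≠ 0 := by
    rw [← Complex.ofReal_sub, Complex.ofReal_ne_zero]; linarith [hx.1]
  have : ContinuousAt (fun z : ℂ => (z - b) / (z - a)) x := by
    exact ContinuousAt.div (by fun_prop) (by fun_prop) h
  have h2 := this.tendsto
  push_cast
  exact h2

lemma rg_limit_re {a b x : ℝ} (hx : x ∈ Set.Ioo a b) : (x - b) / (x - a) < 0 :=
  div_neg_of_neg_of_pos (by linarith [hx.2]) (by linarith [hx.1])

lemma rg_abs {a b x : ℝ} (hx : x ∈ Set.Ioo a b) :
    ‖((((x - b) / (x - a) : ℝ)) : ℂ)‖ = (b - x) / (x - a) := by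
  rw [Complex.norm_real, Real.norm_eq_abs, abs_of_neg (rg_limit_re hx), ← neg_div, neg_sub]

lemma rg_up {a b x : ℝ} (hx : x ∈ Set.Ioo a b) :
    Tendsto (rg a b) (𝓝[{z : ℂ | 0 < z.im}] (x:ℂ)) (𝓝 (rv a b x * exp (Real.pi * I / 4))) := by
  have hab : a < b := hx.1.trans hx.2
  have h1 : Tendsto (fun z : ℂ => (z - b) / (z - a)) (𝓝[{z : ℂ | 0 < z.im}] (x:ℂ))
      (𝓝[{z : ℂ | 0 ≤ z.im}] ((((x - b) / (x - a) : ℝ)) : ℂ)) := by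
    rw [tendsto_nhdsWithin_iff]
    refine ⟨(rg_quot_tendsto hx).mono_left nhdsWithin_le_nhds, ?_⟩
    filter_upwards [self_mem_nhdsWithin] with z hz
    have hz' : 0 < z.im := hz
    change 0 ≤ ((z - b) / (z - a)).im
    rw [rg_quot_im z (rh_ne_of_im hz'.ne' a)]
    have : 0 < b - a := by linarith
    have := normSq_nonneg (z - a)
    positivity
  have h2 := (Complex.tendsto_log_nhdsWithin_im_nonneg_of_re_neg_of_im_zero
    (z := ((((x - b) / (x - a) : ℝ)) : ℂ)) (by rw [Complex.ofReal_re]; exact rg_limit_re hx) (Complex.ofReal_im _)).comp h1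
  have h3 := ((h2.div_const (4:ℂ)).cexp)
  rw [rg_abs hx] at h3
  have e : (rv a b x : ℂ) * exp (Real.pi * I / 4) = exp ((Real.log ((b - x) / (x - a)) + Real.pi * I) / 4) := by
    unfold rv
    push_cast
    rw [← Complex.exp_add]
    congr 1
    ring
  rw [e]
  exact h3

lemma rg_low {a b x : ℝ} (hx : x ∈ Set.Ioo a b) :
    Tendsto (rg a b) (𝓝[{z : ℂ | z.im < 0}] (x:ℂ)) (𝓝 (rv a b x * exp (-(Real.pi * I / 4)))) := by
  have hab : a < b := hx.1.trans hx.2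
  have h1 : Tendsto (fun z : ℂ => (z - b) / (z - a)) (𝓝[{z : ℂ | z.im < 0}] (x:ℂ))
      (𝓝[{z : ℂ | z.im < 0}] ((((x - b) / (x - a) : ℝ)) : ℂ)) := by
    rw [tendsto_nhdsWithin_iff]
    refine ⟨(rg_quot_tendsto hx).mono_left nhdsWithin_le_nhds, ?_⟩
    filter_upwards [self_mem_nhdsWithin] with z hz
    have hz' : z.im < 0 := hz
    change ((z - b) / (z - a)).im < 0
    rw [rg_quot_im z (rh_ne_of_im hz'.ne a)]
    have : 0 < b - a := by linarith
    have : 0 < normSq (z - a) := normSq_pos.2 (sub_ne_zero.2 (rh_ne_of_im hz'.ne a))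
    exact div_neg_of_neg_of_pos (by nlinarith) this
  have h2 := (Complex.tendsto_log_nhdsWithin_im_neg_of_re_neg_of_im_zero
    (z := ((((x - b) / (x - a) : ℝ)) : ℂ)) (by rw [Complex.ofReal_re]; exact rg_limit_re hx) (Complex.ofReal_im _)).comp h1
  have h3 := ((h2.div_const (4:ℂ)).cexp)
  rw [rg_abs hx] at h3
  have e : (rv a b x : ℂ) * exp (-(Real.pi * I / 4)) = exp ((Real.log ((b - x) / (x - a)) - Real.pi * I) / 4) := by
    unfold rv
    push_cast
    rw [← Complex.exp_add]
    congr 1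
    ring
  rw [e]
  exact h3

lemma rh_exp_pi4 : exp (Real.pi * I / 4) = I * exp (-(Real.pi * I / 4)) := by
  have h := Complex.exp_pi_div_two_mul_I
  have h2 : exp (Real.pi * I / 4) = exp (Real.pi / 2 * I) * exp (-(Real.pi * I / 4)) := by
    rw [← Complex.exp_add]
    congr 1
    ring
  rw [h2, h]

lemma rh_exp_pi4_sq : exp (Real.pi * I / 4) ^ 2 = I := by
  rw [← Complex.exp_nat_mul]
  refine Eq.trans ?_ Complex.exp_pi_div_two_mul_I
  congr 1
  push_cast
  ring

lemma rh_exp_npi4_sq : exp (-(Real.pi * I / 4)) ^ 2 = -I := by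
  have h := rh_exp_pi4_sq
  rw [rh_exp_pi4] at h
  have h2 := Complex.I_sq
  rw [mul_pow, h2] at h
  linear_combination -h

/-- square root -/
def csq (w : ℂ) : ℂ := exp (log w / 2)

lemma csq_ne (w : ℂ) : csq w ≠ 0 := exp_ne_zero _

lemma csq_sq {w : ℂ} (hw : w ≠ 0) : csq w ^ 2 = w := by
  unfold csq
  rw [← Complex.exp_nat_mul]
  push_cast
  rw [mul_div_cancel₀ _ (by norm_num : (2:ℂ) ≠ 0), exp_log hw]

lemma csq_diff {w : ℂ} (hw : w ∈ slitPlane) : DifferentiableAt ℂ csq w := by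
  unfold csq
  exact ((differentiableAt_id.clog hw).div_const 2).cexp

lemma csq_ofReal {x : ℝ} (hx : 0 < x) : csq x = (Real.sqrt x : ℂ) := by
  unfold csq
  rw [← Complex.ofReal_log hx.le, Real.sqrt_eq_rpow, Real.rpow_def_of_pos hx]
  push_cast
  congr 1
  ring

/-- same side -/
def sameSide (u v : ℂ) : Prop :=
  (0 < u.im ∧ 0 < v.im) ∨ (u.im < 0 ∧ v.im < 0) ∨ ((0 < u.re ∧ u.im = 0) ∧ (0 < v.re ∧ v.im = 0))

lemma rh_log_div {u v : ℂ} (h : sameSide u v) : log (u / v) = log u - log v := by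
  have hu : u ≠ 0 := by rintro rfl; rcases h with h | h | h <;> simp at h
  have hv : v ≠ 0 := by rintro rfl; rcases h with h | h | h <;> simp at h
  have hva : v.arg ≠ Real.pi := by
    rw [Ne, Complex.arg_eq_pi_iff]
    rcases h with h | h | h <;> intro h' <;> linarith [h.2, h.1, h'.1, h'.2] 
  have hvi : v⁻¹.arg = -v.arg := by rw [Complex.arg_inv, if_neg hva]
  rw [div_eq_mul_inv, Complex.log_mul hu (inv_ne_zero hv), Complex.log_inv _ hva, sub_eq_add_neg]
  rw [hvi]
  rcases h with h | h | h
  · have h1 := Complex.arg_mem_Ioc u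
    have h2 := Complex.arg_mem_Ioc v
    have h3 := Complex.arg_nonneg_iff.2 h.1.le
    have h4 := Complex.arg_nonneg_iff.2 h.2.le
    have h5 := lt_of_le_of_ne h2.2 hva
    constructor <;> linarith [h1.2, h1.1]
  · have h1 := Complex.arg_mem_Ioc u
    have h2 := Complex.arg_mem_Ioc v
    have h3 := Complex.arg_neg_iff.2 h.1
    have h4 := Complex.arg_neg_iff.2 h.2
    constructor <;> linarith [h1.2, h1.1, h2.1]
  · have h1 : u.arg = 0 := Complex.arg_eq_zero_iff.2 ⟨h.1.1.le, h.1.2⟩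
    have h2 : v.arg = 0 := Complex.arg_eq_zero_iff.2 ⟨h.2.1.le, h.2.2⟩
    rw [h1, h2]
    constructor <;> linarith [Real.pi_pos]

lemma rr_eq_sq_right {a b : ℝ} {z : ℂ} (h : sameSide (z - b) (z - a)) :
    rr a b z = csq (z - b) * csq (z - a) := by
  have hv : z - a ≠ 0 := by intro h0; rw [h0] at h; rcases h with h | h | h <;> simp at h
  have h1 : rg a b z ^ 2 = csq (z - b) / csq (z - a) := by
    unfold rg csq
    rw [rh_log_div h, ← Complex.exp_nat_mul, ← Complex.exp_sub]
    congr 1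
    push_cast
    ring
  unfold rr
  rw [h1]
  have h2 := csq_sq hv
  have h3 := csq_ne (z - a)
  nth_rewrite 1 [← h2]
  field_simp

lemma rr_eq_sq_left {a b : ℝ} {z : ℂ} (h : sameSide (b - z) (a - z)) :
    rr a b z = - (csq (a - z) * csq (b - z)) := by
  have hv : a - z ≠ 0 := by intro h0; rw [h0] at h; rcases h with h | h | h <;> simp at h
  have h1 : rg a b z ^ 2 = csq (b - z) / csq (a - z) := by
    have : (z - b) / (z - a) = (b - z) / (a - z) := by
      rw [← neg_sub, ← neg_sub (a:ℂ) z, neg_div_neg_eq]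
    unfold rg csq
    rw [this, rh_log_div h, ← Complex.exp_nat_mul, ← Complex.exp_sub]
    congr 1
    push_cast
    ring
  unfold rr
  rw [h1]
  have h2 := csq_sq hv
  have h3 := csq_ne (a - z)
  have : z - a = - (csq (a - z) ^ 2) := by rw [h2]; ring
  rw [this]
  field_simp

lemma rh_tendsto_eq {α β : Type*} [TopologicalSpace β] {f : α → β} {l : Filter α} {x y : β}
    (h : Tendsto f l (𝓝 x)) (e : x = y) : Tendsto f l (𝓝 y) := e ▸ h

/-- ordering hypothesis -/
def RHOrd (N : ℕ) (a b : ℕ → ℝ) : Prop :=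
  1 ≤ N ∧ (∀ k < N, a k < b k) ∧ (∀ k, k + 1 < N → b k < a (k + 1))

lemma RHOrd.pos {N : ℕ} {a b : ℕ → ℝ} (h : RHOrd N a b) : 1 ≤ N := h.1
lemma RHOrd.ab {N : ℕ} {a b : ℕ → ℝ} (h : RHOrd N a b) {k : ℕ} (hk : k < N) : a k < b k := h.2.1 k hk
lemma RHOrd.ba {N : ℕ} {a b : ℕ → ℝ} (h : RHOrd N a b) {k : ℕ} (hk : k + 1 < N) :
    b k < a (k + 1) := h.2.2 k hk

lemma RHOrd.lt {N : ℕ} {a b : ℕ → ℝ} (h : RHOrd N a b) {l k : ℕ} (hlk : l < k) (hk : k < N) :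
    b l < a k := by
  induction k, hlk using Nat.le_induction with
  | base => exact h.ba hk
  | succ m hm ih =>
    have h1 := ih (by omega)
    have h2 := h.ab (k := m) (by omega)
    have h3 := h.ba (k := m) hk
    linarith

lemma RHOrd.a0 {N : ℕ} {a b : ℕ → ℝ} (h : RHOrd N a b) {k : ℕ} (hk : k < N) : a 0 ≤ a k := by
  rcases Nat.eq_zero_or_pos k with rfl | h0
  · rfl
  · have := h.lt h0 hk
    have := h.ab (k := 0) (by omega)
    linarith

lemma RHOrd.bN {N : ℕ} {a b : ℕ → ℝ} (h : RHOrd N a b) {k : ℕ} (hk : k < N) : b k ≤ b (N - 1) := by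
  rcases Nat.lt_or_ge k (N - 1) with h0 | h0
  · have := h.lt h0 (by omega)
    have := h.ab (k := N - 1) (by omega)
    linarith
  · have : k = N - 1 := by omega
    rw [this]

/-- complement of the bands -/
def offCut (N : ℕ) (a b : ℕ → ℝ) : Set ℂ :=
  {z | ∀ k < N, z ∉ Complex.ofReal '' Set.Icc (a k) (b k)}

lemma RHOrd.cutSet_sub {N : ℕ} {a b : ℕ → ℝ} (h : RHOrd N a b) : (cutSet N a b)ᶜ ⊆ offCut N a b := by
  intro z hz k hk hz'
  obtain ⟨x, hx, rfl⟩ := hz'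
  exact hz ⟨x, ⟨(h.a0 hk).trans hx.1, hx.2.trans (h.bN hk)⟩, rfl⟩

lemma rh_closed_seg (c d : ℝ) : IsClosed (Complex.ofReal '' Set.Icc c d) :=
  (isCompact_Icc.image Complex.continuous_ofReal).isClosed

lemma isOpen_cutSet (N : ℕ) (a b : ℕ → ℝ) : IsOpen (cutSet N a b)ᶜ :=
  (rh_closed_seg _ _).isOpen_compl

lemma isOpen_offCut (N : ℕ) (a b : ℕ → ℝ) : IsOpen (offCut N a b) := by
  have : offCut N a b = ⋂ k ∈ Finset.range N, (Complex.ofReal '' Set.Icc (a k) (b k))ᶜ := by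
    ext z; simp [offCut]
  rw [this]
  exact isOpen_biInter_finset fun k _ => (rh_closed_seg _ _).isOpen_compl

lemma rh_im_notin {z : ℂ} (hz : z.im ≠ 0) (s : Set ℝ) : z ∉ Complex.ofReal '' s := by
  rintro ⟨x, _, rfl⟩; simp at hz

lemma rh_im_cutSet {z : ℂ} (hz : z.im ≠ 0) (N : ℕ) (a b : ℕ → ℝ) : z ∈ (cutSet N a b)ᶜ :=
  rh_im_notin hz _

lemma rh_im_offCut {z : ℂ} (hz : z.im ≠ 0) (N : ℕ) (a b : ℕ → ℝ) : z ∈ offCut N a b :=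
  fun _ _ => rh_im_notin hz _

lemma rh_real_offCut {N : ℕ} {a b : ℕ → ℝ} {x : ℝ} (h : ∀ k < N, x < a k ∨ b k < x) :
    (x : ℂ) ∈ offCut N a b := by
  rintro k hk ⟨y, hy, hxy⟩
  have : y = x := by exact_mod_cast hxy
  subst this
  rcases h k hk with h | h
  · linarith [hy.1]
  · linarith [hy.2]

lemma rh_offCut_real {N : ℕ} {a b : ℕ → ℝ} {x : ℝ} (h : (x : ℂ) ∈ offCut N a b) :
    ∀ k < N, x < a k ∨ b k < x := by
  intro k hk
  by_contra! h'
  exact h k hk ⟨x, h', rfl⟩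

lemma RHOrd.cut_side {N : ℕ} {a b : ℕ → ℝ} (h : RHOrd N a b) {k l : ℕ} (hk : k < N) (hl : l < N)
    (hlk : l ≠ k) {x : ℝ} (hx : x ∈ Set.Icc (a k) (b k)) : x < a l ∨ b l < x := by
  rcases lt_or_gt_of_ne hlk with h1 | h1
  · right; linarith [h.lt h1 hk, hx.1]
  · left; linarith [h.lt h1 hl, hx.2]

lemma RHOrd.gap_side {N : ℕ} {a b : ℕ → ℝ} (h : RHOrd N a b) {k l : ℕ} (hk : k + 1 < N) (hl : l < N)
    {x : ℝ} (hx : x ∈ Set.Ioo (b k) (a (k + 1))) : x < a l ∨ b l < x := by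
  rcases Nat.lt_or_ge k l with h1 | h1
  · left
    rcases Nat.lt_or_ge (k+1) l with h2 | h2
    · linarith [h.lt h2 hl, hx.2, h.ab hk]
    · have : l = k + 1 := by omega
      rw [this]; exact hx.2
  · right
    rcases Nat.lt_or_ge l k with h2 | h2
    · linarith [h.lt h2 (by omega : k < N), hx.1, h.ab (by omega : k < N)]
    · have : l = k := by omega
      rw [this]; exact hx.1

lemma RHOrd.gap_off {N : ℕ} {a b : ℕ → ℝ} (h : RHOrd N a b) {k : ℕ} (hk : k + 1 < N)
    {x : ℝ} (hx : x ∈ Set.Ioo (b k) (a (k + 1))) : (x : ℂ) ∈ offCut N a b :=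
  rh_real_offCut fun _ hl => h.gap_side hk hl hx

/-- real trichotomy -/
lemma RHOrd.cases {N : ℕ} {a b : ℕ → ℝ} (h : RHOrd N a b) (x : ℝ) :
    (x : ℂ) ∈ (cutSet N a b)ᶜ ∨ (∃ k < N, x = a k ∨ x = b k) ∨ (∃ k < N, x ∈ Set.Ioo (a k) (b k)) ∨
      (∃ k, k + 1 < N ∧ x ∈ Set.Ioo (b k) (a (k+1))) := by
  by_contra! hc
  obtain ⟨h1, h2, h3, h4⟩ := hc
  have h1' : x ∈ Set.Icc (a 0) (b (N-1)) := by
    simp only [Set.mem_compl_iff, not_not] at h1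
    obtain ⟨y, hy, hyx⟩ := h1
    have : y = x := by exact_mod_cast hyx
    rwa [this] at hy
  have key : ∀ k, k < N → a k < x := by
    intro k
    induction k with
    | zero => intro hk; exact lt_of_le_of_ne h1'.1 (fun e => (h2 0 hk).1 e.symm)
    | succ m ih =>
      intro hk
      have h5 := ih (by omega)
      have h6 : b m < x := by
        by_contra! h7
        exact h3 m (by omega) ⟨h5, lt_of_le_of_ne h7 (h2 m (by omega)).2⟩
      by_contra! h7
      exact h4 m hk ⟨h6, lt_of_le_of_ne h7 (h2 _ hk).1⟩
  have hN := h.pos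
  exact h3 (N-1) (by omega) ⟨key _ (by omega), lt_of_le_of_ne h1'.2 (h2 _ (by omega)).2⟩

/-- product of fourth roots -/
def rG (N : ℕ) (a b : ℕ → ℝ) (z : ℂ) : ℂ := ∏ k ∈ Finset.range N, rg (a k) (b k) z

/-- the square root R -/
def rR (N : ℕ) (a b : ℕ → ℝ) (z : ℂ) : ℂ := ∏ k ∈ Finset.range N, rr (a k) (b k) z

lemma rG_ne (N : ℕ) (a b : ℕ → ℝ) (z : ℂ) : rG N a b z ≠ 0 :=
  Finset.prod_ne_zero_iff.2 fun _ _ => rg_ne _ _ _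

lemma rr_ne {a b : ℝ} {z : ℂ} (hz : z ≠ a) : rr a b z ≠ 0 :=
  mul_ne_zero (sub_ne_zero.2 hz) (pow_ne_zero _ (rg_ne _ _ _))

lemma rR_ne {N : ℕ} {a b : ℕ → ℝ} (h : RHOrd N a b) {z : ℂ} (hz : z ∈ offCut N a b) :
    rR N a b z ≠ 0 := by
  refine Finset.prod_ne_zero_iff.2 fun k hk => rr_ne ?_
  rintro rfl
  exact hz k (Finset.mem_range.1 hk) ⟨a k, ⟨le_rfl, (h.ab (Finset.mem_range.1 hk)).le⟩, rfl⟩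

lemma rG_diff {N : ℕ} {a b : ℕ → ℝ} (h : RHOrd N a b) {z : ℂ} (hz : z ∈ offCut N a b) :
    DifferentiableAt ℂ (rG N a b) z := by
  unfold rG
  refine DifferentiableAt.fun_finsetProd fun k hk => ?_
  exact rg_diff (h.ab (Finset.mem_range.1 hk)) (hz k (Finset.mem_range.1 hk))

lemma rR_diff {N : ℕ} {a b : ℕ → ℝ} (h : RHOrd N a b) {z : ℂ} (hz : z ∈ offCut N a b) :
    DifferentiableAt ℂ (rR N a b) z := by
  unfold rR
  refine DifferentiableAt.fun_finsetProd fun k hk => ?_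
  exact rr_diff (h.ab (Finset.mem_range.1 hk)) (hz k (Finset.mem_range.1 hk))

lemma rR_conj {N : ℕ} {a b : ℕ → ℝ} (h : RHOrd N a b) {z : ℂ} (hz : z ∈ offCut N a b) :
    rR N a b (starRingEnd ℂ z) = starRingEnd ℂ (rR N a b z) := by
  unfold rR
  rw [map_prod]
  exact Finset.prod_congr rfl fun k hk => rr_conj (h.ab (Finset.mem_range.1 hk)) (hz k (Finset.mem_range.1 hk))

lemma rR_real {N : ℕ} {a b : ℕ → ℝ} (h : RHOrd N a b) {x : ℝ} (hz : (x:ℂ) ∈ offCut N a b) :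
    (((rR N a b x).re : ℝ) : ℂ) = rR N a b x := by
  have := rR_conj h hz
  rw [Complex.conj_ofReal] at this
  exact Complex.conj_eq_iff_re.1 this.symm

lemma rG_infty (N : ℕ) (a b : ℕ → ℝ) : Tendsto (rG N a b) (cobounded ℂ) (𝓝 1) := by
  unfold rG
  have := tendsto_finsetProd (Finset.range N) (fun k _ => rg_tendsto_infty (a k) (b k))
  simpa using this

lemma rR_infty (N : ℕ) (a b : ℕ → ℝ) :
    Tendsto (fun z => rR N a b z / z ^ N) (cobounded ℂ) (𝓝 1) := by
  have h1 : ∀ k, Tendsto (fun z => rr (a k) (b k) z / z) (cobounded ℂ) (𝓝 1) := by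
    intro k
    have h2 : Tendsto (fun z : ℂ => (1 - (a k : ℂ) * z⁻¹) * rg (a k) (b k) z ^ 2) (cobounded ℂ)
        (𝓝 ((1 - (a k : ℂ) * 0) * 1 ^ 2)) :=
      (tendsto_const_nhds.sub (tendsto_const_nhds.mul (tendsto_inv₀_cobounded (α := ℂ)))).mul
        ((rg_tendsto_infty (a k) (b k)).pow 2)
    simp only [mul_zero, sub_zero, one_pow, mul_one] at h2
    refine h2.congr' ?_
    filter_upwards [eventually_ne_cobounded (0 : ℂ)] with z hz
    unfold rr
    field_simp
  have := tendsto_finsetProd (Finset.range N) (fun k _ => h1 k)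
  simp only [Finset.prod_const_one] at this
  refine this.congr fun z => ?_
  rw [Finset.prod_div_distrib]
  simp [rR]

lemma rR_bigO (N : ℕ) (a b : ℕ → ℝ) : rR N a b =O[cobounded ℂ] fun z => z ^ N := by
  have h := (rR_infty N a b).isBigO_one ℂ
  have h2 := h.mul (isBigO_refl (fun z : ℂ => z ^ N) (cobounded ℂ))
  refine (h2.congr' ?_ ?_)
  · filter_upwards [eventually_ne_cobounded (0 : ℂ)] with z hz
    field_simp
  · filter_upwards with z
    simp

lemma rR_sq {N : ℕ} {a b : ℕ → ℝ} (h : RHOrd N a b) {z : ℂ} (hz : z ∈ offCut N a b) :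
    rR N a b z ^ 2 = ∏ k ∈ Finset.range N, ((z - a k) * (z - b k)) := by
  unfold rR
  rw [← Finset.prod_pow]
  refine Finset.prod_congr rfl fun k hk => ?_
  have hk := Finset.mem_range.1 hk
  have := h.ab hk
  refine rr_sq ?_ ?_
  · rintro rfl; exact hz k hk ⟨a k, ⟨le_rfl, this.le⟩, rfl⟩
  · rintro rfl; exact hz k hk ⟨b k, ⟨this.le, le_rfl⟩, rfl⟩

/-- the partial products -/
lemma rR_erase (N : ℕ) (a b : ℕ → ℝ) {k : ℕ} (hk : k < N) (z : ℂ) :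
    rR N a b z = rr (a k) (b k) z * ∏ l ∈ (Finset.range N).erase k, rr (a l) (b l) z :=
  (Finset.mul_prod_erase _ _ (Finset.mem_range.2 hk)).symm

lemma rG_erase (N : ℕ) (a b : ℕ → ℝ) {k : ℕ} (hk : k < N) (z : ℂ) :
    rG N a b z = rg (a k) (b k) z * ∏ l ∈ (Finset.range N).erase k, rg (a l) (b l) z :=
  (Finset.mul_prod_erase _ _ (Finset.mem_range.2 hk)).symm

lemma rh_notin_seg {x c d : ℝ} (h : x < c ∨ d < x) : (x : ℂ) ∉ Complex.ofReal '' Set.Icc c d := by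
  rintro ⟨y, hy, hxy⟩
  have : y = x := by exact_mod_cast hxy
  subst this
  rcases h with h | h
  · linarith [hy.1]
  · linarith [hy.2]

/-- the value of the other factors on a band -/
lemma rG_other {N : ℕ} {a b : ℕ → ℝ} (h : RHOrd N a b) {k : ℕ} (hk : k < N) {x : ℝ}
    (hx : x ∈ Set.Icc (a k) (b k)) :
    ∃ u : ℝ, 0 < u ∧ Tendsto (fun z => ∏ l ∈ (Finset.range N).erase k, rg (a l) (b l) z) (𝓝 (x:ℂ)) (𝓝 (u:ℂ)) := by
  refine ⟨∏ l ∈ (Finset.range N).erase k, rgR (a l) (b l) x, Finset.prod_pos fun _ _ => rgR_pos _ _ _, ?_⟩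
  push_cast
  refine tendsto_finsetProd _ fun l hl => ?_
  obtain ⟨hlk, hl⟩ := Finset.mem_erase.1 hl
  have hl := Finset.mem_range.1 hl
  have hs := h.cut_side hk hl hlk hx
  rw [← rg_ofReal (h.ab hl) hs]
  exact (rg_diff (h.ab hl) (rh_notin_seg hs)).continuousAt.tendsto

lemma rR_other {N : ℕ} {a b : ℕ → ℝ} (h : RHOrd N a b) {k : ℕ} (hk : k < N) {x : ℝ}
    (hx : x ∈ Set.Icc (a k) (b k)) :
    ∃ u : ℝ, 0 < u ∧ Tendsto (fun z => ∏ l ∈ (Finset.range N).erase k, rr (a l) (b l) z) (𝓝 (x:ℂ))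
      (𝓝 (((-1) ^ (N - 1 - k) * u : ℝ):ℂ)) := by
  set s : ℕ → ℝ := fun l => if l < k then 1 else -1 with hs
  set r : ℕ → ℝ := fun l => (x - a l) * rgR (a l) (b l) x ^ 2 with hr
  have e1 : ∏ l ∈ (Finset.range N).erase k, s l = (-1) ^ (N - 1 - k) := by
    rw [hs, Finset.prod_ite]
    have : ((Finset.range N).erase k).filter (fun l => ¬ l < k) = Finset.Ico (k+1) N := by
      ext l; simp; omega
    simp only [Finset.prod_const_one, one_mul, Finset.prod_const, this, Nat.card_Ico]
    congr 1
    omega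
  have e2 : ∏ l ∈ (Finset.range N).erase k, r l =
      (-1) ^ (N - 1 - k) * ∏ l ∈ (Finset.range N).erase k, (s l * r l) := by
    rw [Finset.prod_mul_distrib (f := s), e1, ← mul_assoc, ← mul_pow]
    norm_num
  refine ⟨∏ l ∈ (Finset.range N).erase k, (s l * r l), Finset.prod_pos fun l hl => ?_, ?_⟩
  · obtain ⟨hlk, hl⟩ := Finset.mem_erase.1 hl
    have hl := Finset.mem_range.1 hl
    have hp := pow_pos (rgR_pos (a l) (b l) x) 2
    rw [hs, hr]
    dsimp only
    split_ifs with h1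
    · have := h.lt h1 hk
      have := h.ab hl
      have : 0 < x - a l := by linarith [hx.1]
      positivity
    · have := h.lt (lt_of_le_of_ne (not_lt.1 h1) hlk.symm) hl
      have : 0 < a l - x := by linarith [hx.2]
      have : -1 * ((x - a l) * rgR (a l) (b l) x ^ 2) = (a l - x) * rgR (a l) (b l) x ^ 2 := by ring
      rw [this]
      positivity
  · rw [← e2]
    push_cast
    refine tendsto_finsetProd _ fun l hl => ?_
    obtain ⟨hlk, hl⟩ := Finset.mem_erase.1 hl
    have hl := Finset.mem_range.1 hl
    have hs := h.cut_side hk hl hlk hx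
    have : (r l : ℂ) = rr (a l) (b l) x := by
      rw [hr]; unfold rr; rw [rg_ofReal (h.ab hl) hs]; push_cast; rfl
    rw [this]
    exact (rr_diff (h.ab hl) (rh_notin_seg hs)).continuousAt.tendsto

/-- boundary values on the bands -/
lemma rG_cut {N : ℕ} {a b : ℕ → ℝ} (h : RHOrd N a b) {k : ℕ} (hk : k < N) {x : ℝ}
    (hx : x ∈ Set.Ioo (a k) (b k)) :
    ∃ v : ℂ, v ≠ 0 ∧ Tendsto (rG N a b) (𝓝[{z : ℂ | 0 < z.im}] (x:ℂ)) (𝓝 (I * v)) ∧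
      Tendsto (rG N a b) (𝓝[{z : ℂ | z.im < 0}] (x:ℂ)) (𝓝 v) := by
  obtain ⟨u, hu, hl⟩ := rG_other h hk (Set.Ioo_subset_Icc_self hx)
  have e : rG N a b = fun z => rg (a k) (b k) z * ∏ l ∈ (Finset.range N).erase k, rg (a l) (b l) z :=
    funext (rG_erase N a b hk)
  have h1 := (rg_up hx).mul (hl.mono_left nhdsWithin_le_nhds)
  have h2 := (rg_low hx).mul (hl.mono_left nhdsWithin_le_nhds)
  have hv := rv_pos (a k) (b k) x
  refine ⟨rv (a k) (b k) x * exp (-(Real.pi * I / 4)) * u, ?_, ?_, ?_⟩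
  · have := exp_ne_zero (-(Real.pi * I / 4))
    have h3 : (u:ℂ) ≠ 0 := by exact_mod_cast hu.ne'
    have h4 : (rv (a k) (b k) x:ℂ) ≠ 0 := by exact_mod_cast hv.ne'
    positivity
  · rw [e]
    convert h1 using 2
    rw [rh_exp_pi4]; ring
  · rw [e]
    exact h2

lemma rR_cut {N : ℕ} {a b : ℕ → ℝ} (h : RHOrd N a b) {k : ℕ} (hk : k < N) {x : ℝ}
    (hx : x ∈ Set.Ioo (a k) (b k)) :
    ∃ ρ : ℝ, 0 < ρ ∧ Tendsto (rR N a b) (𝓝[{z : ℂ | 0 < z.im}] (x:ℂ)) (𝓝 ((((-1) ^ (N - 1 - k) * ρ : ℝ):ℂ) * I)) ∧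
      Tendsto (rR N a b) (𝓝[{z : ℂ | z.im < 0}] (x:ℂ)) (𝓝 (-((((-1) ^ (N - 1 - k) * ρ : ℝ):ℂ) * I))) := by
  obtain ⟨u, hu, hl⟩ := rR_other h hk (Set.Ioo_subset_Icc_self hx)
  have e : rR N a b = fun z => rr (a k) (b k) z * ∏ l ∈ (Finset.range N).erase k, rr (a l) (b l) z :=
    funext (rR_erase N a b hk)
  have h0 : Tendsto (fun z : ℂ => z - a k) (𝓝 (x:ℂ)) (𝓝 ((x:ℂ) - a k)) :=
    (by fun_prop : Continuous (fun z : ℂ => z - a k)).tendsto _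
  have h1 := ((h0.mono_left nhdsWithin_le_nhds).mul ((rg_up hx).pow 2)).mul (hl.mono_left nhdsWithin_le_nhds)
  have h2 := ((h0.mono_left nhdsWithin_le_nhds).mul ((rg_low hx).pow 2)).mul (hl.mono_left nhdsWithin_le_nhds)
  have hv := rv_pos (a k) (b k) x
  have hxa : 0 < x - a k := by linarith [hx.1]
  refine ⟨(x - a k) * rv (a k) (b k) x ^ 2 * u, by positivity, ?_, ?_⟩
  · rw [e]
    rw [mul_pow, rh_exp_pi4_sq] at h1
    refine rh_tendsto_eq h1 ?_
    push_cast
    ring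
  · rw [e]
    rw [mul_pow, rh_exp_npi4_sq] at h2
    refine rh_tendsto_eq h2 ?_
    push_cast
    ring

/-- endpoint estimates -/
lemma rh_rpow_bdd (p : ℂ) (c : ℂ) {r : ℝ} (hr : 0 ≤ r) :
    (fun z : ℂ => ‖z - c‖ ^ r) =O[𝓝[≠] p] (fun _ => (1:ℝ)) := by
  have : Tendsto (fun z : ℂ => ‖z - c‖ ^ r) (𝓝[≠] p) (𝓝 (‖p - c‖ ^ r)) := by
    refine Tendsto.mono_left ?_ nhdsWithin_le_nhds
    exact (((continuous_id.sub continuous_const).norm).rpow_const (fun _ => Or.inr hr)).tendsto p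
  exact this.isBigO_one ℝ

lemma rh_rpow_bdd_ne (p : ℂ) (c : ℂ) (hc : p ≠ c) (r : ℝ) :
    (fun z : ℂ => ‖z - c‖ ^ r) =O[𝓝[≠] p] (fun _ => (1:ℝ)) := by
  have : Tendsto (fun z : ℂ => ‖z - c‖ ^ r) (𝓝[≠] p) (𝓝 (‖p - c‖ ^ r)) := by
    refine Tendsto.mono_left ?_ nhdsWithin_le_nhds
    have h1 : ContinuousAt (fun z : ℂ => ‖z - c‖) p := by fun_prop
    exact (h1.rpow_const (Or.inl (by rw [Ne, norm_eq_zero, sub_eq_zero]; exact hc))).tendsto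
  exact this.isBigO_one ℝ

lemma rh_one_rpow (p : ℂ) : (fun _ => (1:ℝ)) =O[𝓝[≠] p] (fun z : ℂ => ‖z - p‖ ^ (-(1/4) : ℝ)) := by
  have h := (rh_rpow_bdd p p (r := 1/4) (by norm_num)).mul (isBigO_refl (fun z : ℂ => ‖z - p‖ ^ (-(1/4) : ℝ)) (𝓝[≠] p))
  refine h.congr' ?_ (by filter_upwards with z; simp)
  filter_upwards [self_mem_nhdsWithin] with z hz
  have : 0 < ‖z - p‖ := norm_pos_iff.2 (sub_ne_zero.2 hz)
  rw [← Real.rpow_add this]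
  simp

lemma rg_end {a b p : ℝ} (hab : a < b) (hp : p = a ∨ p = b) :
    (rg a b =O[𝓝[≠] (p:ℂ)] fun z : ℂ => ‖z - p‖ ^ (-(1/4) : ℝ)) ∧
    ((fun z => (rg a b z)⁻¹) =O[𝓝[≠] (p:ℂ)] fun z : ℂ => ‖z - p‖ ^ (-(1/4) : ℝ)) ∧
    (rr a b =O[𝓝[≠] (p:ℂ)] fun z : ℂ => ‖z - p‖ ^ (1/2 : ℝ)) := by
  have hne : ∀ᶠ z : ℂ in 𝓝[≠] (p:ℂ), z ≠ a ∧ z ≠ b := by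
    rcases hp with rfl | rfl
    · have : ∀ᶠ z : ℂ in 𝓝[≠] (p:ℂ), z ≠ b := 
        (eventually_ne_nhds (by exact_mod_cast hab.ne)).filter_mono nhdsWithin_le_nhds
      filter_upwards [self_mem_nhdsWithin, this] with z h1 h2 using ⟨h1, h2⟩
    · have : ∀ᶠ z : ℂ in 𝓝[≠] (p:ℂ), z ≠ a := 
        (eventually_ne_nhds (by exact_mod_cast hab.ne')).filter_mono nhdsWithin_le_nhds
      filter_upwards [self_mem_nhdsWithin, this] with z h1 h2 using ⟨h2, h1⟩
  have hn1 : (fun z => ‖rg a b z‖) =ᶠ[𝓝[≠] (p:ℂ)] fun z : ℂ => ‖z - b‖ ^ (1/4 : ℝ) * ‖z - a‖ ^ (-(1/4) : ℝ) := by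
    filter_upwards [hne] with z hz using rg_norm hz.1 hz.2
  have hn2 : (fun z => ‖(rg a b z)⁻¹‖) =ᶠ[𝓝[≠] (p:ℂ)] fun z : ℂ => ‖z - a‖ ^ (1/4 : ℝ) * ‖z - b‖ ^ (-(1/4) : ℝ) := by
    filter_upwards [hne] with z hz using rg_norm_inv hz.1 hz.2
  have hn3 : (fun z => ‖rr a b z‖) =ᶠ[𝓝[≠] (p:ℂ)] fun z : ℂ => ‖z - a‖ ^ (1/2 : ℝ) * ‖z - b‖ ^ (1/2 : ℝ) := by
    filter_upwards [hne] with z hz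
    rw [← Real.sqrt_eq_rpow, ← Real.sqrt_eq_rpow, ← Real.sqrt_mul (norm_nonneg _), ← norm_mul, ← rr_sq hz.1 hz.2,
      norm_pow, Real.sqrt_sq (norm_nonneg _)]
  rw [← isBigO_norm_left, ← isBigO_norm_left (f' := fun z => (rg a b z)⁻¹), ← isBigO_norm_left (f' := rr a b)]
  rcases hp with rfl | rfl
  · have hb : (p:ℂ) ≠ b := by exact_mod_cast hab.ne
    refine ⟨?_, ?_, ?_⟩
    · refine hn1.trans_isBigO ?_
      simpa using (rh_rpow_bdd p b (r := 1/4) (by norm_num)).mul (isBigO_refl (fun z : ℂ => ‖z - p‖ ^ (-(1/4) : ℝ)) (𝓝[≠] (p:ℂ)))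
    · refine hn2.trans_isBigO ?_
      refine IsBigO.trans ?_ (rh_one_rpow _)
      simpa using (rh_rpow_bdd p p (r := 1/4) (by norm_num)).mul (rh_rpow_bdd_ne p b hb (-(1/4)))
    · refine hn3.trans_isBigO ?_
      simpa using (isBigO_refl (fun z : ℂ => ‖z - p‖ ^ (1/2 : ℝ)) (𝓝[≠] (p:ℂ))).mul (rh_rpow_bdd p b (r := 1/2) (by norm_num))
  · have hb : (p:ℂ) ≠ a := by exact_mod_cast hab.ne'
    refine ⟨?_, ?_, ?_⟩
    · refine hn1.trans_isBigO ?_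
      refine IsBigO.trans ?_ (rh_one_rpow _)
      simpa using (rh_rpow_bdd p p (r := 1/4) (by norm_num)).mul (rh_rpow_bdd_ne p a hb (-(1/4)))
    · refine hn2.trans_isBigO ?_
      simpa using (rh_rpow_bdd p a (r := 1/4) (by norm_num)).mul (isBigO_refl (fun z : ℂ => ‖z - p‖ ^ (-(1/4) : ℝ)) (𝓝[≠] (p:ℂ)))
    · refine hn3.trans_isBigO ?_
      simpa using (rh_rpow_bdd p a (r := 1/2) (by norm_num)).mul (isBigO_refl (fun z : ℂ => ‖z - p‖ ^ (1/2 : ℝ)) (𝓝[≠] (p:ℂ)))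

lemma rG_end {N : ℕ} {a b : ℕ → ℝ} (h : RHOrd N a b) {k : ℕ} (hk : k < N) {p : ℝ}
    (hp : p = a k ∨ p = b k) :
    (rG N a b =O[𝓝[≠] (p:ℂ)] fun z : ℂ => ‖z - p‖ ^ (-(1/4) : ℝ)) ∧
    ((fun z => (rG N a b z)⁻¹) =O[𝓝[≠] (p:ℂ)] fun z : ℂ => ‖z - p‖ ^ (-(1/4) : ℝ)) ∧
    (rR N a b =O[𝓝[≠] (p:ℂ)] fun z : ℂ => ‖z - p‖ ^ (1/2 : ℝ)) := by
  have hpI : p ∈ Set.Icc (a k) (b k) := by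
    have := h.ab hk
    rcases hp with rfl | rfl <;> constructor <;> linarith
  obtain ⟨u, hu, hl⟩ := rG_other h hk hpI
  obtain ⟨v, hv, hl'⟩ := rR_other h hk hpI
  have hu' : (u:ℂ) ≠ 0 := by exact_mod_cast hu.ne'
  obtain ⟨e1, e2, e3⟩ := rg_end (h.ab hk) hp
  refine ⟨?_, ?_, ?_⟩
  · have := e1.mul ((hl.mono_left nhdsWithin_le_nhds).isBigO_one ℝ)
    simp only [mul_one] at this
    exact this.congr_left fun z => (rG_erase N a b hk z).symm
  · have := e2.mul (((hl.inv₀ hu').mono_left nhdsWithin_le_nhds).isBigO_one ℝ)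
    simp only [mul_one] at this
    exact this.congr_left fun z => by rw [rG_erase N a b hk z, mul_inv]
  · have := e3.mul ((hl'.mono_left nhdsWithin_le_nhds).isBigO_one ℝ)
    simp only [mul_one] at this
    exact this.congr_left fun z => (rR_erase N a b hk z).symm

lemma RHOrd.end_mem {N : ℕ} {a b : ℕ → ℝ} (h : RHOrd N a b) {k : ℕ} (hk : k < N) {p : ℝ}
    (hp : p = a k ∨ p = b k) : (p:ℂ) ∈ cutSet N a b := by
  have h1 := h.ab hk
  have h2 := h.a0 hk
  have h3 := h.bN hk
  refine ⟨p, ?_, rfl⟩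
  rcases hp with rfl | rfl <;> constructor <;> linarith

lemma RHOrd.end_le {N : ℕ} {a b : ℕ → ℝ} (h : RHOrd N a b) {k : ℕ} (hk : k < N) {p : ℝ}
    (hp : p = a k ∨ p = b k) : 𝓝[(cutSet N a b)ᶜ] (p:ℂ) ≤ 𝓝[≠] (p:ℂ) := by
  refine nhdsWithin_mono _ ?_
  rintro z hz rfl
  exact hz (h.end_mem hk hp)

lemma RHOrd.im_le (N : ℕ) (a b : ℕ → ℝ) (p : ℂ) : 𝓝[{z : ℂ | z.im ≠ 0}] p ≤ 𝓝[(cutSet N a b)ᶜ] p :=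
  nhdsWithin_mono _ fun _ hz => rh_im_cutSet hz N a b

/-- A row solution of the homogeneous problem (without condition at infinity). -/
structure RHRow (N : ℕ) (a b β : ℕ → ℝ) (f g : ℂ → ℂ) : Prop where
  df : DifferentiableOn ℂ f (cutSet N a b)ᶜ
  dg : DifferentiableOn ℂ g (cutSet N a b)ᶜ
  cut : ∀ k < N, ∀ x ∈ Set.Ioo (a k) (b k), ∃ fp fm : ℂ,
    Tendsto f (𝓝[{z : ℂ | 0 < z.im}] (x : ℂ)) (𝓝 fp) ∧
    Tendsto f (𝓝[{z : ℂ | z.im < 0}] (x : ℂ)) (𝓝 fm) ∧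
    Tendsto g (𝓝[{z : ℂ | 0 < z.im}] (x : ℂ)) (𝓝 fm) ∧
    Tendsto g (𝓝[{z : ℂ | z.im < 0}] (x : ℂ)) (𝓝 (-fp))
  gap : ∀ k, k + 1 < N → ∀ x ∈ Set.Ioo (b k) (a (k + 1)), ∃ fm gm : ℂ,
    Tendsto f (𝓝[{z : ℂ | 0 < z.im}] (x : ℂ)) (𝓝 (exp (-(2 * Real.pi * β k) * I) * fm)) ∧
    Tendsto f (𝓝[{z : ℂ | z.im < 0}] (x : ℂ)) (𝓝 fm) ∧
    Tendsto g (𝓝[{z : ℂ | 0 < z.im}] (x : ℂ)) (𝓝 (exp ((2 * Real.pi * β k) * I) * gm)) ∧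
    Tendsto g (𝓝[{z : ℂ | z.im < 0}] (x : ℂ)) (𝓝 gm)
  ef : ∀ k < N, ∀ p : ℝ, p = a k ∨ p = b k →
    f =O[𝓝[(cutSet N a b)ᶜ] (p:ℂ)] fun z => ‖z - (p : ℂ)‖ ^ (-(1 / 4) : ℝ)
  eg : ∀ k < N, ∀ p : ℝ, p = a k ∨ p = b k →
    g =O[𝓝[(cutSet N a b)ᶜ] (p:ℂ)] fun z => ‖z - (p : ℂ)‖ ^ (-(1 / 4) : ℝ)

lemma RHRow.add {N : ℕ} {a b β : ℕ → ℝ} {f g f' g' : ℂ → ℂ} (h : RHRow N a b β f g)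
    (h' : RHRow N a b β f' g') : RHRow N a b β (fun z => f z + f' z) (fun z => g z + g' z) where
  df := h.df.add h'.df
  dg := h.dg.add h'.dg
  cut := fun k hk x hx => by
    obtain ⟨fp, fm, h1, h2, h3, h4⟩ := h.cut k hk x hx
    obtain ⟨fp', fm', h1', h2', h3', h4'⟩ := h'.cut k hk x hx
    refine ⟨fp + fp', fm + fm', h1.add h1', h2.add h2', h3.add h3', ?_⟩
    exact rh_tendsto_eq (h4.add h4') (by ring)
  gap := fun k hk x hx => by
    obtain ⟨fp, fm, h1, h2, h3, h4⟩ := h.gap k hk x hx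
    obtain ⟨fp', fm', h1', h2', h3', h4'⟩ := h'.gap k hk x hx
    exact ⟨fp + fp', fm + fm', rh_tendsto_eq (h1.add h1') (by ring), h2.add h2',
      rh_tendsto_eq (h3.add h3') (by ring), h4.add h4'⟩
  ef := fun k hk p hp => (h.ef k hk p hp).add (h'.ef k hk p hp)
  eg := fun k hk p hp => (h.eg k hk p hp).add (h'.eg k hk p hp)

lemma RHRow.smul {N : ℕ} {a b β : ℕ → ℝ} {f g : ℂ → ℂ} (h : RHRow N a b β f g) (c : ℂ) :
    RHRow N a b β (fun z => c * f z) (fun z => c * g z) where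
  df := h.df.const_mul c
  dg := h.dg.const_mul c
  cut := fun k hk x hx => by
    obtain ⟨fp, fm, h1, h2, h3, h4⟩ := h.cut k hk x hx
    exact ⟨c * fp, c * fm, h1.const_mul c, h2.const_mul c, h3.const_mul c,
      rh_tendsto_eq (h4.const_mul c) (by ring)⟩
  gap := fun k hk x hx => by
    obtain ⟨fp, fm, h1, h2, h3, h4⟩ := h.gap k hk x hx
    exact ⟨c * fp, c * fm, rh_tendsto_eq (h1.const_mul c) (by ring), h2.const_mul c,
      rh_tendsto_eq (h3.const_mul c) (by ring), h4.const_mul c⟩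
  ef := fun k hk p hp => (h.ef k hk p hp).const_mul_left c
  eg := fun k hk p hp => (h.eg k hk p hp).const_mul_left c

/-- Schwarz reflection -/
def rstar (f : ℂ → ℂ) (z : ℂ) : ℂ := starRingEnd ℂ (f (starRingEnd ℂ z))

lemma rh_conj_cutSet {N : ℕ} {a b : ℕ → ℝ} {z : ℂ} (hz : z ∈ (cutSet N a b)ᶜ) :
    starRingEnd ℂ z ∈ (cutSet N a b)ᶜ := by
  rintro ⟨x, hx, hxz⟩
  refine hz ⟨x, hx, ?_⟩
  have := congrArg (starRingEnd ℂ) hxz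
  simpa using this

lemma rstar_diff {N : ℕ} {a b : ℕ → ℝ} {f : ℂ → ℂ} (h : DifferentiableOn ℂ f (cutSet N a b)ᶜ) :
    DifferentiableOn ℂ (rstar f) (cutSet N a b)ᶜ := by
  intro z hz
  have h1 := (h _ (rh_conj_cutSet hz)).differentiableAt ((isOpen_cutSet N a b).mem_nhds (rh_conj_cutSet hz))
  have : rstar f = starRingEnd ℂ ∘ f ∘ starRingEnd ℂ := rfl
  rw [this]
  have h2 := h1.conj_conj
  simp only [Complex.conj_conj] at h2
  exact h2.differentiableWithinAt

lemma rh_conj_up (x : ℝ) : Tendsto (starRingEnd ℂ) (𝓝[{z : ℂ | 0 < z.im}] (x:ℂ)) (𝓝[{z : ℂ | z.im < 0}] (x:ℂ)) := by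
  rw [tendsto_nhdsWithin_iff]
  constructor
  · have := (Complex.continuous_conj.tendsto (x:ℂ)).mono_left (nhdsWithin_le_nhds (s := {z : ℂ | 0 < z.im}))
    simpa using this
  · filter_upwards [self_mem_nhdsWithin] with z hz
    change (starRingEnd ℂ z).im < 0
    have : 0 < z.im := hz
    simpa using this

lemma rh_conj_low (x : ℝ) : Tendsto (starRingEnd ℂ) (𝓝[{z : ℂ | z.im < 0}] (x:ℂ)) (𝓝[{z : ℂ | 0 < z.im}] (x:ℂ)) := by
  rw [tendsto_nhdsWithin_iff]
  constructor
  · have := (Complex.continuous_conj.tendsto (x:ℂ)).mono_left (nhdsWithin_le_nhds (s := {z : ℂ | z.im < 0}))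
    simpa using this
  · filter_upwards [self_mem_nhdsWithin] with z hz
    change 0 < (starRingEnd ℂ z).im
    have : z.im < 0 := hz
    simpa using this

lemma rh_conj_cs (N : ℕ) (a b : ℕ → ℝ) (x : ℝ) :
    Tendsto (starRingEnd ℂ) (𝓝[(cutSet N a b)ᶜ] (x:ℂ)) (𝓝[(cutSet N a b)ᶜ] (x:ℂ)) := by
  rw [tendsto_nhdsWithin_iff]
  constructor
  · have := (Complex.continuous_conj.tendsto (x:ℂ)).mono_left (nhdsWithin_le_nhds (s := (cutSet N a b)ᶜ))
    simpa using this
  · filter_upwards [self_mem_nhdsWithin] with z hz using rh_conj_cutSet hz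

lemma rstar_up {f : ℂ → ℂ} {x : ℝ} {L : ℂ} (h : Tendsto f (𝓝[{z : ℂ | z.im < 0}] (x:ℂ)) (𝓝 L)) :
    Tendsto (rstar f) (𝓝[{z : ℂ | 0 < z.im}] (x:ℂ)) (𝓝 (starRingEnd ℂ L)) :=
  (Complex.continuous_conj.tendsto _).comp (h.comp (rh_conj_up x))

lemma rstar_low {f : ℂ → ℂ} {x : ℝ} {L : ℂ} (h : Tendsto f (𝓝[{z : ℂ | 0 < z.im}] (x:ℂ)) (𝓝 L)) :
    Tendsto (rstar f) (𝓝[{z : ℂ | z.im < 0}] (x:ℂ)) (𝓝 (starRingEnd ℂ L)) :=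
  (Complex.continuous_conj.tendsto _).comp (h.comp (rh_conj_low x))

lemma rstar_end {N : ℕ} {a b : ℕ → ℝ} {f : ℂ → ℂ} {p : ℝ}
    (h : f =O[𝓝[(cutSet N a b)ᶜ] (p:ℂ)] fun z => ‖z - (p : ℂ)‖ ^ (-(1 / 4) : ℝ)) :
    rstar f =O[𝓝[(cutSet N a b)ᶜ] (p:ℂ)] fun z => ‖z - (p : ℂ)‖ ^ (-(1 / 4) : ℝ) := by
  have h1 := h.comp_tendsto (rh_conj_cs N a b p)
  rw [← isBigO_norm_left] at h1 ⊢
  refine h1.congr (fun z => by simp [rstar]) (fun z => ?_)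
  have : ‖starRingEnd ℂ z - (p:ℂ)‖ = ‖z - (p:ℂ)‖ := by
    rw [← Complex.norm_conj (z - p)]; simp
  simp only [Function.comp, this]

lemma rstar_infty {f : ℂ → ℂ} (h : f =O[cobounded ℂ] fun z => z⁻¹) :
    rstar f =O[cobounded ℂ] fun z => z⁻¹ := by
  have h0 : Tendsto (starRingEnd ℂ) (cobounded ℂ) (cobounded ℂ) := by
    rw [← tendsto_norm_atTop_iff_cobounded]
    simp only [Complex.norm_conj]
    exact tendsto_norm_cobounded_atTop
  have h1 := h.comp_tendsto h0
  rw [← isBigO_norm_left, ← isBigO_norm_right] at h1 ⊢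
  exact h1.congr (fun z => by simp [rstar]) (fun z => by simp)

lemma RHRow.star {N : ℕ} {a b β : ℕ → ℝ} {f g : ℂ → ℂ} (h : RHRow N a b β f g) :
    RHRow N a b β (rstar f) (fun z => -rstar g z) where
  df := rstar_diff h.df
  dg := (rstar_diff h.dg).neg
  cut := fun k hk x hx => by
    obtain ⟨fp, fm, h1, h2, h3, h4⟩ := h.cut k hk x hx
    refine ⟨starRingEnd ℂ fm, starRingEnd ℂ fp, rstar_up h2, rstar_low h1, ?_, ?_⟩
    · exact rh_tendsto_eq (rstar_up h4).neg (by simp)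
    · exact (rstar_low h3).neg
  gap := fun k hk x hx => by
    obtain ⟨fm, gm, h1, h2, h3, h4⟩ := h.gap k hk x hx
    have e : exp (-(2 * Real.pi * β k) * I) * exp ((2 * Real.pi * β k) * I) = 1 := by
      rw [← Complex.exp_add]; simp
    have c1 : starRingEnd ℂ (exp (-(2 * Real.pi * β k) * I)) = exp ((2 * Real.pi * β k) * I) := by
      rw [← Complex.exp_conj]; congr 1; simp [map_ofNat]
    have c2 : starRingEnd ℂ (exp ((2 * Real.pi * β k) * I)) = exp (-(2 * Real.pi * β k) * I) := by
      rw [← Complex.exp_conj]; congr 1; simp [map_ofNat]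
    refine ⟨_, _, ?_, rstar_low h1, ?_, (rstar_low h3).neg⟩
    · refine rh_tendsto_eq (rstar_up h2) ?_
      rw [map_mul, c1, ← mul_assoc, e, one_mul]
    · refine rh_tendsto_eq (rstar_up h4).neg ?_
      rw [map_mul, c2]
      linear_combination (starRingEnd ℂ gm) * e
  ef := fun k hk p hp => rstar_end (h.ef k hk p hp)
  eg := fun k hk p hp => (rstar_end (h.eg k hk p hp)).neg_left

lemma rh_preconn (N : ℕ) (a b : ℕ → ℝ) : IsPreconnected (cutSet N a b)ᶜ := by
  have cU : IsPreconnected {z : ℂ | 0 < z.im} := (convex_halfSpace_im_gt 0).isPreconnected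
  have cL : IsPreconnected {z : ℂ | z.im < 0} := (convex_halfSpace_im_lt 0).isPreconnected
  have cR : IsPreconnected {z : ℂ | b (N-1) < z.re} := (convex_halfSpace_re_gt _).isPreconnected
  have cA : IsPreconnected {z : ℂ | z.re < a 0} := (convex_halfSpace_re_lt _).isPreconnected
  have h1 := IsPreconnected.union (⟨b (N-1) + 1, 1⟩ : ℂ) (by simp) (by simp) cU cR
  have h2 := IsPreconnected.union (⟨b (N-1) + 1, -1⟩ : ℂ) (by right; simp) (by simp) h1 cL
  have h3 := IsPreconnected.union (⟨a 0 - 1, 1⟩ : ℂ) (by left; left; simp) (by simp) h2 cA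
  convert h3 using 1
  ext z
  constructor
  · intro hz
    rcases lt_trichotomy z.im 0 with h | h | h
    · left; right; exact h
    · by_contra hc
      apply hz
      refine ⟨z.re, ⟨?_, ?_⟩, by apply Complex.ext <;> simp [h]⟩
      · by_contra! h'; exact hc (Or.inr h')
      · by_contra! h'; exact hc (Or.inl (Or.inl (Or.inr h')))
    · left; left; left; exact h
  · rintro (((h | h) | h) | h) ⟨x, hx, rfl⟩
    · simp at h
    · simp at h; linarith [hx.2]
    · simp at h
    · simp at h; linarith [hx.1]

lemma rh_im_sup (x : ℂ) : 𝓝[{z : ℂ | z.im ≠ 0}] x = 𝓝[{z : ℂ | 0 < z.im}] x ⊔ 𝓝[{z : ℂ | z.im < 0}] x := by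
  rw [← nhdsWithin_union]
  congr 1
  ext z
  change z.im ≠ 0 ↔ 0 < z.im ∨ z.im < 0
  rw [ne_iff_lt_or_gt]; tauto

lemma rh_up_neBot (x : ℝ) : (𝓝[{z : ℂ | 0 < z.im}] (x:ℂ)).NeBot := by
  rw [← mem_closure_iff_nhdsWithin_neBot, Complex.closure_setOfPred_lt_im]
  simp

lemma rh_low_neBot (x : ℝ) : (𝓝[{z : ℂ | z.im < 0}] (x:ℂ)).NeBot := by
  rw [← mem_closure_iff_nhdsWithin_neBot, Complex.closure_setOfPred_im_lt]
  simp

lemma rh_up_le (x : ℂ) : 𝓝[{z : ℂ | 0 < z.im}] x ≤ 𝓝[{z : ℂ | z.im ≠ 0}] x := by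
  rw [rh_im_sup]; exact le_sup_left
lemma rh_low_le (x : ℂ) : 𝓝[{z : ℂ | z.im < 0}] x ≤ 𝓝[{z : ℂ | z.im ≠ 0}] x := by
  rw [rh_im_sup]; exact le_sup_right

/-- function with zero boundary values on a band vanishes -/
lemma rh_zero_bdry {N : ℕ} {a b : ℕ → ℝ} (h : RHOrd N a b) {g : ℂ → ℂ}
    (hg : DifferentiableOn ℂ g (cutSet N a b)ᶜ)
    (h0 : ∀ x ∈ Set.Ioo (a 0) (b 0), Tendsto g (𝓝[{z : ℂ | z.im ≠ 0}] (x:ℂ)) (𝓝 0)) :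
    ∀ z ∈ (cutSet N a b)ᶜ, g z = 0 := by
  have hab : a 0 < b 0 := h.ab (by have := h.pos; omega)
  set U : Set ℂ := {z : ℂ | a 0 < z.re} ∩ {z : ℂ | z.re < b 0} with hU
  have hUo : IsOpen U := (isOpen_lt continuous_const Complex.continuous_re).inter (isOpen_lt Complex.continuous_re continuous_const)
  have hUc : IsPreconnected U := ((convex_halfSpace_re_gt _).inter (convex_halfSpace_re_lt _)).isPreconnected
  set q : ℂ → ℂ := fun z => if z.im = 0 then 0 else g z with hq
  have hqe : ∀ z : ℂ, z.im ≠ 0 → q =ᶠ[𝓝 z] g := by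
    intro z hz
    filter_upwards [rh_isOpen_im.mem_nhds hz] with w hw
    exact if_neg hw
  have hgd : ∀ z : ℂ, z.im ≠ 0 → DifferentiableAt ℂ q z := fun z hz =>
    ((hg z (rh_im_cutSet hz N a b)).differentiableAt ((isOpen_cutSet N a b).mem_nhds (rh_im_cutSet hz N a b))).congr_of_eventuallyEq (hqe z hz)
  have hqc : ContinuousOn q U := by
    intro z hz
    by_cases hi : z.im = 0
    · obtain ⟨x, rfl⟩ : ∃ x : ℝ, z = x := ⟨z.re, by apply Complex.ext <;> simp [hi]⟩
      apply ContinuousAt.continuousWithinAt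
      have hx : x ∈ Set.Ioo (a 0) (b 0) := ⟨by simpa using hz.1, by simpa using hz.2⟩
      have hq0 : q x = 0 := if_pos (by simp)
      rw [ContinuousAt, hq0]
      have e : 𝓝 (x:ℂ) = 𝓝[{z : ℂ | z.im = 0}] (x:ℂ) ⊔ 𝓝[{z : ℂ | z.im ≠ 0}] (x:ℂ) := by
        rw [← nhdsWithin_union, ← nhdsWithin_univ]
        congr 1
        ext w
        simp [em]
      rw [e]
      refine Tendsto.sup ?_ ?_
      · refine tendsto_const_nhds.congr' ?_
        filter_upwards [self_mem_nhdsWithin] with w hw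
        exact (if_pos hw).symm
      · refine (h0 x hx).congr' ?_
        filter_upwards [self_mem_nhdsWithin] with w hw
        exact (if_neg hw).symm
    · exact (hgd z hi).continuousAt.continuousWithinAt
  have hqd : DifferentiableOn ℂ q U := rh_morera hUo hqc fun z hz => (hgd z hz.2).differentiableWithinAt
  have hqa := hqd.analyticOnNhd hUo
  set x0 : ℝ := (a 0 + b 0) / 2 with hx0
  have hx0U : (x0:ℂ) ∈ U := ⟨by simp [hx0]; linarith, by simp [hx0]; linarith⟩
  have hfr : ∃ᶠ z in 𝓝[≠] (x0:ℂ), q z = 0 := by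
    have ht : Tendsto (fun t : ℝ => (t:ℂ)) (𝓝[≠] x0) (𝓝[≠] (x0:ℂ)) := by
      rw [tendsto_nhdsWithin_iff]
      refine ⟨(Complex.continuous_ofReal.tendsto x0).mono_left nhdsWithin_le_nhds, ?_⟩
      filter_upwards [self_mem_nhdsWithin] with t ht
      intro h; exact ht (Complex.ofReal_injective h)
    refine ht.frequently (Eventually.frequently ?_)
    filter_upwards with t
    exact if_pos (by simp)
  have hz := hqa.eqOn_zero_of_preconnected_of_frequently_eq_zero hUc hx0U hfr
  have hga := hg.analyticOnNhd (isOpen_cutSet N a b)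
  set z0 : ℂ := ⟨x0, 1⟩ with hz0
  have hz0i : z0.im ≠ 0 := by simp [hz0]
  have hz0U : z0 ∈ U := by simpa [hU, hz0] using hx0U
  have := hga.eqOn_zero_of_preconnected_of_eventuallyEq_zero (rh_preconn N a b) (rh_im_cutSet hz0i N a b) (by
    filter_upwards [hUo.mem_nhds hz0U, hqe z0 hz0i] with w h1 h2
    rw [← h2]; exact hz h1)
  exact this

/-- vanishing lemma, symmetric case -/
lemma RHRow.vanish_symm {N : ℕ} {a b β : ℕ → ℝ} (ho : RHOrd N a b) {f g : ℂ → ℂ} (h : RHRow N a b β f g)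
    (hf : f =O[cobounded ℂ] fun z => z⁻¹) (hg : g =O[cobounded ℂ] fun z => z⁻¹)
    (sf : ∀ z, f (starRingEnd ℂ z) = starRingEnd ℂ (f z)) (sg : ∀ z, g (starRingEnd ℂ z) = - starRingEnd ℂ (g z)) :
    ∀ z ∈ (cutSet N a b)ᶜ, f z = 0 ∧ g z = 0 := by
  have hcut : ∀ k < N, ∀ x ∈ Set.Ioo (a k) (b k), ∃ t : ℝ, 0 ≤ t ∧
      Tendsto (fun z => f z * g z * rR N a b z) (𝓝[{z : ℂ | z.im ≠ 0}] (x:ℂ)) (𝓝 ((((-1) ^ (N - 1 - k) * t : ℝ):ℂ) * I)) := by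
    intro k hk x hx
    obtain ⟨fp, fm, h1, h2, h3, h4⟩ := h.cut k hk x hx
    obtain ⟨ρ, hρ, r1, r2⟩ := rR_cut ho hk hx
    have hfm : fm = starRingEnd ℂ fp := by
      have := rstar_low h1
      have e : rstar f = f := by
        funext z; simp [rstar, sf]
      rw [e] at this
      have hnb := rh_low_neBot x
      exact tendsto_nhds_unique h2 this
    have hff : fp * fm = ((normSq fp : ℝ) : ℂ) := by rw [hfm, Complex.mul_conj]
    refine ⟨normSq fp * ρ, mul_nonneg (normSq_nonneg _) hρ.le, ?_⟩
    rw [rh_im_sup]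
    refine Tendsto.sup ?_ ?_
    · refine rh_tendsto_eq ((h1.mul h3).mul r1) ?_
      rw [hff]; push_cast; ring
    · refine rh_tendsto_eq ((h2.mul h4).mul r2) ?_
      have : fm * -fp = - ((normSq fp : ℝ) : ℂ) := by rw [← hff]; ring
      rw [this]; push_cast; ring
  have hfd : ∀ z ∈ (cutSet N a b)ᶜ, DifferentiableAt ℂ (fun z => f z * g z * rR N a b z) z := fun z hz =>
    (((h.df z hz).differentiableAt ((isOpen_cutSet N a b).mem_nhds hz)).mul
      ((h.dg z hz).differentiableAt ((isOpen_cutSet N a b).mem_nhds hz))).mul (rR_diff ho (ho.cutSet_sub hz))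
  set E : Set ℝ := ⋃ k ∈ Finset.range N, {a k, b k} with hE
  have hEf : E.Finite := by
    refine Set.Finite.biUnion (Finset.finite_toSet _) fun k _ => by simp
  have hEm : ∀ x, x ∈ E ↔ ∃ k < N, x = a k ∨ x = b k := by
    intro x; simp [hE]
  obtain ⟨Q, hQ, hQq⟩ := rh_entire (q := fun z => f z * g z * rR N a b z) hEf
    (fun z hz => (hfd z (rh_im_cutSet hz N a b)).differentiableWithinAt) (by
      intro x hx
      rcases ho.cases x with h1 | h1 | ⟨k, hk, h1⟩ | ⟨k, hk, h1⟩
      · exact ⟨_, (hfd x h1).continuousAt.tendsto.mono_left nhdsWithin_le_nhds⟩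
      · exact absurd ((hEm x).2 h1) hx
      · obtain ⟨t, _, ht⟩ := hcut k hk x h1
        exact ⟨_, ht⟩
      · obtain ⟨fm, gm, g1, g2, g3, g4⟩ := h.gap k hk x h1
        have hR := (rR_diff ho (ho.gap_off hk h1)).continuousAt.tendsto
        refine ⟨fm * gm * rR N a b x, ?_⟩
        rw [rh_im_sup]
        refine Tendsto.sup ?_ ?_
        · refine rh_tendsto_eq ((g1.mul g3).mul (hR.mono_left nhdsWithin_le_nhds)) ?_
          have e : exp (-(2 * Real.pi * β k) * I) * exp ((2 * Real.pi * β k) * I) = 1 := by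
            rw [← Complex.exp_add]; simp
          linear_combination fm * gm * rR N a b x * e
        · exact (g2.mul g4).mul (hR.mono_left nhdsWithin_le_nhds)) (by
      intro p hp
      obtain ⟨k, hk, hp⟩ := (hEm p).1 hp
      have e1 := (h.ef k hk p hp).mono (RHOrd.im_le N a b p)
      have e2 := (h.eg k hk p hp).mono (RHOrd.im_le N a b p)
      have e3 := ((rG_end ho hk hp).2.2).mono ((RHOrd.im_le N a b p).trans (ho.end_le hk hp))
      refine ((e1.mul e2).mul e3).congr' EventuallyEq.rfl ?_
      have : ∀ᶠ z : ℂ in 𝓝[{z : ℂ | z.im ≠ 0}] (p:ℂ), z ≠ p :=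
        ((RHOrd.im_le N a b p).trans (ho.end_le hk hp)) self_mem_nhdsWithin
      filter_upwards [this] with z hz
      have : 0 < ‖z - p‖ := norm_pos_iff.2 (sub_ne_zero.2 hz)
      rw [← Real.rpow_add this, ← Real.rpow_add this]
      norm_num)
  have hQlim : ∀ (x : ℝ) (L : ℂ), Tendsto (fun z => f z * g z * rR N a b z) (𝓝[{z : ℂ | z.im ≠ 0}] (x:ℂ)) (𝓝 L) → Q x = L := by
    intro x L hL
    have : (𝓝[{z : ℂ | z.im ≠ 0}] (x:ℂ)).NeBot := (rh_up_neBot x).mono (rh_up_le x)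
    have h1 : Tendsto Q (𝓝[{z : ℂ | z.im ≠ 0}] (x:ℂ)) (𝓝 (Q x)) := (hQ.continuous.tendsto _).mono_left nhdsWithin_le_nhds
    refine tendsto_nhds_unique h1 (hL.congr' ?_)
    filter_upwards [self_mem_nhdsWithin] with z hz using (hQq z hz).symm
  have hQe : ∀ z ∈ (cutSet N a b)ᶜ, Q z = f z * g z * rR N a b z := by
    intro z hz
    by_cases hi : z.im = 0
    · obtain ⟨x, rfl⟩ : ∃ x : ℝ, z = x := ⟨z.re, by apply Complex.ext <;> simp [hi]⟩
      exact hQlim x _ ((hfd x hz).continuousAt.tendsto.mono_left nhdsWithin_le_nhds)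
    · exact hQq z hi
  have hcob : ∀ᶠ z in cobounded ℂ, z ∈ (cutSet N a b)ᶜ := by
    have : IsBounded (cutSet N a b) := (isCompact_Icc.image Complex.continuous_ofReal).isBounded
    exact isBounded_def.1 this
  have hsym : ∀ z, Q (starRingEnd ℂ z) = - starRingEnd ℂ (Q z) := by
    have := Continuous.ext_on rh_dense_im (hQ.continuous.comp Complex.continuous_conj) (Complex.continuous_conj.comp hQ.continuous).neg (by
      intro z hz
      have hz' : z.im ≠ 0 := hz
      have hzc : (starRingEnd ℂ z).im ≠ 0 := by simpa using hz'
      change Q (starRingEnd ℂ z) = - starRingEnd ℂ (Q z)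
      rw [hQq _ hzc, hQq _ hz', sf, sg, rR_conj ho (rh_im_offCut hz' N a b)]
      simp only [map_mul]
      ring)
    intro z
    exact congrFun this z
  have hre : ∀ x : ℝ, (Q x).re = 0 := by
    intro x
    have := congrArg Complex.re (hsym x)
    simp at this
    linarith
  have himc : Continuous (fun x : ℝ => (Q x).im) := Complex.continuous_im.comp (hQ.continuous.comp Complex.continuous_ofReal)
  have him : ∀ k < N, ∀ x ∈ Set.Icc (a k) (b k), 0 ≤ (-1) ^ (N - 1 - k) * (Q x).im := by
    intro k hk x hx
    have hcl : IsClosed {x : ℝ | 0 ≤ (-1) ^ (N - 1 - k) * (Q x).im} := isClosed_le continuous_const (continuous_const.mul himc)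
    have hsub : Set.Ioo (a k) (b k) ⊆ {x : ℝ | 0 ≤ (-1) ^ (N - 1 - k) * (Q x).im} := by
      intro x hx
      obtain ⟨t, ht, hl⟩ := hcut k hk x hx
      have := hQlim x _ hl
      change 0 ≤ (-1) ^ (N - 1 - k) * (Q x).im
      rw [this, Complex.im_ofReal_mul, Complex.I_im, mul_one, ← mul_assoc, ← mul_pow]
      simpa using ht
    have := hcl.closure_subset_iff.2 hsub
    rw [closure_Ioo (ho.ab hk).ne] at this
    exact this hx
  have hzero : ∀ k, k + 1 < N → ∃ x ∈ Set.Icc (b k) (a (k+1)), Q (x : ℝ) = 0 := by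
    intro k hk
    have h1 := him k (by omega) (b k) ⟨(ho.ab (by omega)).le, le_rfl⟩
    have h2 := him (k+1) hk (a (k+1)) ⟨le_rfl, (ho.ab hk).le⟩
    have e : N - 1 - k = (N - 1 - (k+1)) + 1 := by omega
    rw [e, pow_succ] at h1
    have : (0:ℝ) ∈ Set.uIcc ((-1) ^ (N - 1 - (k+1)) * (Q (b k : ℝ)).im) ((-1) ^ (N - 1 - (k+1)) * (Q (a (k+1) : ℝ)).im) := by
      rw [Set.uIcc_of_le (by linarith)]
      exact ⟨by linarith, h2⟩
    have hiv := intermediate_value_uIcc (a := b k) (b := a (k+1)) ((continuous_const.mul himc : Continuous (fun x : ℝ => (-1) ^ (N - 1 - (k+1)) * (Q x).im)).continuousOn) this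
    obtain ⟨x, hx, hx0⟩ := hiv
    rw [Set.uIcc_of_le (ho.ba hk).le] at hx
    refine ⟨x, hx, ?_⟩
    have : (Q x).im = 0 := by
      rcases mul_eq_zero.1 hx0 with h | h
      · exact absurd h (by positivity)
      · exact h
    apply Complex.ext
    · exact hre x
    · exact this
  choose! y hy hy0 using hzero
  have hQ0 : ∀ z, Q z = 0 := by
    refine rh_entire_zero hQ (N - 1) y ?_ (fun i hi => hy0 i (by omega)) ?_
    · have key : ∀ i j, i < j → j < N - 1 → y i < y j := by
        intro i j hij hj
        have h1 := (hy i (by omega)).2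
        have h2 := (hy j (by omega)).1
        have h3 := ho.ab (k := i + 1) (by omega)
        rcases Nat.lt_or_ge (i+1) j with h4 | h4
        · have := ho.lt h4 (by omega)
          have := ho.ab (k := j) (by omega)
          linarith
        · have : j = i + 1 := by omega
          subst this
          linarith
      intro i hi j hj hij
      rcases lt_trichotomy i j with h1 | h1 | h1
      · exact absurd hij (key i j h1 hj).ne
      · exact h1
      · exact absurd hij (key j i h1 hi).ne'
    · have h1 := ((hf.mul hg).mul (rR_bigO N a b))
      refine h1.congr' ?_ ?_
      · filter_upwards [hcob] with z hz using (hQe z hz).symm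
      · filter_upwards [eventually_ne_cobounded (0:ℂ)] with z hz
        have hN := ho.pos
        have : ((N - 1 : ℕ) : ℤ) - 1 = -1 + -1 + N := by omega
        rw [this, zpow_add₀ hz, zpow_add₀ hz]
        simp
  have hfg : ∀ z ∈ (cutSet N a b)ᶜ, f z * g z = 0 := by
    intro z hz
    have := hQe z hz
    rw [hQ0 z] at this
    rcases mul_eq_zero.1 this.symm with h | h
    · exact h
    · exact absurd h (rR_ne ho (ho.cutSet_sub hz))
  have hN := ho.pos
  have hor := AnalyticOnNhd.eq_zero_or_eq_zero_of_mul_eq_zero (h.df.analyticOnNhd (isOpen_cutSet N a b)) (h.dg.analyticOnNhd (isOpen_cutSet N a b)) hfg (rh_preconn N a b)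
  have hlim0 : ∀ {F : ℂ → ℂ} {s : Set ℂ} {x : ℝ} {L : ℂ}, (∀ z ∈ (cutSet N a b)ᶜ, F z = 0) → (s ⊆ {z : ℂ | z.im ≠ 0}) → (𝓝[s] (x:ℂ)).NeBot →
      Tendsto F (𝓝[s] (x:ℂ)) (𝓝 L) → L = 0 := by
    intro F s x L hF hs hne ht
    refine tendsto_nhds_unique ht (tendsto_const_nhds.congr' ?_)
    filter_upwards [self_mem_nhdsWithin] with z hz
    exact (hF z (rh_im_cutSet (hs hz) N a b)).symm
  have hsu : {z : ℂ | 0 < z.im} ⊆ {z : ℂ | z.im ≠ 0} := fun z (hz : 0 < z.im) => hz.ne'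
  have hsl : {z : ℂ | z.im < 0} ⊆ {z : ℂ | z.im ≠ 0} := fun z (hz : z.im < 0) => hz.ne
  rcases hor with h0 | h0
  · have hg0 := rh_zero_bdry ho h.dg (by
      intro x hx
      obtain ⟨fp, fm, h1, h2, h3, h4⟩ := h.cut 0 (by omega) x hx
      have e1 := hlim0 h0 hsu (rh_up_neBot x) h1
      have e2 := hlim0 h0 hsl (rh_low_neBot x) h2
      rw [rh_im_sup]
      refine Tendsto.sup ?_ ?_
      · rwa [e2] at h3
      · rw [e1, neg_zero] at h4; exact h4)
    exact fun z hz => ⟨h0 z hz, hg0 z hz⟩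
  · have hg0 := rh_zero_bdry ho h.df (by
      intro x hx
      obtain ⟨fp, fm, h1, h2, h3, h4⟩ := h.cut 0 (by omega) x hx
      have e1 := hlim0 h0 hsu (rh_up_neBot x) h3
      have e2 := neg_eq_zero.1 (hlim0 h0 hsl (rh_low_neBot x) h4)
      rw [rh_im_sup]
      refine Tendsto.sup ?_ ?_
      · rwa [e2] at h1
      · rwa [e1] at h2)
    exact fun z hz => ⟨hg0 z hz, h0 z hz⟩

/-- vanishing lemma -/
lemma RHRow.vanish {N : ℕ} {a b β : ℕ → ℝ} (ho : RHOrd N a b) {f g : ℂ → ℂ} (h : RHRow N a b β f g)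
    (hf : f =O[cobounded ℂ] fun z => z⁻¹) (hg : g =O[cobounded ℂ] fun z => z⁻¹) :
    ∀ z ∈ (cutSet N a b)ᶜ, f z = 0 ∧ g z = 0 := by
  have h1 := h.add h.star
  have h2 := (h.add (h.star.smul (-1))).smul I
  have v1 := h1.vanish_symm ho (hf.add (rstar_infty hf)) (hg.add (rstar_infty hg).neg_left)
    (by intro z; simp [rstar, add_comm]) (by intro z; simp [rstar])
  have v2 := h2.vanish_symm ho ((hf.add ((rstar_infty hf).const_mul_left _)).const_mul_left _)
    ((hg.add ((rstar_infty hg).neg_left.const_mul_left _)).const_mul_left _)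
    (by intro z; simp [rstar]; ring) (by intro z; simp [rstar]; ring)
  intro z hz
  obtain ⟨a1, a2⟩ := v1 z hz
  obtain ⟨b1, b2⟩ := v2 z hz
  have b1 := (mul_eq_zero.1 b1).resolve_left Complex.I_ne_zero
  have b2 := (mul_eq_zero.1 b2).resolve_left Complex.I_ne_zero
  constructor
  · linear_combination (a1 + b1) / 2
  · linear_combination (a2 + b2) / 2

lemma rh_divis (U : Set ℂ) (hU : IsOpen U) (l : List ℂ) :
    ∀ {V : Type} [AddCommGroup V] [Module ℂ V] [FiniteDimensional ℂ V] (T : V →ₗ[ℂ] (ℂ → ℂ))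
    (_ : ∀ v, DifferentiableOn ℂ (T v) U) (_ : ∀ p ∈ l, p ∈ U),
    ∃ W : Submodule ℂ V, Module.finrank ℂ V ≤ Module.finrank ℂ W + l.length ∧
      ∀ w ∈ W, ∃ q : ℂ → ℂ, DifferentiableOn ℂ q U ∧ ∀ z, T w z = (l.map (fun p => z - p)).prod * q z := by
  induction l with
  | nil =>
    intro V _ _ _ T hT _
    refine ⟨⊤, by simp, fun w _ => ⟨T w, hT w, fun z => by simp⟩⟩
  | cons p l ih =>
    intro V _ _ _ T hT hl
    have hp : p ∈ U := hl p (by simp)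
    set ev : V →ₗ[ℂ] ℂ := (LinearMap.proj p).comp T with hev
    have hevv : ∀ v, ev v = T v p := fun v => rfl
    have hd : ∀ v, DifferentiableAt ℂ (T v) p := fun v => (hT v p hp).differentiableAt (hU.mem_nhds hp)
    set T0 : (LinearMap.ker ev) →ₗ[ℂ] (ℂ → ℂ) :=
      { toFun := fun w => dslope (T w) p
        map_add' := by
          intro u v
          funext z
          by_cases hz : z = p
          · subst hz
            simp only [dslope_same, Pi.add_apply, Submodule.coe_add, map_add]
            exact deriv_add (hd _) (hd _)
          · simp only [dslope_of_ne _ hz, Pi.add_apply, Submodule.coe_add, map_add, slope_def_field]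
            ring
        map_smul' := by
          intro c v
          funext z
          by_cases hz : z = p
          · subst hz
            simp only [dslope_same, Pi.smul_apply, Submodule.coe_smul, map_smul, RingHom.id_apply]
            exact deriv_const_smul c (hd _)
          · simp only [dslope_of_ne _ hz, Pi.smul_apply, Submodule.coe_smul, map_smul, slope_def_field, RingHom.id_apply, smul_eq_mul]
            ring } with hT0
    obtain ⟨W, hW1, hW2⟩ := ih T0 (by
      intro v
      exact (Complex.differentiableOn_dslope (hU.mem_nhds hp)).2 (hT v)) (fun q hq => hl q (by simp [hq]))
    refine ⟨W.map (LinearMap.ker ev).subtype, ?_, ?_⟩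
    · have h1 : Module.finrank ℂ (W.map (LinearMap.ker ev).subtype) = Module.finrank ℂ W :=
        (Submodule.equivMapOfInjective _ (Submodule.injective_subtype _) W).finrank_eq.symm
      have h2 := LinearMap.finrank_range_add_finrank_ker ev
      have h3 : Module.finrank ℂ (LinearMap.range ev) ≤ 1 := by
        have := Submodule.finrank_le (LinearMap.range ev)
        simpa using this
      rw [h1]
      simp only [List.length_cons]
      omega
    · rintro _ ⟨w, hw, rfl⟩
      obtain ⟨q, hq1, hq2⟩ := hW2 w hw
      refine ⟨q, hq1, fun z => ?_⟩
      have h0 : T w p = 0 := w.2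
      have h1 := sub_smul_dslope (T w) p z
      rw [h0, sub_zero] at h1
      change T w z = _
      rw [← h1, smul_eq_mul]
      have := hq2 z
      change dslope (T w) p z = _ at this
      rw [this]
      simp [mul_assoc]

/-- the scalar function with poles -/
def rE {n : ℕ} (x y : Fin n → ℝ) (ψ : ℂ → ℂ) (z : ℂ) : ℂ := (∏ i, ((z - y i) / (z - x i))) * ψ z

/-- properties of the auxiliary scalar function -/
structure RHPsi (N : ℕ) (a b β : ℕ → ℝ) (n : ℕ) (x y : Fin n → ℝ) (ψ : ℂ → ℂ) : Prop where
  hx : ∀ i, b (N - 1) < x i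
  hy : ∀ i, b (N - 1) < y i
  ne : ∀ z, ψ z ≠ 0
  d : DifferentiableOn ℂ ψ (cutSet N a b)ᶜ
  cut : ∀ k < N, ∀ t ∈ Set.Ioo (a k) (b k), ∃ c : ℂ, c ≠ 0 ∧
    Tendsto (rE x y ψ) (𝓝[{z : ℂ | 0 < z.im}] (t : ℂ)) (𝓝 c) ∧
    Tendsto (rE x y ψ) (𝓝[{z : ℂ | z.im < 0}] (t : ℂ)) (𝓝 c⁻¹)
  gap : ∀ k, k + 1 < N → ∀ t ∈ Set.Ioo (b k) (a (k + 1)), ∃ c : ℂ, c ≠ 0 ∧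
    Tendsto (rE x y ψ) (𝓝[{z : ℂ | 0 < z.im}] (t : ℂ))
      (𝓝 (exp (-(2 * Real.pi * β k) * I) * c)) ∧
    Tendsto (rE x y ψ) (𝓝[{z : ℂ | z.im < 0}] (t : ℂ)) (𝓝 c)
  e1 : ∀ k < N, ∀ p : ℝ, p = a k ∨ p = b k → ψ =O[𝓝[(cutSet N a b)ᶜ] (p:ℂ)] fun _ => (1:ℝ)
  e2 : ∀ k < N, ∀ p : ℝ, p = a k ∨ p = b k → (fun z => (ψ z)⁻¹) =O[𝓝[(cutSet N a b)ᶜ] (p:ℂ)] fun _ => (1:ℝ)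
  i1 : ψ =O[cobounded ℂ] fun _ => (1:ℝ)
  i2 : (fun z => (ψ z)⁻¹) =O[cobounded ℂ] fun _ => (1:ℝ)

lemma rh_cob_cutSet (N : ℕ) (a b : ℕ → ℝ) : ∀ᶠ z in cobounded ℂ, z ∈ (cutSet N a b)ᶜ := by
  have : IsBounded (cutSet N a b) := (isCompact_Icc.image Complex.continuous_ofReal).isBounded
  exact isBounded_def.1 this

lemma rh_inv_lim {f : ℂ → ℂ} (h : f =O[cobounded ℂ] fun z => z⁻¹) : Tendsto f (cobounded ℂ) (𝓝 0) :=
  h.trans_tendsto (tendsto_inv₀_cobounded (α := ℂ))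

/-- upgrade of a limit at infinity -/
lemma rh_rate {f : ℂ → ℂ} (hd : ∀ᶠ z in cobounded ℂ, DifferentiableAt ℂ f z) {L : ℂ}
    (hL : Tendsto f (cobounded ℂ) (𝓝 L)) : (fun z => f z - L) =O[cobounded ℂ] fun z => z⁻¹ := by
  obtain ⟨c, hc⟩ := rh_infty hd (hL.isBigO_one ℝ)
  have h1 := rh_inv_lim hc
  have h2 : Tendsto (fun z => f z - c) (cobounded ℂ) (𝓝 (L - c)) := hL.sub_const c
  have := tendsto_nhds_unique h1 h2
  rw [eq_comm, sub_eq_zero] at this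
  rwa [this]

lemma RHPsi.lim {N : ℕ} {a b β : ℕ → ℝ} {n : ℕ} {x y : Fin n → ℝ} {ψ : ℂ → ℂ} (h : RHPsi N a b β n x y ψ) :
    ∃ c : ℂ, c ≠ 0 ∧ Tendsto ψ (cobounded ℂ) (𝓝 c) := by
  obtain ⟨c, hc⟩ := rh_infty (f := ψ) (by
    filter_upwards [rh_cob_cutSet N a b] with z hz
    exact (h.d z hz).differentiableAt ((isOpen_cutSet N a b).mem_nhds hz)) h.i1
  have h1 : Tendsto ψ (cobounded ℂ) (𝓝 c) := by
    have := (rh_inv_lim hc).add_const c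
    simpa using this
  refine ⟨c, ?_, h1⟩
  rintro rfl
  have h2 : (fun z => ψ z * (ψ z)⁻¹) =O[cobounded ℂ] fun z => ‖ψ z‖ * 1 := by
    exact (isBigO_refl ψ _).norm_right.mul h.i2
  have h3 : Tendsto (fun z => ψ z * (ψ z)⁻¹) (cobounded ℂ) (𝓝 0) := by
    refine h2.trans_tendsto ?_
    simpa using h1.norm
  have h4 : Tendsto (fun _ : ℂ => (1:ℂ)) (cobounded ℂ) (𝓝 0) := h3.congr fun z => mul_inv_cancel₀ (h.ne z)
  exact one_ne_zero (tendsto_nhds_unique tendsto_const_nhds h4)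

/-- polynomials by coefficients -/
def rP {m : ℕ} (v : Fin (m + 1) → ℂ) (z : ℂ) : ℂ := ∑ i, v i * z ^ (i : ℕ)

lemma rP_diff {m : ℕ} (v : Fin (m + 1) → ℂ) : Differentiable ℂ (rP v) := by
  unfold rP; fun_prop

lemma rP_lim {m : ℕ} (v : Fin (m + 1) → ℂ) :
    Tendsto (fun z => rP v z / z ^ m) (cobounded ℂ) (𝓝 (v (Fin.last m))) := by
  have h1 : ∀ i : Fin (m+1), Tendsto (fun z : ℂ => v i * z ^ (i:ℕ) / z ^ m) (cobounded ℂ)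
      (𝓝 (if i = Fin.last m then v i else 0)) := by
    intro i
    split_ifs with hi
    · refine tendsto_const_nhds.congr' ?_
      filter_upwards [eventually_ne_cobounded (0:ℂ)] with z hz
      rw [hi]
      simp [hz]
    · have hlt : (i:ℕ) < m := lt_of_le_of_ne (Nat.lt_succ_iff.1 i.2) (fun e => hi (Fin.ext e))
      have h2 : Tendsto (fun z : ℂ => v i * (z⁻¹) ^ (m - i)) (cobounded ℂ) (𝓝 (v i * 0 ^ (m - (i:ℕ)))) :=
        tendsto_const_nhds.mul ((tendsto_inv₀_cobounded (α := ℂ)).pow _)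
      rw [zero_pow (by omega), mul_zero] at h2
      refine h2.congr' ?_
      filter_upwards [eventually_ne_cobounded (0:ℂ)] with z hz
      have : z ^ m = z ^ (m - (i:ℕ)) * z ^ (i:ℕ) := by rw [← pow_add]; congr 1; omega
      rw [this, inv_pow]
      field_simp
  have := tendsto_finsetSum Finset.univ (fun i _ => h1 i)
  simp only [Finset.sum_ite_eq', Finset.mem_univ, if_true] at this
  refine this.congr fun z => ?_
  rw [rP, Finset.sum_div]

lemma rP_zero {m : ℕ} {v : Fin (m + 1) → ℂ} {s : Set ℂ} (hs : s.Infinite) (h : ∀ z ∈ s, rP v z = 0) : v = 0 := by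
  set P : Polynomial ℂ := ∑ i, Polynomial.C (v i) * Polynomial.X ^ (i : ℕ) with hP
  have hev : ∀ z, P.eval z = rP v z := by
    intro z; simp [hP, Polynomial.eval_finsetSum, rP]
  have h0 : P = 0 := Polynomial.eq_zero_of_infinite_isRoot P (hs.mono fun z hz => by
    change P.eval z = 0
    rw [hev]; exact h z hz)
  funext i
  have : P.coeff i = v i := by
    simp only [hP, Polynomial.finsetSum_coeff, Polynomial.coeff_C_mul, Polynomial.coeff_X_pow]
    rw [Finset.sum_eq_single i]
    · simp
    · intro j _ hj
      rw [if_neg (fun e => hj (Fin.ext e.symm))]; simp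
    · simp
  rw [← this, h0]; simp

/-- product over nodes -/
def rX {n : ℕ} (x : Fin n → ℝ) (z : ℂ) : ℂ := ∏ i, (z - x i)

lemma rX_diff {n : ℕ} (x : Fin n → ℝ) : Differentiable ℂ (rX x) := by
  unfold rX; fun_prop

lemma rX_ne {n : ℕ} {x : Fin n → ℝ} {c : ℝ} (h : ∀ i, c < x i) {z : ℂ} (hz : z.re ≤ c ∨ z.im ≠ 0) : rX x z ≠ 0 := by
  refine Finset.prod_ne_zero_iff.2 fun i _ => ?_
  intro h0
  rw [sub_eq_zero] at h0
  rcases hz with hz | hz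
  · rw [h0, Complex.ofReal_re] at hz; linarith [h i]
  · rw [h0] at hz; simp at hz

lemma rX_ev {n : ℕ} {x : Fin n → ℝ} {c : ℝ} (h : ∀ i, c < x i) {t : ℝ} (ht : t ≤ c) :
    ∀ᶠ z in 𝓝 (t:ℂ), rX x z ≠ 0 :=
  (rX_diff x).continuous.continuousAt.eventually_ne (rX_ne h (Or.inl (by simpa using ht)))

lemma rX_infty {n : ℕ} (x : Fin n → ℝ) : Tendsto (fun z => z ^ n / rX x z) (cobounded ℂ) (𝓝 1) := by
  have h1 : ∀ i, Tendsto (fun z : ℂ => (1 - (x i : ℂ) * z⁻¹)⁻¹) (cobounded ℂ) (𝓝 1) := by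
    intro i
    have : Tendsto (fun z : ℂ => (1 - (x i : ℂ) * z⁻¹)⁻¹) (cobounded ℂ) (𝓝 (1 - (x i : ℂ) * 0)⁻¹) :=
      (tendsto_const_nhds.sub (tendsto_const_nhds.mul (tendsto_inv₀_cobounded (α := ℂ)))).inv₀ (by simp)
    simpa using this
  have h2 := tendsto_finsetProd Finset.univ (fun i _ => h1 i)
  simp only [Finset.prod_const_one] at h2
  refine h2.congr' ?_
  filter_upwards [eventually_ne_cobounded (0:ℂ)] with z hz
  have : z ^ n = ∏ i : Fin n, z := by simp
  rw [this, rX, ← Finset.prod_div_distrib]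
  refine Finset.prod_congr rfl fun i _ => ?_
  have : z - x i = z * (1 - (x i:ℂ) * z⁻¹) := by field_simp
  rw [this, ← div_div, div_self hz, one_div]

/-- node list -/
def rL {n : ℕ} (x : Fin n → ℝ) : List ℂ := (List.ofFn fun i => (x i : ℂ)) ++ (List.ofFn fun i => (x i : ℂ))

lemma rL_prod {n : ℕ} (x : Fin n → ℝ) (z : ℂ) : ((rL x).map (fun p => z - p)).prod = rX x z ^ 2 := by
  simp [rL, rX, List.map_ofFn, List.prod_ofFn, sq]

lemma rL_len {n : ℕ} (x : Fin n → ℝ) : (rL x).length = 2 * n := by simp [rL]; ring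

lemma rL_mem {N : ℕ} {a b : ℕ → ℝ} {n : ℕ} {x : Fin n → ℝ} (h : ∀ i, b (N-1) < x i) : ∀ p ∈ rL x, p ∈ (cutSet N a b)ᶜ := by
  intro p hp
  obtain ⟨i, rfl⟩ : ∃ i, (x i : ℂ) = p := by simpa [rL, List.mem_ofFn] using hp
  exact rh_notin_seg (Or.inr (h i))

/-- the numerator functions -/
def rF0 (N : ℕ) (a b : ℕ → ℝ) {m : ℕ} (v : (Fin (m+1) → ℂ) × (Fin (m+1) → ℂ)) (z : ℂ) : ℂ :=
  rP v.1 z * rG N a b z + rP v.2 z * (rG N a b z)⁻¹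
def rH0 (N : ℕ) (a b : ℕ → ℝ) {m : ℕ} (v : (Fin (m+1) → ℂ) × (Fin (m+1) → ℂ)) (z : ℂ) : ℂ :=
  -I * (rP v.1 z * rG N a b z - rP v.2 z * (rG N a b z)⁻¹)

lemma rP_add {m : ℕ} (v w : Fin (m + 1) → ℂ) (z : ℂ) : rP (v + w) z = rP v z + rP w z := by
  simp [rP, add_mul, Finset.sum_add_distrib]
lemma rP_smul {m : ℕ} (c : ℂ) (v : Fin (m + 1) → ℂ) (z : ℂ) : rP (c • v) z = c * rP v z := by
  simp [rP, Finset.mul_sum, mul_assoc]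

lemma rF0_diff {N : ℕ} {a b : ℕ → ℝ} (ho : RHOrd N a b) {m : ℕ} (v : (Fin (m+1) → ℂ) × (Fin (m+1) → ℂ)) :
    DifferentiableOn ℂ (rF0 N a b v) (cutSet N a b)ᶜ := fun z hz => by
  have h1 := rG_diff ho (ho.cutSet_sub hz)
  exact ((((rP_diff v.1) z).mul h1).add (((rP_diff v.2) z).mul (h1.inv (rG_ne _ _ _ _)))).differentiableWithinAt

lemma rH0_diff {N : ℕ} {a b : ℕ → ℝ} (ho : RHOrd N a b) {m : ℕ} (v : (Fin (m+1) → ℂ) × (Fin (m+1) → ℂ)) :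
    DifferentiableOn ℂ (rH0 N a b v) (cutSet N a b)ᶜ := fun z hz => by
  have h1 := rG_diff ho (ho.cutSet_sub hz)
  exact (((((rP_diff v.1) z).mul h1).sub (((rP_diff v.2) z).mul (h1.inv (rG_ne _ _ _ _)))).const_mul _).differentiableWithinAt

lemma rF0_end {N : ℕ} {a b : ℕ → ℝ} (ho : RHOrd N a b) {m : ℕ} (v : (Fin (m+1) → ℂ) × (Fin (m+1) → ℂ))
    {k : ℕ} (hk : k < N) {p : ℝ} (hp : p = a k ∨ p = b k) :
    (rF0 N a b v =O[𝓝[(cutSet N a b)ᶜ] (p:ℂ)] fun z => ‖z - (p : ℂ)‖ ^ (-(1 / 4) : ℝ)) ∧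
    (rH0 N a b v =O[𝓝[(cutSet N a b)ᶜ] (p:ℂ)] fun z => ‖z - (p : ℂ)‖ ^ (-(1 / 4) : ℝ)) := by
  obtain ⟨e1, e2, -⟩ := rG_end ho hk hp
  have e1 := e1.mono (ho.end_le hk hp)
  have e2 := e2.mono (ho.end_le hk hp)
  have hP : ∀ w : Fin (m+1) → ℂ, rP w =O[𝓝[(cutSet N a b)ᶜ] (p:ℂ)] fun _ => (1:ℝ) := fun w =>
    ((((rP_diff w).continuous.tendsto (p:ℂ)).mono_left nhdsWithin_le_nhds).isBigO_one ℝ)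
  have f1 := (hP v.1).mul e1
  have f2 := (hP v.2).mul e2
  simp only [one_mul] at f1 f2
  exact ⟨f1.add f2, (f1.sub f2).const_mul_left _⟩

/-- row from divisible numerators -/
lemma rh_row {N : ℕ} {a b β : ℕ → ℝ} (ho : RHOrd N a b) {n : ℕ} {x y : Fin n → ℝ} {ψ : ℂ → ℂ}
    (hψ : RHPsi N a b β n x y ψ) {v : (Fin (2*n+1) → ℂ) × (Fin (2*n+1) → ℂ)} {f g : ℂ → ℂ}
    (hf : DifferentiableOn ℂ f (cutSet N a b)ᶜ) (hg : DifferentiableOn ℂ g (cutSet N a b)ᶜ)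
    (ef : ∀ z, rF0 N a b v z * ψ z = rX x z ^ 2 * f z) (eg : ∀ z, rH0 N a b v z * (ψ z)⁻¹ = rX y z ^ 2 * g z) :
    RHRow N a b β f g := by
  have hf' : ∀ z, rX x z ≠ 0 → rX y z ≠ 0 → f z = rF0 N a b v z * rE x y ψ z * (rX x z * rX y z)⁻¹ := by
    intro z h1 h2
    have h3 : rE x y ψ z = rX y z / rX x z * ψ z := by
      rw [rE, Finset.prod_div_distrib]; rfl
    have h4 : rF0 N a b v z * rE x y ψ z = (rF0 N a b v z * ψ z) * (rX y z / rX x z) := by rw [h3]; ring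
    rw [h4, ef]
    field_simp
  have hg' : ∀ z, rX x z ≠ 0 → rX y z ≠ 0 → g z = rH0 N a b v z * (rE x y ψ z)⁻¹ * (rX x z * rX y z)⁻¹ := by
    intro z h1 h2
    have h3 : rE x y ψ z = rX y z / rX x z * ψ z := by
      rw [rE, Finset.prod_div_distrib]; rfl
    have h4 : rH0 N a b v z * (rE x y ψ z)⁻¹ = (rH0 N a b v z * (ψ z)⁻¹) * (rX x z / rX y z) := by
      rw [h3, mul_inv, inv_div]; ring
    rw [h4, eg]
    field_simp
  have hD : ∀ t : ℝ, t ≤ b (N-1) → Tendsto (fun z => (rX x z * rX y z)⁻¹) (𝓝 (t:ℂ)) (𝓝 (rX x t * rX y t)⁻¹) := by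
    intro t ht
    have h1 := rX_ne hψ.hx (z := (t:ℂ)) (Or.inl (by simpa using ht))
    have h2 := rX_ne hψ.hy (z := (t:ℂ)) (Or.inl (by simpa using ht))
    exact (((rX_diff x).continuous.tendsto _).mul ((rX_diff y).continuous.tendsto _)).inv₀ (mul_ne_zero h1 h2)
  have hfe : ∀ t : ℝ, t ≤ b (N-1) → (fun z => rF0 N a b v z * rE x y ψ z * (rX x z * rX y z)⁻¹) =ᶠ[𝓝 (t:ℂ)] f := by
    intro t ht
    filter_upwards [rX_ev hψ.hx ht, rX_ev hψ.hy ht] with z h1 h2 using (hf' z h1 h2).symm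
  have hge : ∀ t : ℝ, t ≤ b (N-1) → (fun z => rH0 N a b v z * (rE x y ψ z)⁻¹ * (rX x z * rX y z)⁻¹) =ᶠ[𝓝 (t:ℂ)] g := by
    intro t ht
    filter_upwards [rX_ev hψ.hx ht, rX_ev hψ.hy ht] with z h1 h2 using (hg' z h1 h2).symm
  have lf : ∀ (t : ℝ) (s : Set ℂ) (L c : ℂ), t ≤ b (N-1) → Tendsto (rF0 N a b v) (𝓝[s] (t:ℂ)) (𝓝 L) →
      Tendsto (rE x y ψ) (𝓝[s] (t:ℂ)) (𝓝 c) → Tendsto f (𝓝[s] (t:ℂ)) (𝓝 (L * c * (rX x t * rX y t)⁻¹)) := by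
    intro t s L c ht h1 h2
    exact ((h1.mul h2).mul ((hD t ht).mono_left nhdsWithin_le_nhds)).congr' ((hfe t ht).filter_mono nhdsWithin_le_nhds)
  have lg : ∀ (t : ℝ) (s : Set ℂ) (L c : ℂ), t ≤ b (N-1) → Tendsto (rH0 N a b v) (𝓝[s] (t:ℂ)) (𝓝 L) →
      c ≠ 0 → Tendsto (rE x y ψ) (𝓝[s] (t:ℂ)) (𝓝 c) → Tendsto g (𝓝[s] (t:ℂ)) (𝓝 (L * c⁻¹ * (rX x t * rX y t)⁻¹)) := by
    intro t s L c ht h1 hc h2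
    exact ((h1.mul (h2.inv₀ hc)).mul ((hD t ht).mono_left nhdsWithin_le_nhds)).congr' ((hge t ht).filter_mono nhdsWithin_le_nhds)
  have lP : ∀ (w : Fin (2*n+1) → ℂ) (t : ℝ) (s : Set ℂ), Tendsto (rP w) (𝓝[s] (t:ℂ)) (𝓝 (rP w t)) := fun w t s =>
    ((rP_diff w).continuous.tendsto _).mono_left nhdsWithin_le_nhds
  have lF0 : ∀ (t : ℝ) (s : Set ℂ) (L : ℂ), L ≠ 0 → Tendsto (rG N a b) (𝓝[s] (t:ℂ)) (𝓝 L) →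
      Tendsto (rF0 N a b v) (𝓝[s] (t:ℂ)) (𝓝 (rP v.1 t * L + rP v.2 t * L⁻¹)) := fun t s L hL h =>
    ((lP _ t s).mul h).add ((lP _ t s).mul (h.inv₀ hL))
  have lH0 : ∀ (t : ℝ) (s : Set ℂ) (L : ℂ), L ≠ 0 → Tendsto (rG N a b) (𝓝[s] (t:ℂ)) (𝓝 L) →
      Tendsto (rH0 N a b v) (𝓝[s] (t:ℂ)) (𝓝 (-I * (rP v.1 t * L - rP v.2 t * L⁻¹))) := fun t s L hL h =>
    (((lP _ t s).mul h).sub ((lP _ t s).mul (h.inv₀ hL))).const_mul _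
  refine ⟨hf, hg, ?_, ?_, ?_, ?_⟩
  · intro k hk t ht
    have htb : t ≤ b (N-1) := ht.2.le.trans (ho.bN hk)
    obtain ⟨u, hu, u1, u2⟩ := rG_cut ho hk ht
    obtain ⟨c, hc, c1, c2⟩ := hψ.cut k hk t ht
    have hIu : I * u ≠ 0 := mul_ne_zero I_ne_zero hu
    have hc' := inv_ne_zero hc
    refine ⟨_, _, lf t _ _ _ htb (lF0 t _ _ hIu u1) c1, lf t _ _ _ htb (lF0 t _ _ hu u2) c2, ?_, ?_⟩
    · refine rh_tendsto_eq (lg t _ _ _ htb (lH0 t _ _ hIu u1) hc c1) ?_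
      rw [mul_inv, Complex.inv_I]
      linear_combination (-(rP v.1 t * u + rP v.2 t * u⁻¹) * c⁻¹ * (rX x t * rX y t)⁻¹) * Complex.I_sq
    · refine rh_tendsto_eq (lg t _ _ _ htb (lH0 t _ _ hu u2) hc' c2) ?_
      rw [mul_inv I u, Complex.inv_I, inv_inv]
      linear_combination 0 * Complex.I_sq
  · intro k hk t ht
    have htb : t ≤ b (N-1) := ht.2.le.trans ((ho.ab hk).le.trans (ho.bN hk))
    obtain ⟨c, hc, c1, c2⟩ := hψ.gap k hk t ht
    have hG := (rG_diff ho (ho.gap_off hk ht)).continuousAt.tendsto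
    have hGn := rG_ne N a b t
    have hexp := exp_ne_zero (-(2 * Real.pi * β k) * I)
    have hinv : (exp (-(2 * Real.pi * β k) * I))⁻¹ = exp ((2 * Real.pi * β k) * I) := by
      rw [← Complex.exp_neg]; congr 1; ring
    refine ⟨_, _, ?_, lf t _ _ _ htb (lF0 t _ _ hGn (hG.mono_left nhdsWithin_le_nhds)) c2, ?_,
      lg t _ _ _ htb (lH0 t _ _ hGn (hG.mono_left nhdsWithin_le_nhds)) hc c2⟩
    · refine rh_tendsto_eq (lf t _ _ _ htb (lF0 t _ _ hGn (hG.mono_left nhdsWithin_le_nhds)) c1) ?_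
      ring
    · refine rh_tendsto_eq (lg t _ _ _ htb (lH0 t _ _ hGn (hG.mono_left nhdsWithin_le_nhds)) (mul_ne_zero hexp hc) c1) ?_
      rw [mul_inv, hinv]
      ring
  · intro k hk p hp
    have hpb : p ≤ b (N-1) := by
      have h1 := ho.bN hk
      have h2 := ho.ab hk
      rcases hp with rfl | rfl <;> linarith
    have h1 := (rF0_end ho v hk hp).1.mul (hψ.e1 k hk p hp)
    have hX : Tendsto (fun z => (rX x z ^ 2)⁻¹) (𝓝[(cutSet N a b)ᶜ] (p:ℂ)) (𝓝 (rX x p ^ 2)⁻¹) :=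
      ((((rX_diff x).continuous.tendsto _).pow 2).inv₀ (pow_ne_zero _ (rX_ne hψ.hx (Or.inl (by simpa using hpb))))).mono_left nhdsWithin_le_nhds
    have h2 := h1.mul (hX.isBigO_one ℝ)
    simp only [mul_one] at h2
    refine h2.congr' ?_ EventuallyEq.rfl
    filter_upwards [(rX_ev hψ.hx hpb).filter_mono nhdsWithin_le_nhds] with z hz
    rw [ef]; field_simp
  · intro k hk p hp
    have hpb : p ≤ b (N-1) := by
      have h1 := ho.bN hk
      have h2 := ho.ab hk
      rcases hp with rfl | rfl <;> linarith
    have h1 := (rF0_end ho v hk hp).2.mul (hψ.e2 k hk p hp)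
    have hX : Tendsto (fun z => (rX y z ^ 2)⁻¹) (𝓝[(cutSet N a b)ᶜ] (p:ℂ)) (𝓝 (rX y p ^ 2)⁻¹) :=
      ((((rX_diff y).continuous.tendsto _).pow 2).inv₀ (pow_ne_zero _ (rX_ne hψ.hy (Or.inl (by simpa using hpb))))).mono_left nhdsWithin_le_nhds
    have h2 := h1.mul (hX.isBigO_one ℝ)
    simp only [mul_one] at h2
    refine h2.congr' ?_ EventuallyEq.rfl
    filter_upwards [(rX_ev hψ.hy hpb).filter_mono nhdsWithin_le_nhds] with z hz
    rw [eg]; field_simp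

lemma rF0_infty (N : ℕ) (a b : ℕ → ℝ) {n : ℕ} {x : Fin n → ℝ} {c : ℝ} (hx : ∀ i, c < x i) {ψ : ℂ → ℂ} {L : ℂ}
    (hL : Tendsto ψ (cobounded ℂ) (𝓝 L))
    {v : (Fin (2*n+1) → ℂ) × (Fin (2*n+1) → ℂ)} {f : ℂ → ℂ}
    (ef : ∀ z, rF0 N a b v z * ψ z = rX x z ^ 2 * f z) :
    Tendsto f (cobounded ℂ) (𝓝 ((v.1 (Fin.last _) + v.2 (Fin.last _)) * L)) := by
  have hG := rG_infty N a b
  have h1 := ((((rP_lim v.1).mul hG).add ((rP_lim v.2).mul (hG.inv₀ one_ne_zero))).mul hL).mul ((rX_infty x).pow 2)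
  refine (rh_tendsto_eq h1 (by simp)).congr' ?_
  have hX : ∀ᶠ z in cobounded ℂ, rX x z ≠ 0 := by
    have := (rX_infty x).eventually_ne one_ne_zero
    filter_upwards [this] with z hz h0
    rw [h0] at hz; simp at hz
  filter_upwards [hX, eventually_ne_cobounded (0:ℂ)] with z h1 h2
  have e : f z = (rF0 N a b v z * ψ z) / rX x z ^ 2 := by rw [ef]; field_simp
  rw [e, rF0, pow_mul' z 2 n]
  field_simp

lemma rH0_infty (N : ℕ) (a b : ℕ → ℝ) {n : ℕ} {x : Fin n → ℝ} {c : ℝ} (hx : ∀ i, c < x i) {ψ : ℂ → ℂ} {L : ℂ}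
    (hL : Tendsto ψ (cobounded ℂ) (𝓝 L)) (hL0 : L ≠ 0)
    {v : (Fin (2*n+1) → ℂ) × (Fin (2*n+1) → ℂ)} {f : ℂ → ℂ}
    (ef : ∀ z, rH0 N a b v z * (ψ z)⁻¹ = rX x z ^ 2 * f z) :
    Tendsto f (cobounded ℂ) (𝓝 (-I * (v.1 (Fin.last _) - v.2 (Fin.last _)) * L⁻¹)) := by
  have hG := rG_infty N a b
  have h1 := (((((rP_lim v.1).mul hG).sub ((rP_lim v.2).mul (hG.inv₀ one_ne_zero))).const_mul (-I)).mul (hL.inv₀ hL0)).mul ((rX_infty x).pow 2)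
  refine (rh_tendsto_eq h1 (by simp)).congr' ?_
  have hX : ∀ᶠ z in cobounded ℂ, rX x z ≠ 0 := by
    have := (rX_infty x).eventually_ne one_ne_zero
    filter_upwards [this] with z hz h0
    rw [h0] at hz; simp at hz
  filter_upwards [hX, eventually_ne_cobounded (0:ℂ)] with z h1 h2
  have e : f z = (rH0 N a b v z * (ψ z)⁻¹) / rX x z ^ 2 := by rw [ef]; field_simp
  rw [e, rH0, pow_mul' z 2 n]
  field_simp

lemma rh_rows {N : ℕ} {a b β : ℕ → ℝ} (ho : RHOrd N a b) {n : ℕ} {x y : Fin n → ℝ} {ψ : ℂ → ℂ}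
    (hψ : RHPsi N a b β n x y ψ) (s t : ℂ) : ∃ f g : ℂ → ℂ, RHRow N a b β f g ∧
      ((fun z => f z - s) =O[cobounded ℂ] fun z => z⁻¹) ∧ ((fun z => g z - t) =O[cobounded ℂ] fun z => z⁻¹) := by
  obtain ⟨L, hL0, hL⟩ := hψ.lim
  have hU := isOpen_cutSet N a b
  set T1 : ((Fin (2*n+1) → ℂ) × (Fin (2*n+1) → ℂ)) →ₗ[ℂ] (ℂ → ℂ) :=
    { toFun := fun v z => rF0 N a b v z * ψ z
      map_add' := by intro u v; funext z; simp [rF0, rP_add]; ring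
      map_smul' := by intro c v; funext z; simp [rF0, rP_smul]; ring } with hT1
  set T2 : ((Fin (2*n+1) → ℂ) × (Fin (2*n+1) → ℂ)) →ₗ[ℂ] (ℂ → ℂ) :=
    { toFun := fun v z => rH0 N a b v z * (ψ z)⁻¹
      map_add' := by intro u v; funext z; simp [rH0, rP_add]; ring
      map_smul' := by intro c v; funext z; simp [rH0, rP_smul]; ring } with hT2
  obtain ⟨W1, hW1, hq1⟩ := rh_divis _ hU (rL x) T1 (fun v => (rF0_diff ho v).mul hψ.d) (rL_mem hψ.hx)
  obtain ⟨W2, hW2, hq2⟩ := rh_divis _ hU (rL y) (T2.comp W1.subtype)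
    (fun v => (rH0_diff ho v.1).mul (hψ.d.inv fun z _ => hψ.ne z)) (rL_mem hψ.hy)
  rw [rL_len] at hW1 hW2
  have hVf : Module.finrank ℂ ((Fin (2*n+1) → ℂ) × (Fin (2*n+1) → ℂ)) = 2 * (2 * n + 1) := by
    rw [Module.finrank_prod]; simp; ring
  have hrow : ∀ w : W2, ∃ f g : ℂ → ℂ, RHRow N a b β f g ∧
      (∀ z, rF0 N a b w.1.1 z * ψ z = rX x z ^ 2 * f z) ∧ (∀ z, rH0 N a b w.1.1 z * (ψ z)⁻¹ = rX y z ^ 2 * g z) ∧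
      ((fun z => f z - (w.1.1.1 (Fin.last _) + w.1.1.2 (Fin.last _)) * L) =O[cobounded ℂ] fun z => z⁻¹) ∧
      ((fun z => g z - (-I * (w.1.1.1 (Fin.last _) - w.1.1.2 (Fin.last _)) * L⁻¹)) =O[cobounded ℂ] fun z => z⁻¹) := by
    intro w
    obtain ⟨f, hf, ef⟩ := hq1 w.1.1 w.1.2
    obtain ⟨g, hg, eg⟩ := hq2 w.1 w.2
    simp only [rL_prod] at ef eg
    have ef' : ∀ z, rF0 N a b w.1.1 z * ψ z = rX x z ^ 2 * f z := ef
    have eg' : ∀ z, rH0 N a b w.1.1 z * (ψ z)⁻¹ = rX y z ^ 2 * g z := eg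
    refine ⟨f, g, rh_row ho hψ hf hg ef' eg', ef', eg', rh_rate ?_ (rF0_infty N a b hψ.hx hL ef'), rh_rate ?_ (rH0_infty N a b hψ.hy hL hL0 eg')⟩
    · filter_upwards [rh_cob_cutSet N a b] with z hz
      exact (hf z hz).differentiableAt (hU.mem_nhds hz)
    · filter_upwards [rh_cob_cutSet N a b] with z hz
      exact (hg z hz).differentiableAt (hU.mem_nhds hz)
  set τ : W2 →ₗ[ℂ] (ℂ × ℂ) :=
    { toFun := fun w => (w.1.1.1 (Fin.last _), w.1.1.2 (Fin.last _))
      map_add' := by intro u v; rfl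
      map_smul' := by intro c v; rfl } with hτ
  have hinj : Function.Injective τ := by
    rw [injective_iff_map_eq_zero]
    intro w hw
    have t1 : w.1.1.1 (Fin.last _) = 0 := congrArg Prod.fst hw
    have t2 : w.1.1.2 (Fin.last _) = 0 := congrArg Prod.snd hw
    obtain ⟨f, g, hr, ef, eg, i1, i2⟩ := hrow w
    rw [t1, t2] at i1 i2
    simp only [add_zero, sub_zero, zero_mul, mul_zero] at i1 i2
    have hv := hr.vanish ho i1 i2
    have hz : ∀ z ∈ {z : ℂ | z.im ≠ 0}, rP w.1.1.1 z = 0 ∧ rP w.1.1.2 z = 0 := by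
      intro z hz
      obtain ⟨v1, v2⟩ := hv z (rh_im_cutSet hz N a b)
      have e1 := ef z
      have e2 := eg z
      rw [v1, mul_zero] at e1
      rw [v2, mul_zero] at e2
      have e1 := (mul_eq_zero.1 e1).resolve_right (hψ.ne z)
      have e2 := (mul_eq_zero.1 e2).resolve_right (inv_ne_zero (hψ.ne z))
      have e2 := (mul_eq_zero.1 e2).resolve_left (neg_ne_zero.2 I_ne_zero)
      have hG := rG_ne N a b z
      unfold rF0 at e1
      constructor
      · have : rP w.1.1.1 z * rG N a b z = 0 := by linear_combination (e1 + e2) / 2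
        exact (mul_eq_zero.1 this).resolve_right hG
      · have : rP w.1.1.2 z * (rG N a b z)⁻¹ = 0 := by linear_combination (e1 - e2) / 2
        exact (mul_eq_zero.1 this).resolve_right (inv_ne_zero hG)
    have hinf : {z : ℂ | z.im ≠ 0}.Infinite := by
      have : Set.Infinite (Set.range fun k : ℕ => (⟨k, 1⟩ : ℂ)) := Set.infinite_range_of_injective (by
        intro i j h
        have := congrArg Complex.re h
        simpa using this)
      refine this.mono ?_
      rintro _ ⟨k, rfl⟩
      change (1:ℝ) ≠ 0
      norm_num
    have p1 := rP_zero hinf fun z h => (hz z h).1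
    have p2 := rP_zero hinf fun z h => (hz z h).2
    apply Subtype.ext
    apply Subtype.ext
    exact Prod.ext p1 p2
  have hfr : Module.finrank ℂ W2 = Module.finrank ℂ (ℂ × ℂ) := by
    have h1 := LinearMap.finrank_le_finrank_of_injective hinj
    have h2 : Module.finrank ℂ (ℂ × ℂ) = 2 := by simp
    omega
  have hsurj : Function.Surjective τ := by
    rw [← LinearMap.range_eq_top]
    exact Submodule.eq_top_of_finrank_eq ((LinearMap.finrank_range_of_inj hinj).trans hfr)
  obtain ⟨w, hw⟩ := hsurj ((s * L⁻¹ + I * t * L) / 2, (s * L⁻¹ - I * t * L) / 2)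
  have t1 : w.1.1.1 (Fin.last _) = (s * L⁻¹ + I * t * L) / 2 := congrArg Prod.fst hw
  have t2 : w.1.1.2 (Fin.last _) = (s * L⁻¹ - I * t * L) / 2 := congrArg Prod.snd hw
  obtain ⟨f, g, hr, ef, eg, i1, i2⟩ := hrow w
  refine ⟨f, g, hr, ?_, ?_⟩
  · convert i1 using 3
    rw [t1, t2]; field_simp; ring
  · convert i2 using 3
    rw [t1, t2]
    have : -I * ((s * L⁻¹ + I * t * L) / 2 - (s * L⁻¹ - I * t * L) / 2) * L⁻¹ = -(I * I) * t * (L * L⁻¹) := by ring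
    rw [this, I_mul_I, mul_inv_cancel₀ hL0]; ring

lemma rh_final {N : ℕ} {a b β : ℕ → ℝ} (ho : RHOrd N a b) {n : ℕ} {x y : Fin n → ℝ} {ψ : ℂ → ℂ}
    (hψ : RHPsi N a b β n x y ψ) : ∃ M : ℂ → Matrix (Fin 2) (Fin 2) ℂ, IsModelRHSolution N a b β M := by
  obtain ⟨f1, g1, r1, i11, i12⟩ := rh_rows ho hψ 1 0
  obtain ⟨f2, g2, r2, i21, i22⟩ := rh_rows ho hψ 0 1
  have hlim : ∀ {l : Filter ℂ} {x11 x12 x21 x22 : ℂ}, Tendsto f1 l (𝓝 x11) → Tendsto g1 l (𝓝 x12) → Tendsto f2 l (𝓝 x21) →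
      Tendsto g2 l (𝓝 x22) → Tendsto (fun z => !![f1 z, g1 z; f2 z, g2 z]) l (𝓝 !![x11, x12; x21, x22]) := by
    intro l x11 x12 x21 x22 h1 h2 h3 h4
    refine tendsto_pi_nhds.2 fun i => tendsto_pi_nhds.2 fun j => ?_
    fin_cases i <;> fin_cases j <;> simpa
  have hU := isOpen_cutSet N a b
  refine ⟨fun z => !![f1 z, g1 z; f2 z, g2 z], ?_, ?_, ?_, ?_, ?_⟩
  · intro i j
    fin_cases i <;> fin_cases j
    · exact r1.df.analyticOnNhd hU
    · exact r1.dg.analyticOnNhd hU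
    · exact r2.df.analyticOnNhd hU
    · exact r2.dg.analyticOnNhd hU
  · intro k hk t ht
    obtain ⟨fp, fm, h1, h2, h3, h4⟩ := r1.cut k hk t ht
    obtain ⟨fp', fm', h1', h2', h3', h4'⟩ := r2.cut k hk t ht
    refine ⟨_, _, hlim h1 h3 h1' h3', hlim h2 h4 h2' h4', ?_⟩
    ext i j
    fin_cases i <;> fin_cases j <;> simp [Matrix.mul_apply, Fin.sum_univ_two]
  · intro k hk t ht
    obtain ⟨fp, fm, h1, h2, h3, h4⟩ := r1.gap k hk t ht
    obtain ⟨fp', fm', h1', h2', h3', h4'⟩ := r2.gap k hk t ht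
    refine ⟨_, _, hlim h1 h3 h1' h3', hlim h2 h4 h2' h4', ?_⟩
    ext i j
    fin_cases i <;> fin_cases j <;> simp [Matrix.mul_apply, Fin.sum_univ_two, gapJump, mul_comm]
  · intro i j
    fin_cases i <;> fin_cases j
    · simpa using i11
    · simpa using i12
    · simpa using i21
    · simpa using i22
  · intro k hk p hp i j
    have hp' : p = a k ∨ p = b k := by simpa using hp
    fin_cases i <;> fin_cases j
    · exact r1.ef k hk p hp'
    · exact r1.eg k hk p hp'
    · exact r2.ef k hk p hp'
    · exact r2.eg k hk p hp'

lemma csq_re {w : ℂ} (hw : w.im ≠ 0) : 0 < (csq w).re := by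
  unfold csq
  rw [Complex.exp_re]
  have h : (Complex.log w / 2).im = w.arg / 2 := by
    rw [Complex.div_ofNat_im, Complex.log_im]
  rw [h]
  refine mul_pos (Real.exp_pos _) (Real.cos_pos_of_mem_Ioo ⟨?_, ?_⟩)
  · have := Complex.neg_pi_lt_arg w; linarith
  · have h1 := Complex.arg_le_pi w
    have h2 : w.arg ≠ Real.pi := by
      intro h; rw [Complex.arg_eq_pi_iff] at h; exact hw h.2
    have := lt_of_le_of_ne h1 h2
    linarith

lemma csq_im {w : ℂ} (hw : w.im ≠ 0) : w.im = 2 * (csq w).re * (csq w).im := by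
  have h := csq_sq (w := w) (by rintro rfl; simp at hw)
  conv_lhs => rw [← h]
  rw [sq, Complex.mul_im]; ring

lemma csq_norm {w : ℂ} (hw : w ≠ 0) : ‖csq w‖ ^ 2 = ‖w‖ := by
  rw [← norm_pow, csq_sq hw]

lemma csq_int {d : ℝ} (hd : 0 < d) : IntervalIntegrable (fun t : ℝ => (csq (t:ℂ))⁻¹) MeasureTheory.volume 0 d := by
  have h : IntervalIntegrable (fun t : ℝ => (((t ^ (-(1/2) : ℝ) : ℝ)) : ℂ)) MeasureTheory.volume 0 d := by
    have h0 : IntervalIntegrable (fun t : ℝ => t ^ (-(1/2) : ℝ)) MeasureTheory.volume 0 d :=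
      intervalIntegral.intervalIntegrable_rpow' (by norm_num)
    exact ⟨h0.1.ofReal, h0.2.ofReal⟩
  refine h.congr ?_
  intro t ht
  rw [Set.uIoc_of_le hd.le] at ht
  change ((t ^ (-(1/2) : ℝ) : ℝ) : ℂ) = (csq (t:ℂ))⁻¹
  rw [csq_ofReal ht.1, Real.rpow_neg ht.1.le, ← Real.sqrt_eq_rpow]
  push_cast; rfl

/-- explicit integral -/
lemma rh_sqrt_int {d : ℝ} (hd : 0 < d) {ζ : ℂ} (hζ : ζ.im ≠ 0) :
    csq ζ * ∫ t in (0:ℝ)..d, (csq (t:ℂ))⁻¹ * ((t:ℂ) - ζ)⁻¹ =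
      Complex.log (Real.sqrt d - csq ζ) - Complex.log (Real.sqrt d + csq ζ) - (Complex.log (-csq ζ) - Complex.log (csq ζ)) := by
  set w := csq ζ with hw
  have hre : 0 < w.re := csq_re hζ
  have him : w.im ≠ 0 := by
    intro h; have := csq_im hζ; rw [← hw, h, mul_zero] at this; exact hζ this
  have hww : w ^ 2 = ζ := csq_sq (by rintro rfl; simp at hζ)
  have hs1 : ∀ x : ℝ, (x:ℂ) - w ∈ slitPlane := fun x => Or.inr (by simpa using him)
  have hs2 : ∀ x : ℝ, 0 ≤ x → (x:ℂ) + w ∈ slitPlane := fun x hx => Or.inl (by simp; linarith)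
  have hderiv : ∀ t ∈ Set.Ioo 0 d, HasDerivAt (fun t : ℝ => Complex.log (Real.sqrt t - w) - Complex.log (Real.sqrt t + w))
      (w * ((csq (t:ℂ))⁻¹ * ((t:ℂ) - ζ)⁻¹)) t := by
    intro t ht
    have h1 : HasDerivAt (fun t : ℝ => ((Real.sqrt t : ℝ) : ℂ)) (((1 / (2 * Real.sqrt t) : ℝ)) : ℂ) t :=
      (Real.hasDerivAt_sqrt ht.1.ne').ofReal_comp
    have h2 := (h1.sub_const w).clog_real (hs1 _)
    have h3 := (h1.add_const w).clog_real (hs2 _ (Real.sqrt_nonneg _))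
    refine (h2.sub h3).congr_deriv ?_
    have hsq : ((Real.sqrt t : ℝ) : ℂ) ^ 2 = t := by
      rw [← Complex.ofReal_pow, Real.sq_sqrt ht.1.le]
    have n1 : ((Real.sqrt t : ℝ) : ℂ) ≠ 0 := by
      exact_mod_cast (Real.sqrt_pos.2 ht.1).ne'
    have n2 := slitPlane_ne_zero (hs1 (Real.sqrt t))
    have n3 := slitPlane_ne_zero (hs2 (Real.sqrt t) (Real.sqrt_nonneg _))
    rw [csq_ofReal ht.1, ← hsq, ← hww]
    have e : ((Real.sqrt t : ℝ) : ℂ) ^ 2 - w ^ 2 = (Real.sqrt t - w) * (Real.sqrt t + w) := by ring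
    rw [e]
    push_cast
    field_simp
    ring
  have hcont : ContinuousOn (fun t : ℝ => Complex.log (Real.sqrt t - w) - Complex.log (Real.sqrt t + w)) (Set.Icc 0 d) := by
    have hc : Continuous fun t : ℝ => ((Real.sqrt t : ℝ) : ℂ) := Complex.continuous_ofReal.comp Real.continuous_sqrt
    refine ContinuousOn.sub ?_ ?_
    · exact (hc.sub continuous_const).continuousOn.clog fun t _ => hs1 _
    · exact (hc.add continuous_const).continuousOn.clog fun t _ => hs2 _ (Real.sqrt_nonneg _)
  have hIntg : IntervalIntegrable (fun t : ℝ => w * ((csq (t:ℂ))⁻¹ * ((t:ℂ) - ζ)⁻¹)) MeasureTheory.volume 0 d := by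
    refine ((csq_int hd).mul_continuousOn ?_).const_mul w
    refine ContinuousOn.inv₀ (by fun_prop) ?_
    intro t _ h
    apply hζ
    have := congrArg Complex.im h
    simpa using this
  rw [← intervalIntegral.integral_const_mul, intervalIntegral.integral_eq_sub_of_hasDerivAt_of_le hd.le hcont hderiv hIntg]
  simp

def rK (H : ℂ → ℂ) (d : ℝ) (ζ : ℂ) : ℂ := ∫ t in (0:ℝ)..d, (csq (t:ℂ))⁻¹ * (-(dslope H t ζ) / H t)

def rJ (H : ℂ → ℂ) (d : ℝ) (ζ : ℂ) : ℂ :=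
  csq ζ * H ζ * ∫ t in (0:ℝ)..d, (csq (t:ℂ) * H t)⁻¹ * ((t:ℂ) - ζ)⁻¹

section
variable {H : ℂ → ℂ} {U : Set ℂ} {d : ℝ}

lemma rK_cont (hU : IsOpen U) (hH : DifferentiableOn ℂ H U) (h0 : ∀ z ∈ U, H z ≠ 0) (hd : 0 < d)
    (hs : ∀ t ∈ Set.Icc 0 d, (t:ℂ) ∈ U) : ContinuousOn (fun p : ℂ × ℝ => -(dslope H p.2 p.1) / H p.2) (U ×ˢ Set.uIcc 0 d) := by
  rw [Set.uIcc_of_le hd.le]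
  have h1 := rh_continuousOn_dslope hU hH
  have h2 : ContinuousOn (fun p : ℂ × ℝ => dslope H p.2 p.1) (U ×ˢ Set.Icc 0 d) := by
    refine h1.comp (f := fun p : ℂ × ℝ => (((p.2:ℝ):ℂ), p.1)) (by fun_prop) ?_
    intro p hp
    exact ⟨hs _ hp.2, hp.1⟩
  have h3 : ContinuousOn (fun p : ℂ × ℝ => H p.2) (U ×ˢ Set.Icc 0 d) := by
    refine hH.continuousOn.comp (f := fun p : ℂ × ℝ => ((p.2:ℝ):ℂ)) (by fun_prop) ?_
    intro p hp
    exact hs _ hp.2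
  exact h2.neg.div h3 fun p hp => h0 _ (hs _ hp.2)

lemma rK_diff (hU : IsOpen U) (hH : DifferentiableOn ℂ H U) (h0 : ∀ z ∈ U, H z ≠ 0) (hd : 0 < d)
    (hs : ∀ t ∈ Set.Icc 0 d, (t:ℂ) ∈ U) : DifferentiableOn ℂ (rK H d) U := by
  refine rh_param hU (csq_int hd) (k := fun z s => -(dslope H s z) / H s) (rK_cont hU hH h0 hd hs) ?_
  intro s hs'
  rw [Set.uIcc_of_le hd.le] at hs'
  have : DifferentiableOn ℂ (dslope H s) U :=
    (Complex.differentiableOn_dslope (hU.mem_nhds (hs s hs'))).2 hH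
  exact this.neg.div_const _

lemma rJ_int (hH : DifferentiableOn ℂ H U) (h0 : ∀ z ∈ U, H z ≠ 0) (hd : 0 < d)
    (hs : ∀ t ∈ Set.Icc 0 d, (t:ℂ) ∈ U) : IntervalIntegrable (fun t : ℝ => (csq (t:ℂ) * H t)⁻¹) MeasureTheory.volume 0 d := by
  have : ContinuousOn (fun t : ℝ => (H t)⁻¹) (Set.uIcc 0 d) := by
    rw [Set.uIcc_of_le hd.le]
    refine ContinuousOn.inv₀ ?_ fun t ht => h0 _ (hs t ht)
    exact hH.continuousOn.comp (by fun_prop) hs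
  simpa only [mul_inv] using (csq_int hd).mul_continuousOn this

lemma rJ_eq (hU : IsOpen U) (hH : DifferentiableOn ℂ H U) (h0 : ∀ z ∈ U, H z ≠ 0) (hd : 0 < d)
    (hs : ∀ t ∈ Set.Icc 0 d, (t:ℂ) ∈ U) {ζ : ℂ} (hζ : ζ.im ≠ 0) (hζU : ζ ∈ U) :
    rJ H d ζ = csq ζ * rK H d ζ + (Complex.log (Real.sqrt d - csq ζ) - Complex.log (Real.sqrt d + csq ζ)
      - (Complex.log (-csq ζ) - Complex.log (csq ζ))) := by
  rw [← rh_sqrt_int hd hζ, ← mul_add, rJ, rK, mul_assoc]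
  congr 1
  have hne : ∀ t : ℝ, (t:ℂ) - ζ ≠ 0 := by
    intro t h
    apply hζ
    have := congrArg Complex.im h
    simpa using this
  have i1 : IntervalIntegrable (fun t : ℝ => (csq (t:ℂ))⁻¹ * (-(dslope H t ζ) / H t)) MeasureTheory.volume 0 d := by
    refine (csq_int hd).mul_continuousOn ?_
    refine (rK_cont hU hH h0 hd hs).comp (f := fun t : ℝ => (ζ, t)) (by fun_prop) ?_
    intro t ht
    exact ⟨hζU, ht⟩
  have i2 : IntervalIntegrable (fun t : ℝ => (csq (t:ℂ))⁻¹ * ((t:ℂ) - ζ)⁻¹) MeasureTheory.volume 0 d :=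
    (csq_int hd).mul_continuousOn (ContinuousOn.inv₀ (by fun_prop) fun t _ => hne t)
  rw [← intervalIntegral.integral_add i1 i2, ← intervalIntegral.integral_const_mul]
  refine intervalIntegral.integral_congr ?_
  intro t ht
  rw [Set.uIcc_of_le hd.le] at ht
  have hHt := h0 _ (hs t ht)
  have n1 := hne t
  have n2 : ζ - t ≠ 0 := by
    intro h; apply n1; linear_combination -h
  have n3 := csq_ne (t:ℂ)
  change H ζ * ((csq (t:ℂ) * H t)⁻¹ * ((t:ℂ) - ζ)⁻¹) = (csq (t:ℂ))⁻¹ * (-(dslope H t ζ) / H t) + (csq (t:ℂ))⁻¹ * ((t:ℂ) - ζ)⁻¹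
  rw [dslope_of_ne _ (fun h => n2 (by rw [h]; ring)), slope_def_field]
  have n4 : ζ - t = -((t:ℂ) - ζ) := by ring
  rw [n4]
  field_simp
  ring

lemma rh_log_up {w : ℂ} (hw : 0 < w.im) : Complex.log (-w) - Complex.log w = -(Real.pi * I) := by
  rw [Complex.log, Complex.log, norm_neg, Complex.arg_neg_eq_arg_sub_pi_of_im_pos hw]
  push_cast; ring

lemma rh_log_low {w : ℂ} (hw : w.im < 0) : Complex.log (-w) - Complex.log w = Real.pi * I := by
  rw [Complex.log, Complex.log, norm_neg, Complex.arg_neg_eq_arg_add_pi_of_im_neg hw]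
  push_cast; ring

lemma csq_im_pos {w : ℂ} (hw : 0 < w.im) : 0 < (csq w).im := by
  have h := csq_im hw.ne'
  have h2 := csq_re hw.ne'
  by_contra! h3
  nlinarith

lemma csq_im_neg {w : ℂ} (hw : w.im < 0) : (csq w).im < 0 := by
  have h := csq_im hw.ne
  have h2 := csq_re hw.ne
  by_contra! h3
  nlinarith [mul_nonneg h2.le h3]

lemma csq_zero : Tendsto csq (𝓝[{z : ℂ | z.im ≠ 0}] 0) (𝓝 0) := by
  rw [tendsto_zero_iff_norm_tendsto_zero]
  have h : Tendsto (fun z : ℂ => Real.sqrt ‖z‖) (𝓝[{z : ℂ | z.im ≠ 0}] 0) (𝓝 0) := by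
    have : Continuous fun z : ℂ => Real.sqrt ‖z‖ := by fun_prop
    simpa using (this.tendsto 0).mono_left (nhdsWithin_le_nhds (s := {z : ℂ | z.im ≠ 0}))
  refine h.congr' ?_
  filter_upwards [self_mem_nhdsWithin] with z hz
  have h0 : z ≠ 0 := by rintro rfl; exact hz rfl
  rw [← csq_norm h0, Real.sqrt_sq (norm_nonneg _)]

lemma rJ_bdd (hU : IsOpen U) (hH : DifferentiableOn ℂ H U) (h0 : ∀ z ∈ U, H z ≠ 0) (hd : 0 < d)
    (hs : ∀ t ∈ Set.Icc 0 d, (t:ℂ) ∈ U) : rJ H d =O[𝓝[{z : ℂ | z.im ≠ 0}] 0] (fun _ => (1:ℝ)) := by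
  have h0U : (0:ℂ) ∈ U := by simpa using hs 0 ⟨le_rfl, hd.le⟩
  have hsd : ((Real.sqrt d : ℝ):ℂ) ∈ slitPlane := Or.inl (by simpa using hd)
  have hK : Tendsto (rK H d) (𝓝[{z : ℂ | z.im ≠ 0}] 0) (𝓝 (rK H d 0)) :=
    ((rK_diff hU hH h0 hd hs).differentiableAt (hU.mem_nhds h0U)).continuousAt.tendsto.mono_left nhdsWithin_le_nhds
  have l1 : Tendsto (fun ζ => csq ζ * rK H d ζ + (Complex.log (Real.sqrt d - csq ζ) - Complex.log (Real.sqrt d + csq ζ)))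
      (𝓝[{z : ℂ | z.im ≠ 0}] 0) (𝓝 (0 * rK H d 0 + (Complex.log (Real.sqrt d - 0) - Complex.log (Real.sqrt d + 0)))) := by
    refine (csq_zero.mul hK).add (Tendsto.sub ?_ ?_)
    · exact (tendsto_const_nhds.sub csq_zero).clog (by simpa using hsd)
    · exact (tendsto_const_nhds.add csq_zero).clog (by simpa using hsd)
  have l2 := l1.isBigO_one ℝ
  have l3 : (fun ζ => Complex.log (-csq ζ) - Complex.log (csq ζ)) =O[𝓝[{z : ℂ | z.im ≠ 0}] 0] (fun _ => (1:ℝ)) := by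
    refine IsBigO.of_bound Real.pi ?_
    filter_upwards [self_mem_nhdsWithin] with z hz
    rcases lt_or_gt_of_ne (show z.im ≠ 0 from hz) with h | h
    · rw [rh_log_low (csq_im_neg h)]; simp [abs_of_pos Real.pi_pos]
    · rw [rh_log_up (csq_im_pos h)]; simp [abs_of_pos Real.pi_pos]
  refine (l2.sub l3).congr' ?_ EventuallyEq.rfl
  filter_upwards [self_mem_nhdsWithin, nhdsWithin_le_nhds (hU.mem_nhds h0U)] with z hz hzU
  rw [rJ_eq hU hH h0 hd hs hz hzU]; ring

lemma rJ_lim (hU : IsOpen U) (hH : DifferentiableOn ℂ H U) (h0 : ∀ z ∈ U, H z ≠ 0) (hd : 0 < d)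
    (hs : ∀ t ∈ Set.Icc 0 d, (t:ℂ) ∈ U) {x : ℝ} (hx : x ∈ Set.Ioo 0 d) : ∃ L : ℂ,
    Tendsto (rJ H d) (𝓝[{z : ℂ | 0 < z.im}] x) (𝓝 (L + 2 * Real.pi * I)) ∧
    Tendsto (rJ H d) (𝓝[{z : ℂ | z.im < 0}] x) (𝓝 L) := by
  have hxU : (x:ℂ) ∈ U := hs x ⟨hx.1.le, hx.2.le⟩
  have hK : Tendsto (rK H d) (𝓝 (x:ℂ)) (𝓝 (rK H d x)) :=
    ((rK_diff hU hH h0 hd hs).differentiableAt (hU.mem_nhds hxU)).continuousAt.tendsto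
  have hc : Tendsto csq (𝓝 (x:ℂ)) (𝓝 (Real.sqrt x : ℂ)) := by
    have := (csq_diff (w := (x:ℂ)) (Or.inl (by simpa using hx.1))).continuousAt.tendsto
    rwa [csq_ofReal hx.1] at this
  have hlt := Real.sqrt_lt_sqrt hx.1.le hx.2
  have l1 : Tendsto (fun ζ => csq ζ * rK H d ζ + (Complex.log (Real.sqrt d - csq ζ) - Complex.log (Real.sqrt d + csq ζ)))
      (𝓝 (x:ℂ)) (𝓝 (Real.sqrt x * rK H d x + (Complex.log (Real.sqrt d - Real.sqrt x) - Complex.log (Real.sqrt d + Real.sqrt x)))) := by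
    refine (hc.mul hK).add (Tendsto.sub ?_ ?_)
    · exact (tendsto_const_nhds.sub hc).clog (Or.inl (by simpa using hlt))
    · refine (tendsto_const_nhds.add hc).clog (Or.inl ?_)
      have := Real.sqrt_nonneg x
      simp; linarith
  refine ⟨_ - Real.pi * I, ?_, ((l1.mono_left nhdsWithin_le_nhds).sub tendsto_const_nhds).congr' ?_⟩
  · refine (rh_tendsto_eq ((l1.mono_left nhdsWithin_le_nhds).add_const (Real.pi * I)) (by ring)).congr' ?_
    filter_upwards [self_mem_nhdsWithin, nhdsWithin_le_nhds (hU.mem_nhds hxU)] with z hz hzU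
    rw [rJ_eq hU hH h0 hd hs (ne_of_gt hz) hzU, rh_log_up (csq_im_pos hz)]; ring
  · filter_upwards [self_mem_nhdsWithin, nhdsWithin_le_nhds (hU.mem_nhds hxU)] with z hz hzU
    rw [rJ_eq hU hH h0 hd hs (ne_of_lt hz) hzU, rh_log_low (csq_im_neg hz)]; ring

end

/-- Cauchy integral of the reciprocal of R -/
def rC (N : ℕ) (a b : ℕ → ℝ) (c d : ℝ) (z : ℂ) : ℂ := ∫ s in c..d, (rR N a b s)⁻¹ * ((s:ℂ) - z)⁻¹

lemma rh_prod_nice {N : ℕ} {a b : ℕ → ℝ} (h : RHOrd N a b) {k : ℕ} {z : ℂ}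
    (hz : ∀ l < N, l ≠ k → ∀ x : ℝ, z = x → x < a l ∨ b l < x) :
    DifferentiableAt ℂ (fun z => ∏ l ∈ (Finset.range N).erase k, rr (a l) (b l) z) z ∧
      ∏ l ∈ (Finset.range N).erase k, rr (a l) (b l) z ≠ 0 := by
  have h1 : ∀ l ∈ (Finset.range N).erase k, z ∉ Complex.ofReal '' Set.Icc (a l) (b l) := by
    rintro l hl ⟨x, hx, rfl⟩
    rw [Finset.mem_erase, Finset.mem_range] at hl
    rcases hz l hl.2 hl.1 x rfl with h | h
    · linarith [hx.1]
    · linarith [hx.2]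
  constructor
  · refine DifferentiableAt.fun_finsetProd fun l hl => rr_diff (h.ab ?_) (h1 l hl)
    rw [Finset.mem_erase, Finset.mem_range] at hl
    exact hl.2
  · refine Finset.prod_ne_zero_iff.2 fun l hl => rr_ne ?_
    intro e
    have h2 := h1 l hl
    rw [Finset.mem_erase, Finset.mem_range] at hl
    exact h2 ⟨a l, ⟨le_rfl, (h.ab hl.2).le⟩, e.symm⟩

lemma rh_gapL {N : ℕ} {a b : ℕ → ℝ} (h : RHOrd N a b) {k : ℕ} (hk : k + 1 < N) {m : ℝ} (hm : m ∈ Set.Ioo (b k) (a (k+1))) :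
    IntervalIntegrable (fun s : ℝ => (rR N a b s)⁻¹) MeasureTheory.volume (b k) m ∧
    ((fun z => rR N a b z * rC N a b (b k) m z) =O[𝓝[{z : ℂ | z.im ≠ 0}] (b k : ℂ)] fun _ => (1:ℝ)) ∧
    ∀ x ∈ Set.Ioo (b k) m, ∃ L : ℂ,
      Tendsto (fun z => rR N a b z * rC N a b (b k) m z) (𝓝[{z : ℂ | 0 < z.im}] x) (𝓝 (L + 2 * Real.pi * I)) ∧
      Tendsto (fun z => rR N a b z * rC N a b (b k) m z) (𝓝[{z : ℂ | z.im < 0}] x) (𝓝 L) := by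
  set H : ℂ → ℂ := fun ζ => csq (ζ + b k - a k) * ∏ l ∈ (Finset.range N).erase k, rr (a l) (b l) (ζ + b k) with hHdef
  set U : Set ℂ := {ζ | 0 < ζ.re + b k - a k ∧ ζ.re + b k < a (k+1)} with hUdef
  have hab := h.ab (k := k) (by omega)
  have hd : 0 < m - b k := by linarith [hm.1]
  have hU : IsOpen U := by
    have o1 : IsOpen {ζ : ℂ | 0 < ζ.re + b k - a k} := isOpen_lt (by fun_prop) (by fun_prop)
    have o2 : IsOpen {ζ : ℂ | ζ.re + b k < a (k+1)} := isOpen_lt (by fun_prop) (by fun_prop)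
    exact o1.inter o2
  have hside : ∀ ζ ∈ U, ∀ l < N, l ≠ k → ∀ x : ℝ, ζ + b k = x → x < a l ∨ b l < x := by
    intro ζ hζ l hl hlk x hx
    have hx' : ζ.re + b k = x := by simpa using congrArg Complex.re hx
    obtain ⟨h1, h2⟩ := hζ
    rcases lt_or_gt_of_ne hlk with h3 | h3
    · right; have := h.lt h3 (by omega); linarith
    · left
      rcases Nat.lt_or_ge (k+1) l with h4 | h4
      · have h5 := h.lt h4 hl
        have h6 := h.ab hk
        linarith
      · have : l = k + 1 := by omega
        subst this; linarith
  have hslit : ∀ ζ ∈ U, ζ + b k - a k ∈ slitPlane := fun ζ hζ => Or.inl (by simpa using hζ.1)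
  have hH : DifferentiableOn ℂ H U := by
    intro ζ hζ
    apply DifferentiableAt.differentiableWithinAt
    refine DifferentiableAt.mul ?_ ?_
    · exact DifferentiableAt.comp (g := csq) (f := fun ζ : ℂ => ζ + b k - a k) ζ (csq_diff (hslit ζ hζ)) (by fun_prop)
    · exact DifferentiableAt.comp (f := fun ζ : ℂ => ζ + b k) ζ (rh_prod_nice h (hside ζ hζ)).1 (by fun_prop)
  have h0 : ∀ ζ ∈ U, H ζ ≠ 0 := fun ζ hζ => mul_ne_zero (csq_ne _) (rh_prod_nice h (hside ζ hζ)).2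
  have hs : ∀ t ∈ Set.Icc 0 (m - b k), (t:ℂ) ∈ U := by
    intro t ht
    refine ⟨?_, ?_⟩
    · simp; linarith [ht.1]
    · simp; linarith [ht.2, hm.2]
  have hR : ∀ ζ : ℂ, sameSide (ζ + b k - b k) (ζ + b k - a k) → rR N a b (ζ + b k) = csq ζ * H ζ := by
    intro ζ hζ
    rw [rR_erase N a b (k := k) (by omega), rr_eq_sq_right hζ, hHdef]
    simp only [add_sub_cancel_right]
    ring
  have hRt : ∀ t ∈ Set.Ioc 0 (m - b k), rR N a b ((t:ℂ) + b k) = csq t * H t := by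
    intro t ht
    apply hR
    refine Or.inr (Or.inr ⟨⟨by simpa using ht.1, by simp⟩, ?_, by simp⟩)
    simp; linarith [ht.1]
  have hRz : ∀ ζ : ℂ, ζ.im ≠ 0 → rR N a b (ζ + b k) = csq ζ * H ζ := by
    intro ζ hζ
    apply hR
    rcases lt_or_gt_of_ne hζ with h1 | h1
    · exact Or.inr (Or.inl (by simpa using h1))
    · exact Or.inl (by simpa using h1)
  have hJ : ∀ z : ℂ, z.im ≠ 0 → rJ H (m - b k) (z - b k) = rR N a b z * rC N a b (b k) m z := by
    intro z hz
    have e1 := hRz (z - b k) (by simpa using hz)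
    rw [sub_add_cancel] at e1
    rw [rJ, ← e1, rC]
    congr 1
    have e2 := intervalIntegral.integral_comp_add_right (a := 0) (b := m - b k)
      (fun s : ℝ => (rR N a b s)⁻¹ * ((s:ℂ) - z)⁻¹) (b k)
    rw [zero_add, sub_add_cancel] at e2
    rw [← e2]
    refine intervalIntegral.integral_congr_ae (Eventually.of_forall ?_)
    intro t ht
    rw [Set.uIoc_of_le hd.le] at ht
    rw [← hRt t ht]
    push_cast
    congr 2; ring
  refine ⟨?_, ?_, ?_⟩
  · have i1 := rJ_int hH h0 hd hs
    have i2 : IntervalIntegrable (fun t : ℝ => (rR N a b ((t + b k : ℝ):ℂ))⁻¹) MeasureTheory.volume 0 (m - b k) := by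
      refine i1.congr ?_
      intro t ht
      rw [Set.uIoc_of_le hd.le] at ht
      simp only
      rw [← hRt t ht]; push_cast; rfl
    have i3 := i2.comp_add_right (-b k)
    simpa using i3
  · have hb := rJ_bdd hU hH h0 hd hs
    have ht : Tendsto (fun z : ℂ => z - b k) (𝓝[{z : ℂ | z.im ≠ 0}] (b k : ℂ)) (𝓝[{z : ℂ | z.im ≠ 0}] 0) := by
      refine tendsto_nhdsWithin_iff.2 ⟨?_, ?_⟩
      · have : Continuous fun z : ℂ => z - b k := by fun_prop
        exact (rh_tendsto_eq (this.tendsto _) (sub_self _)).mono_left nhdsWithin_le_nhds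
      · filter_upwards [self_mem_nhdsWithin] with z hz
        change (z - b k).im ≠ 0
        simpa using hz
    refine (hb.comp_tendsto ht).congr' ?_ EventuallyEq.rfl
    filter_upwards [self_mem_nhdsWithin] with z hz
    exact hJ z hz
  · intro x hx
    obtain ⟨L, h1, h2⟩ := rJ_lim hU hH h0 hd hs (x := x - b k) ⟨by linarith [hx.1], by linarith [hx.2]⟩
    have hc : Tendsto (fun z : ℂ => z - b k) (𝓝 (x:ℂ)) (𝓝 ((x - b k : ℝ):ℂ)) := by
      have : Continuous fun z : ℂ => z - b k := by fun_prop
      exact rh_tendsto_eq (this.tendsto _) (by push_cast; rfl)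
    refine ⟨L, ?_, ?_⟩
    · have ht : Tendsto (fun z : ℂ => z - b k) (𝓝[{z : ℂ | 0 < z.im}] (x : ℂ)) (𝓝[{z : ℂ | 0 < z.im}] ((x - b k : ℝ):ℂ)) := by
        refine tendsto_nhdsWithin_iff.2 ⟨hc.mono_left nhdsWithin_le_nhds, ?_⟩
        filter_upwards [self_mem_nhdsWithin] with z hz
        change 0 < (z - b k).im
        simpa using hz
      refine (h1.comp ht).congr' ?_
      filter_upwards [self_mem_nhdsWithin] with z hz
      exact hJ z (ne_of_gt hz)
    · have ht : Tendsto (fun z : ℂ => z - b k) (𝓝[{z : ℂ | z.im < 0}] (x : ℂ)) (𝓝[{z : ℂ | z.im < 0}] ((x - b k : ℝ):ℂ)) := by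
        refine tendsto_nhdsWithin_iff.2 ⟨hc.mono_left nhdsWithin_le_nhds, ?_⟩
        filter_upwards [self_mem_nhdsWithin] with z hz
        change (z - b k).im < 0
        simpa using hz
      refine (h2.comp ht).congr' ?_
      filter_upwards [self_mem_nhdsWithin] with z hz
      exact hJ z (ne_of_lt hz)

lemma rh_gapR {N : ℕ} {a b : ℕ → ℝ} (h : RHOrd N a b) {k : ℕ} (hk : k + 1 < N) {m : ℝ} (hm : m ∈ Set.Ioo (b k) (a (k+1))) :
    IntervalIntegrable (fun s : ℝ => (rR N a b s)⁻¹) MeasureTheory.volume m (a (k+1)) ∧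
    ((fun z => rR N a b z * rC N a b m (a (k+1)) z) =O[𝓝[{z : ℂ | z.im ≠ 0}] (a (k+1) : ℂ)] fun _ => (1:ℝ)) := by
  set A := a (k+1) with hA
  set B := b (k+1) with hB
  set H : ℂ → ℂ := fun ζ => -csq (B - (A - ζ)) * ∏ l ∈ (Finset.range N).erase (k+1), rr (a l) (b l) (A - ζ) with hHdef
  set U : Set ℂ := {ζ | 0 < B - (A - ζ.re) ∧ b k < A - ζ.re} with hUdef
  have hab : A < B := h.ab (k := k+1) hk
  have hd : 0 < A - m := by linarith [hm.2]
  have hU : IsOpen U := by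
    have o1 : IsOpen {ζ : ℂ | 0 < B - (A - ζ.re)} := isOpen_lt (by fun_prop) (by fun_prop)
    have o2 : IsOpen {ζ : ℂ | b k < A - ζ.re} := isOpen_lt (by fun_prop) (by fun_prop)
    exact o1.inter o2
  have hside : ∀ ζ ∈ U, ∀ l < N, l ≠ k + 1 → ∀ x : ℝ, A - ζ = x → x < a l ∨ b l < x := by
    intro ζ hζ l hl hlk x hx
    have hx' : A - ζ.re = x := by simpa using congrArg Complex.re hx
    obtain ⟨h1, h2⟩ := hζ
    rcases lt_or_gt_of_ne hlk with h3 | h3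
    · right
      rcases Nat.lt_or_ge l k with h4 | h4
      · have h5 := h.lt h4 (by omega)
        have h6 := h.ab (k := k) (by omega)
        linarith
      · have : l = k := by omega
        subst this; linarith
    · left; have := h.lt h3 (by omega); linarith
  have hslit : ∀ ζ ∈ U, (B:ℂ) - (A - ζ) ∈ slitPlane := fun ζ hζ => Or.inl (by simpa using hζ.1)
  have hH : DifferentiableOn ℂ H U := by
    intro ζ hζ
    apply DifferentiableAt.differentiableWithinAt
    refine DifferentiableAt.mul (DifferentiableAt.neg ?_) ?_
    · exact DifferentiableAt.comp (g := csq) (f := fun ζ : ℂ => (B:ℂ) - (A - ζ)) ζ (csq_diff (hslit ζ hζ)) (by fun_prop)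
    · exact DifferentiableAt.comp (f := fun ζ : ℂ => (A:ℂ) - ζ) ζ (rh_prod_nice h (hside ζ hζ)).1 (by fun_prop)
  have h0 : ∀ ζ ∈ U, H ζ ≠ 0 := fun ζ hζ => mul_ne_zero (neg_ne_zero.2 (csq_ne _)) (rh_prod_nice h (hside ζ hζ)).2
  have hs : ∀ t ∈ Set.Icc 0 (A - m), (t:ℂ) ∈ U := by
    intro t ht
    refine ⟨?_, ?_⟩
    · simp; linarith [ht.1]
    · simp; linarith [ht.2, hm.1]
  have hR : ∀ ζ : ℂ, sameSide (B - (A - ζ)) (A - (A - ζ)) → rR N a b (A - ζ) = csq ζ * H ζ := by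
    intro ζ hζ
    rw [rR_erase N a b (k := k+1) hk, rr_eq_sq_left hζ, hHdef]
    simp only [sub_sub_cancel]
    ring
  have hRt : ∀ t ∈ Set.Ioc 0 (A - m), rR N a b ((A:ℂ) - t) = csq t * H t := by
    intro t ht
    apply hR
    refine Or.inr (Or.inr ⟨⟨?_, by simp⟩, by simpa using ht.1, by simp⟩)
    simp; linarith [ht.1]
  have hRz : ∀ ζ : ℂ, ζ.im ≠ 0 → rR N a b (A - ζ) = csq ζ * H ζ := by
    intro ζ hζ
    apply hR
    rcases lt_or_gt_of_ne hζ with h1 | h1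
    · exact Or.inr (Or.inl (by simpa using h1))
    · exact Or.inl (by simpa using h1)
  have hJ : ∀ z : ℂ, z.im ≠ 0 → -rJ H (A - m) (A - z) = rR N a b z * rC N a b m A z := by
    intro z hz
    have e1 := hRz (A - z) (by simpa using hz)
    rw [sub_sub_cancel] at e1
    rw [rJ, ← e1, rC, ← mul_neg]
    congr 1
    have e2 := intervalIntegral.integral_comp_sub_left (a := 0) (b := A - m)
      (fun s : ℝ => (rR N a b s)⁻¹ * ((s:ℂ) - z)⁻¹) A
    rw [sub_zero, sub_sub_cancel] at e2
    rw [← e2, ← intervalIntegral.integral_neg]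
    refine intervalIntegral.integral_congr_ae (Eventually.of_forall ?_)
    intro t ht
    rw [Set.uIoc_of_le hd.le] at ht
    rw [← hRt t ht, ← mul_neg, ← inv_neg]
    push_cast
    congr 2; ring
  refine ⟨?_, ?_⟩
  · have i1 := rJ_int hH h0 hd hs
    have i2 : IntervalIntegrable (fun t : ℝ => (rR N a b ((A - t : ℝ):ℂ))⁻¹) MeasureTheory.volume 0 (A - m) := by
      refine i1.congr ?_
      intro t ht
      rw [Set.uIoc_of_le hd.le] at ht
      simp only
      rw [← hRt t ht]; push_cast; rfl
    have i3 := i2.comp_sub_left A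
    simpa using i3.symm
  · have hb := rJ_bdd hU hH h0 hd hs
    have ht : Tendsto (fun z : ℂ => A - z) (𝓝[{z : ℂ | z.im ≠ 0}] (A : ℂ)) (𝓝[{z : ℂ | z.im ≠ 0}] 0) := by
      refine tendsto_nhdsWithin_iff.2 ⟨?_, ?_⟩
      · have : Continuous fun z : ℂ => A - z := by fun_prop
        exact (rh_tendsto_eq (this.tendsto _) (sub_self _)).mono_left nhdsWithin_le_nhds
      · filter_upwards [self_mem_nhdsWithin] with z hz
        change (A - z).im ≠ 0
        simpa using hz
    refine (hb.comp_tendsto ht).neg_left.congr' ?_ EventuallyEq.rfl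
    filter_upwards [self_mem_nhdsWithin] with z hz
    exact hJ z hz

def rhPairSub (B : ℝ) (q : ℝ → ℝ) (K : ℕ) : AddSubgroup (Fin K → ℝ) where
  carrier := {V | ∃ (n : ℕ) (x y : Fin n → ℝ), (∀ i, B < x i) ∧ (∀ i, B < y i) ∧
    ∀ m : Fin K, ∑ i, ∫ s in (x i)..(y i), q s * s ^ (m:ℕ) = V m}
  zero_mem' := ⟨0, Fin.elim0, Fin.elim0, fun i => i.elim0, fun i => i.elim0, fun m => by simp⟩
  add_mem' := by
    rintro V W ⟨n, x, y, h1, h2, h3⟩ ⟨n', x', y', h1', h2', h3'⟩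
    refine ⟨n + n', Fin.append x x', Fin.append y y', ?_, ?_, ?_⟩
    · intro i; refine Fin.addCases (fun i => ?_) (fun i => ?_) i
      · simpa using h1 i
      · simpa using h1' i
    · intro i; refine Fin.addCases (fun i => ?_) (fun i => ?_) i
      · simpa using h2 i
      · simpa using h2' i
    · intro m
      rw [Fin.sum_univ_add]
      simp only [Fin.append_left, Fin.append_right]
      rw [h3, h3']; rfl
  neg_mem' := by
    rintro V ⟨n, x, y, h1, h2, h3⟩
    refine ⟨n, y, x, h2, h1, fun m => ?_⟩
    rw [Pi.neg_apply, ← h3 m, ← Finset.sum_neg_distrib]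
    exact Finset.sum_congr rfl fun i _ => intervalIntegral.integral_symm _ _

lemma rh_pairs (B : ℝ) (q : ℝ → ℝ) (hq : ContinuousOn q (Set.Ioi B)) (hq0 : ∀ s > B, q s ≠ 0) (K : ℕ) (V : Fin K → ℝ) :
    ∃ (n : ℕ) (x y : Fin n → ℝ), (∀ i, B < x i) ∧ (∀ i, B < y i) ∧
    ∀ m : Fin K, ∑ i, ∫ s in (x i)..(y i), q s * s ^ (m:ℕ) = V m := by
  change V ∈ rhPairSub B q K
  set x : Fin K → ℝ := fun j => B + 1 + (j:ℕ) with hx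
  have hxB : ∀ j, B < x j := fun j => by
    have : (0:ℝ) ≤ ((j:ℕ):ℝ) := by positivity
    simp only [hx]; linarith
  set F : (Fin K → ℝ) → (Fin K → ℝ) := fun Y m => ∑ j, ∫ s in (x j)..(Y j), q s * s ^ (m:ℕ) with hF
  set A : (Fin K → ℝ) →L[ℝ] (Fin K → ℝ) := ContinuousLinearMap.pi fun m =>
    ∑ j, (q (x j) * x j ^ (m:ℕ)) • (ContinuousLinearMap.proj j : (Fin K → ℝ) →L[ℝ] ℝ) with hA
  have hder : HasStrictFDerivAt F A x := by
    rw [hasStrictFDerivAt_pi']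
    intro m
    have h1 : ∀ j ∈ (Finset.univ : Finset (Fin K)), HasStrictFDerivAt (fun Y : Fin K → ℝ => ∫ s in (x j)..(Y j), q s * s ^ (m:ℕ))
        ((q (x j) * x j ^ (m:ℕ)) • (ContinuousLinearMap.proj j : (Fin K → ℝ) →L[ℝ] ℝ)) x := by
      intro j _
      have hc : ContinuousOn (fun s => q s * s ^ (m:ℕ)) (Set.Ioi B) := hq.mul (by fun_prop)
      have h2 : HasStrictDerivAt (fun u => ∫ s in (x j)..u, q s * s ^ (m:ℕ)) (q (x j) * x j ^ (m:ℕ)) (x j) := by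
        refine intervalIntegral.integral_hasStrictDerivAt_right (by simp) ?_ ?_
        · exact hc.stronglyMeasurableAtFilter isOpen_Ioi _ (hxB j)
        · exact hc.continuousAt (isOpen_Ioi.mem_nhds (hxB j))
      have h3 := (ContinuousLinearMap.proj j : (Fin K → ℝ) →L[ℝ] ℝ).hasStrictFDerivAt (x := x)
      exact h2.comp_hasStrictFDerivAt x h3
    have h4 := HasStrictFDerivAt.fun_sum h1
    refine h4.congr_fderiv ?_
    ext v; simp [hA]
  have hsurj : Function.Surjective A := by
    have hinj : Function.Injective (A : (Fin K → ℝ) →ₗ[ℝ] (Fin K → ℝ)) := by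
      rw [injective_iff_map_eq_zero]
      intro v hv
      have hdet : (Matrix.vandermonde x).det ≠ 0 := by
        rw [Matrix.det_vandermonde_ne_zero_iff]
        intro i j hij
        simp only [hx, add_right_inj, Nat.cast_inj] at hij
        exact Fin.ext hij
      have h1 : Matrix.vecMul (fun j => q (x j) * v j) (Matrix.vandermonde x) = 0 := by
        funext m
        have h2 := congrFun hv m
        simp only [hA, ContinuousLinearMap.coe_coe, ContinuousLinearMap.coe_pi', ContinuousLinearMap.sum_apply, ContinuousLinearMap.smul_apply, ContinuousLinearMap.proj_apply, smul_eq_mul, Pi.zero_apply] at h2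
        simp only [Matrix.vecMul, dotProduct, Matrix.vandermonde_apply, Pi.zero_apply]
        rw [← h2]
        exact Finset.sum_congr rfl fun j _ => by ring
      have h3 := Matrix.eq_zero_of_vecMul_eq_zero hdet h1
      funext j
      have h4 := congrFun h3 j
      exact (mul_eq_zero.1 h4).resolve_left (hq0 _ (hxB j))
    exact LinearMap.injective_iff_surjective.1 hinj
  have hmap := hder.map_nhds_eq_of_surj (LinearMap.range_eq_top.2 hsurj)
  have hF0 : F x = 0 := by funext m; simp [hF]
  rw [hF0] at hmap
  have hS : (rhPairSub B q K : Set (Fin K → ℝ)) ∈ 𝓝 (0 : Fin K → ℝ) := by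
    rw [← hmap, Filter.mem_map]
    have : ∀ᶠ Y in 𝓝 x, ∀ j, B < Y j := by
      rw [eventually_all]
      intro j
      exact (continuous_apply j).continuousAt.eventually (isOpen_Ioi.mem_nhds (hxB j))
    filter_upwards [this] with Y hY
    exact ⟨K, x, Y, hxB, hY, fun m => rfl⟩
  have hlim : Tendsto (fun n : ℕ => ((n:ℝ) + 1)⁻¹ • V) atTop (𝓝 0) := by
    have : Tendsto (fun n : ℕ => ((n:ℝ) + 1)⁻¹) atTop (𝓝 0) := by
      simpa using tendsto_one_div_add_atTop_nhds_zero_nat (𝕜 := ℝ)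
    simpa using this.smul_const V
  obtain ⟨n, hn⟩ := (hlim.eventually hS).exists
  have h5 := (rhPairSub B q K).nsmul_mem hn (n+1)
  have h6 : (n+1) • (((n:ℝ) + 1)⁻¹ • V) = V := by
    have : (n:ℝ) + 1 ≠ 0 := by positivity
    rw [← Nat.cast_smul_eq_nsmul ℝ, smul_smul]
    push_cast
    rw [mul_inv_cancel₀ this, one_smul]
  rwa [h6] at h5

structure RHGood (N : ℕ) (a b : ℕ → ℝ) (j : ℕ → ℝ) (Φ : ℂ → ℂ) : Prop where
  cut : ∀ k < N, ∀ t ∈ Set.Ioo (a k) (b k), ∃ L : ℂ,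
    Tendsto Φ (𝓝[{z : ℂ | 0 < z.im}] (t : ℂ)) (𝓝 L) ∧ Tendsto Φ (𝓝[{z : ℂ | z.im < 0}] (t : ℂ)) (𝓝 (-L))
  gap : ∀ k, k + 1 < N → ∀ t ∈ Set.Ioo (b k) (a (k + 1)), ∃ L : ℂ,
    Tendsto Φ (𝓝[{z : ℂ | 0 < z.im}] (t : ℂ)) (𝓝 (L + j k * (2 * Real.pi * I))) ∧
    Tendsto Φ (𝓝[{z : ℂ | z.im < 0}] (t : ℂ)) (𝓝 L)
  e : ∀ k < N, ∀ p : ℝ, p = a k ∨ p = b k → Φ =O[𝓝[{z : ℂ | z.im ≠ 0}] (p:ℂ)] fun _ => (1:ℝ)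

section
variable {N : ℕ} {a b : ℕ → ℝ}

lemma RHGood.zero : RHGood N a b 0 (fun _ => 0) where
  cut := fun k hk t ht => ⟨0, tendsto_const_nhds, by simpa using tendsto_const_nhds⟩
  gap := fun k hk t ht => ⟨0, by simpa using tendsto_const_nhds, tendsto_const_nhds⟩
  e := fun k hk p hp => isBigO_zero _ _

lemma RHGood.add {j1 j2 : ℕ → ℝ} {f1 f2 : ℂ → ℂ} (h1 : RHGood N a b j1 f1) (h2 : RHGood N a b j2 f2) :
    RHGood N a b (fun k => j1 k + j2 k) (fun z => f1 z + f2 z) where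
  cut := fun k hk t ht => by
    obtain ⟨L, u, v⟩ := h1.cut k hk t ht
    obtain ⟨L', u', v'⟩ := h2.cut k hk t ht
    exact ⟨L + L', u.add u', rh_tendsto_eq (v.add v') (by ring)⟩
  gap := fun k hk t ht => by
    obtain ⟨L, u, v⟩ := h1.gap k hk t ht
    obtain ⟨L', u', v'⟩ := h2.gap k hk t ht
    exact ⟨L + L', rh_tendsto_eq (u.add u') (by push_cast; ring), v.add v'⟩
  e := fun k hk p hp => (h1.e k hk p hp).add (h2.e k hk p hp)

lemma RHGood.smul {j1 : ℕ → ℝ} {f1 : ℂ → ℂ} (c : ℝ) (h1 : RHGood N a b j1 f1) :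
    RHGood N a b (fun k => c * j1 k) (fun z => c * f1 z) where
  cut := fun k hk t ht => by
    obtain ⟨L, u, v⟩ := h1.cut k hk t ht
    exact ⟨c * L, u.const_mul _, rh_tendsto_eq (v.const_mul _) (by ring)⟩
  gap := fun k hk t ht => by
    obtain ⟨L, u, v⟩ := h1.gap k hk t ht
    exact ⟨c * L, rh_tendsto_eq (u.const_mul _) (by push_cast; ring), v.const_mul _⟩
  e := fun k hk p hp => (h1.e k hk p hp).const_mul_left _

lemma RHGood.sum {ι : Type*} (s : Finset ι) {j : ι → ℕ → ℝ} {f : ι → ℂ → ℂ} (h : ∀ i ∈ s, RHGood N a b (j i) (f i)) :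
    RHGood N a b (fun k => ∑ i ∈ s, j i k) (fun z => ∑ i ∈ s, f i z) := by
  classical
  induction s using Finset.induction_on with
  | empty =>
    simp only [Finset.sum_empty]
    exact RHGood.zero
  | insert i s hi ih =>
    simp only [Finset.sum_insert hi]
    exact (h i (Finset.mem_insert_self _ _)).add (ih fun i' hi' => h i' (Finset.mem_insert_of_mem hi'))

lemma rh_closed_useg (c d : ℝ) : IsClosed (Complex.ofReal '' Set.uIcc c d) := rh_closed_seg _ _

lemma rD_diff {w : ℝ → ℂ} {c d : ℝ} (hw : IntervalIntegrable w MeasureTheory.volume c d) {z : ℂ}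
    (hz : z ∉ Complex.ofReal '' Set.uIcc c d) :
    DifferentiableAt ℂ (fun z => ∫ s in c..d, w s * ((s:ℂ) - z)⁻¹) z := by
  have hU := (rh_closed_useg c d).isOpen_compl
  have hne : ∀ z ∈ (Complex.ofReal '' Set.uIcc c d)ᶜ, ∀ s ∈ Set.uIcc c d, (s:ℂ) - z ≠ 0 := by
    intro z hz s hs h
    exact hz ⟨s, hs, sub_eq_zero.1 h⟩
  refine (rh_param hU hw (k := fun z s => ((s:ℂ) - z)⁻¹) ?_ ?_).differentiableAt (hU.mem_nhds hz)
  · refine ContinuousOn.inv₀ (by fun_prop) ?_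
    rintro ⟨z, s⟩ ⟨h1, h2⟩
    exact hne z h1 s h2
  · intro s hs
    refine DifferentiableOn.inv (by fun_prop) ?_
    intro z hz
    exact hne z hz s hs

lemma rC_cont {c d : ℝ} (hw : IntervalIntegrable (fun s : ℝ => (rR N a b s)⁻¹) MeasureTheory.volume c d) {t : ℝ}
    (ht : t ∉ Set.uIcc c d) (s : Set ℂ) : Tendsto (rC N a b c d) (𝓝[s] (t:ℂ)) (𝓝 (rC N a b c d t)) := by
  refine Tendsto.mono_left ?_ nhdsWithin_le_nhds
  refine (rD_diff hw ?_).continuousAt.tendsto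
  rintro ⟨t', h, e⟩
  have : t' = t := by exact_mod_cast e
  exact ht (this ▸ h)

lemma rR_bdd (ho : RHOrd N a b) {k : ℕ} (hk : k < N) {p : ℝ} (hp : p = a k ∨ p = b k) :
    rR N a b =O[𝓝[{z : ℂ | z.im ≠ 0}] (p:ℂ)] fun _ => (1:ℝ) := by
  have h := (rG_end ho hk hp).2.2.trans (rh_rpow_bdd (p:ℂ) p (r := 1/2) (by norm_num))
  exact h.mono ((RHOrd.im_le N a b p).trans (ho.end_le hk hp))

lemma rC_bdd (ho : RHOrd N a b) {c d : ℝ} (hw : IntervalIntegrable (fun s : ℝ => (rR N a b s)⁻¹) MeasureTheory.volume c d)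
    {k : ℕ} (hk : k < N) {p : ℝ} (hp : p = a k ∨ p = b k) (h : p ∉ Set.uIcc c d) :
    (fun z => rR N a b z * rC N a b c d z) =O[𝓝[{z : ℂ | z.im ≠ 0}] (p:ℂ)] fun _ => (1:ℝ) := by
  simpa using (rR_bdd ho hk hp).mul ((rC_cont hw h _).isBigO_one ℝ)

lemma rC_cut (ho : RHOrd N a b) {c d : ℝ} (hw : IntervalIntegrable (fun s : ℝ => (rR N a b s)⁻¹) MeasureTheory.volume c d)
    {k : ℕ} (hk : k < N) {t : ℝ} (ht : t ∈ Set.Ioo (a k) (b k)) (h : t ∉ Set.uIcc c d) : ∃ L : ℂ,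
    Tendsto (fun z => rR N a b z * rC N a b c d z) (𝓝[{z : ℂ | 0 < z.im}] (t : ℂ)) (𝓝 L) ∧
    Tendsto (fun z => rR N a b z * rC N a b c d z) (𝓝[{z : ℂ | z.im < 0}] (t : ℂ)) (𝓝 (-L)) := by
  obtain ⟨ρ, _, h1, h2⟩ := rR_cut ho hk ht
  exact ⟨_, h1.mul (rC_cont hw h _), rh_tendsto_eq (h2.mul (rC_cont hw h _)) (by ring)⟩

lemma rC_gap (ho : RHOrd N a b) {c d : ℝ} (hw : IntervalIntegrable (fun s : ℝ => (rR N a b s)⁻¹) MeasureTheory.volume c d)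
    {k : ℕ} (hk : k + 1 < N) {t : ℝ} (ht : t ∈ Set.Ioo (b k) (a (k+1))) (h : t ∉ Set.uIcc c d) (s : Set ℂ) :
    Tendsto (fun z => rR N a b z * rC N a b c d z) (𝓝[s] (t : ℂ)) (𝓝 (rR N a b t * rC N a b c d t)) :=
  ((rR_diff ho (ho.gap_off hk ht)).continuousAt.tendsto.mono_left nhdsWithin_le_nhds).mul (rC_cont hw h _)

lemma rh_pair_int (ho : RHOrd N a b) {c d : ℝ} (hc : b (N-1) < c) (hd : b (N-1) < d) :
    IntervalIntegrable (fun s : ℝ => (rR N a b s)⁻¹) MeasureTheory.volume c d := by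
  apply ContinuousOn.intervalIntegrable
  intro s hs
  have hs' : b (N-1) < s := lt_of_lt_of_le (lt_min hc hd) hs.1
  have ho' : (s:ℂ) ∈ offCut N a b := rh_real_offCut fun k hk => Or.inr ((ho.bN hk).trans_lt hs')
  have h1 := (rR_diff ho ho').continuousAt
  have h2 : ContinuousAt (fun s : ℝ => (rR N a b s)) s := ContinuousAt.comp (f := fun s : ℝ => (s:ℂ)) h1 Complex.continuous_ofReal.continuousAt
  exact (h2.inv₀ (rR_ne ho ho')).continuousWithinAt

lemma rh_good_pair (ho : RHOrd N a b) {c d : ℝ} (hc : b (N-1) < c) (hd : b (N-1) < d) :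
    RHGood N a b 0 (fun z => rR N a b z * rC N a b c d z) := by
  have hw := rh_pair_int ho hc hd
  have hn : ∀ t ≤ b (N-1), t ∉ Set.uIcc c d := fun t ht h => by
    have := lt_of_lt_of_le (lt_min hc hd) h.1
    linarith
  refine ⟨?_, ?_, ?_⟩
  · intro k hk t ht
    exact rC_cut ho hw hk ht (hn t (ht.2.le.trans (ho.bN hk)))
  · intro k hk t ht
    have h := hn t (ht.2.le.trans ((ho.ab hk).le.trans (ho.bN hk)))
    exact ⟨_, rh_tendsto_eq (rC_gap ho hw hk ht h _) (by simp), rC_gap ho hw hk ht h _⟩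
  · intro k hk p hp
    have h1 := ho.ab hk
    have h2 := ho.bN hk
    refine rC_bdd ho hw hk hp (hn p ?_)
    rcases hp with rfl | rfl <;> linarith

lemma rh_gap_int (ho : RHOrd N a b) {k : ℕ} (hk : k + 1 < N) :
    IntervalIntegrable (fun s : ℝ => (rR N a b s)⁻¹) MeasureTheory.volume (b k) (a (k+1)) := by
  have hba := ho.ba hk
  have hm : (b k + a (k+1)) / 2 ∈ Set.Ioo (b k) (a (k+1)) := ⟨by linarith, by linarith⟩
  exact (rh_gapL ho hk hm).1.trans (rh_gapR ho hk hm).1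

lemma rC_split (ho : RHOrd N a b) {k : ℕ} (hk : k + 1 < N) {m : ℝ} (hm : m ∈ Set.Ioo (b k) (a (k+1))) {z : ℂ} (hz : z.im ≠ 0) :
    rC N a b (b k) m z + rC N a b m (a (k+1)) z = rC N a b (b k) (a (k+1)) z := by
  have hc : Continuous fun s : ℝ => ((s:ℂ) - z)⁻¹ := by
    refine Continuous.inv₀ (by fun_prop) ?_
    intro s h
    apply hz
    simpa using congrArg Complex.im h
  exact intervalIntegral.integral_add_adjacent_intervals ((rh_gapL ho hk hm).1.mul_continuousOn hc.continuousOn)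
    ((rh_gapR ho hk hm).1.mul_continuousOn hc.continuousOn)

lemma rh_good_gap (ho : RHOrd N a b) {k : ℕ} (hk : k + 1 < N) :
    RHGood N a b (fun l => if l = k then 1 else 0) (fun z => rR N a b z * rC N a b (b k) (a (k+1)) z) := by
  have hw := rh_gap_int ho hk
  have hba := ho.ba hk
  have hsplit : ∀ {m : ℝ} (_ : m ∈ Set.Ioo (b k) (a (k+1))) (p : ℂ), (fun z => rR N a b z * rC N a b (b k) m z + rR N a b z * rC N a b m (a (k+1)) z) =ᶠ[𝓝[{z : ℂ | z.im ≠ 0}] p]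
      (fun z => rR N a b z * rC N a b (b k) (a (k+1)) z) := by
    intro m hm p
    filter_upwards [self_mem_nhdsWithin] with z hz
    rw [← rC_split ho hk hm hz]; ring
  have hup : ∀ p : ℂ, 𝓝[{z : ℂ | 0 < z.im}] p ≤ 𝓝[{z : ℂ | z.im ≠ 0}] p := fun p => nhdsWithin_mono _ fun z hz => ne_of_gt hz
  have hlow : ∀ p : ℂ, 𝓝[{z : ℂ | z.im < 0}] p ≤ 𝓝[{z : ℂ | z.im ≠ 0}] p := fun p => nhdsWithin_mono _ fun z hz => ne_of_lt hz
  refine ⟨?_, ?_, ?_⟩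
  · intro l hl t ht
    refine rC_cut ho hw hl ht ?_
    rw [Set.uIcc_of_le hba.le]
    rintro ⟨h1, h2⟩
    rcases Nat.lt_or_ge k l with h3 | h3
    · have : a (k+1) ≤ a l := by
        rcases Nat.lt_or_ge (k+1) l with h4 | h4
        · have := ho.lt h4 hl; have := ho.ab hk; linarith
        · have : l = k+1 := by omega
          rw [this]
      linarith [ht.1]
    · have : b l ≤ b k := by
        rcases Nat.lt_or_ge l k with h4 | h4
        · have := ho.lt h4 (by omega); have := ho.ab (k := k) (by omega); linarith
        · have : l = k := by omega
          rw [this]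
      linarith [ht.2]
  · intro l hl t ht
    by_cases hlk : l = k
    · subst hlk
      have hm : (t + a (l+1)) / 2 ∈ Set.Ioo (b l) (a (l+1)) := ⟨by linarith [ht.1], by linarith [ht.2]⟩
      obtain ⟨L, h1, h2⟩ := (rh_gapL ho hk hm).2.2 t ⟨ht.1, by linarith [ht.2]⟩
      have hn : t ∉ Set.uIcc ((t + a (l+1)) / 2) (a (l+1)) := by
        rw [Set.uIcc_of_le hm.2.le]
        rintro ⟨h, _⟩
        linarith [ht.2]
      have h3 := rC_gap ho (rh_gapR ho hk hm).1 hk ht hn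
      refine ⟨L + rR N a b t * rC N a b ((t + a (l+1)) / 2) (a (l+1)) t, ?_, ?_⟩
      · refine (rh_tendsto_eq (h1.add (h3 _)) ?_).congr' ((hsplit hm _).filter_mono (hup _))
        simp; ring
      · exact (h2.add (h3 _)).congr' ((hsplit hm _).filter_mono (hlow _))
    · have hn : t ∉ Set.uIcc (b k) (a (k+1)) := by
        rw [Set.uIcc_of_le hba.le]
        rintro ⟨h1, h2⟩
        rcases lt_or_gt_of_ne hlk with h3 | h3
        · have : a (l+1) < b k := by
            rcases Nat.lt_or_ge (l+1) k with h4 | h4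
            · have h5 := ho.lt h4 (by omega); have h6 := ho.ab (k := k) (by omega); have h7 := ho.ab (k := l+1) (by omega); linarith
            · have : k = l + 1 := by omega
              rw [this]; exact ho.ab hl
          linarith [ht.2]
        · have : a (k+1) < b l := by
            rcases Nat.lt_or_ge (k+1) l with h4 | h4
            · have h5 := ho.lt h4 (by omega); have h6 := ho.ab (k := l) (by omega); have h7 := ho.ab (k := k+1) (by omega); linarith
            · have : l = k + 1 := by omega
              rw [this]; exact ho.ab hk
          linarith [ht.1]
      exact ⟨_, rh_tendsto_eq (rC_gap ho hw hl ht hn _) (by simp [hlk]), rC_gap ho hw hl ht hn _⟩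
  · intro l hl p hp
    have hm : (b k + a (k+1)) / 2 ∈ Set.Ioo (b k) (a (k+1)) := ⟨by linarith, by linarith⟩
    by_cases c1 : p = b k
    · subst c1
      have hn : b k ∉ Set.uIcc ((b k + a (k+1)) / 2) (a (k+1)) := by
        rw [Set.uIcc_of_le hm.2.le]
        rintro ⟨h, _⟩
        linarith
      exact ((rh_gapL ho hk hm).2.1.add (rC_bdd ho (rh_gapR ho hk hm).1 hl hp hn)).congr' (hsplit hm _) EventuallyEq.rfl
    by_cases c2 : p = a (k+1)
    · subst c2
      have hn : a (k+1) ∉ Set.uIcc (b k) ((b k + a (k+1)) / 2) := by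
        rw [Set.uIcc_of_le hm.1.le]
        rintro ⟨_, h⟩
        linarith
      exact ((rC_bdd ho (rh_gapL ho hk hm).1 hl hp hn).add (rh_gapR ho hk hm).2).congr' (hsplit hm _) EventuallyEq.rfl
    refine rC_bdd ho hw hl hp ?_
    rw [Set.uIcc_of_le hba.le]
    rintro ⟨h1, h2⟩
    have h0 := ho.ab hl
    rcases Nat.lt_or_ge k l with h3 | h3
    · rcases Nat.lt_or_ge (k+1) l with h4 | h4
      · have := ho.lt h4 hl; have := ho.ab hk
        rcases hp with rfl | rfl <;> linarith
      · have : l = k+1 := by omega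
        subst this
        rcases hp with rfl | rfl
        · exact c2 rfl
        · linarith
    · rcases Nat.lt_or_ge l k with h4 | h4
      · have := ho.lt h4 (by omega); have := ho.ab (k := k) (by omega)
        rcases hp with rfl | rfl <;> linarith
      · have : l = k := by omega
        subst this
        rcases hp with rfl | rfl
        · linarith
        · exact c1 rfl

end

def rD (w : ℝ → ℂ) (c d : ℝ) (K : ℕ) (z : ℂ) : ℂ := ∫ s in c..d, w s * (s:ℂ) ^ K * ((s:ℂ) - z)⁻¹
def rM (w : ℝ → ℂ) (c d : ℝ) (K : ℕ) : ℂ := ∫ s in c..d, w s * (s:ℂ) ^ K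

lemma rh_seg_ne {c d : ℝ} {z : ℂ} (hz : z ∉ Complex.ofReal '' Set.uIcc c d) {s : ℝ} (hs : s ∈ Set.uIcc c d) : (s:ℂ) - z ≠ 0 :=
  fun h => hz ⟨s, hs, sub_eq_zero.1 h⟩

lemma rh_seg_cont {c d : ℝ} {z : ℂ} (hz : z ∉ Complex.ofReal '' Set.uIcc c d) :
    ContinuousOn (fun s : ℝ => ((s:ℂ) - z)⁻¹) (Set.uIcc c d) :=
  ContinuousOn.inv₀ (by fun_prop) fun _ hs => rh_seg_ne hz hs

lemma rD_step {w : ℝ → ℂ} {c d : ℝ} (hw : IntervalIntegrable w MeasureTheory.volume c d) (K : ℕ) {z : ℂ}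
    (hz : z ∉ Complex.ofReal '' Set.uIcc c d) : z * rD w c d K z = rD w c d (K+1) z - rM w c d K := by
  have hp : ∀ K : ℕ, IntervalIntegrable (fun s : ℝ => w s * (s:ℂ) ^ K) MeasureTheory.volume c d := fun K =>
    hw.mul_continuousOn (by fun_prop)
  rw [rD, rD, rM, ← intervalIntegral.integral_const_mul, ← intervalIntegral.integral_sub ((hp (K+1)).mul_continuousOn (rh_seg_cont hz)) (hp K)]
  refine intervalIntegral.integral_congr ?_
  intro s hs
  have := rh_seg_ne hz hs
  simp only
  field_simp
  ring

lemma rh_cob_seg (c d : ℝ) : ∀ᶠ z in cobounded ℂ, z ∉ Complex.ofReal '' Set.uIcc c d :=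
  isBounded_def.1 (isCompact_uIcc.image Complex.continuous_ofReal).isBounded

lemma rD_bdd {w : ℝ → ℂ} {c d : ℝ} (hw : IntervalIntegrable w MeasureTheory.volume c d) (K : ℕ) :
    rD w c d K =O[cobounded ℂ] fun _ => (1:ℝ) := by
  have hp : IntervalIntegrable (fun s : ℝ => w s * (s:ℂ) ^ K) MeasureTheory.volume c d := hw.mul_continuousOn (by fun_prop)
  refine IsBigO.of_bound |∫ s in c..d, ‖w s * (s:ℂ) ^ K‖| ?_
  have h1 : ∀ᶠ z in cobounded ℂ, |c| + |d| + 1 ≤ ‖z‖ := tendsto_norm_cobounded_atTop.eventually_ge_atTop _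
  filter_upwards [h1] with z hz
  simp only [norm_one, mul_one]
  refine intervalIntegral.norm_integral_le_abs_of_norm_le ?_ hp.norm
  filter_upwards [MeasureTheory.ae_restrict_mem measurableSet_uIoc] with s hs
  rw [norm_mul]
  refine mul_le_of_le_one_right (norm_nonneg _) ?_
  rw [norm_inv]
  apply inv_le_one_of_one_le₀
  have h2 : |s| ≤ |c| + |d| := by
    have := Set.uIoc_subset_uIcc hs
    rcases Set.mem_uIcc.1 this with ⟨u, v⟩ | ⟨u, v⟩ <;>
    · rw [abs_le]
      have := neg_abs_le c; have := neg_abs_le d; have := le_abs_self c; have := le_abs_self d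
      have := abs_nonneg c; have := abs_nonneg d
      constructor <;> linarith
  have h3 : ‖z‖ - ‖(s:ℂ)‖ ≤ ‖(s:ℂ) - z‖ := by rw [norm_sub_rev]; exact norm_sub_norm_le _ _
  rw [Complex.norm_real, Real.norm_eq_abs] at h3
  linarith

lemma rh_inf {N : ℕ} {a b : ℕ → ℝ} (ho : RHOrd N a b) {ι : Type*} [Fintype ι] (e c d : ι → ℝ)
    (hw : ∀ i, IntervalIntegrable (fun s : ℝ => (rR N a b s)⁻¹) MeasureTheory.volume (c i) (d i))
    (hM : ∀ m < N - 1, ∑ i, (e i : ℂ) * rM (fun s : ℝ => (rR N a b s)⁻¹) (c i) (d i) m = 0) :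
    (fun z => rR N a b z * ∑ i, (e i : ℂ) * rC N a b (c i) (d i) z) =O[cobounded ℂ] fun _ => (1:ℝ) := by
  set w : ℝ → ℂ := fun s : ℝ => (rR N a b s)⁻¹ with hwdef
  set T : ℕ → ℂ → ℂ := fun K z => ∑ i, (e i : ℂ) * rD w (c i) (d i) K z with hT
  have hN := ho.pos
  have hoff : ∀ᶠ z in cobounded ℂ, ∀ i, z ∉ Complex.ofReal '' Set.uIcc (c i) (d i) := by
    rw [eventually_all]; exact fun i => rh_cob_seg _ _
  have hstep : ∀ z, (∀ i, z ∉ Complex.ofReal '' Set.uIcc (c i) (d i)) → ∀ K, z * T K z = T (K+1) z - ∑ i, (e i : ℂ) * rM w (c i) (d i) K := by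
    intro z hz K
    simp only [hT, Finset.mul_sum]
    rw [← Finset.sum_sub_distrib]
    refine Finset.sum_congr rfl fun i _ => ?_
    rw [← mul_sub, ← rD_step (hw i) K (hz i)]; ring
  have hpow : ∀ z, (∀ i, z ∉ Complex.ofReal '' Set.uIcc (c i) (d i)) → ∀ K ≤ N - 1, z ^ K * T 0 z = T K z := by
    intro z hz K hK
    induction K with
    | zero => simp
    | succ K ih =>
      rw [pow_succ', mul_assoc, ih (by omega), hstep z hz, hM K (by omega), sub_zero]
  have hTb : ∀ K, T K =O[cobounded ℂ] fun _ => (1:ℝ) := fun K =>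
    IsBigO.fun_sum fun i _ => (rD_bdd (hw i) K).const_mul_left _
  have hb : (fun z => z ^ N * T 0 z) =O[cobounded ℂ] fun _ => (1:ℝ) := by
    have h1 := (hTb (N - 1 + 1)).sub (isBigO_const_const (∑ i, (e i : ℂ) * rM w (c i) (d i) (N-1)) (one_ne_zero (α := ℝ)) (cobounded ℂ))
    refine h1.congr' ?_ EventuallyEq.rfl
    filter_upwards [hoff] with z hz
    rw [← hstep z hz, ← hpow z hz _ le_rfl, ← mul_assoc, ← pow_succ', Nat.sub_add_cancel hN]
  have h2 := ((rR_infty N a b).isBigO_one ℝ).mul hb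
  simp only [mul_one] at h2
  refine h2.congr' ?_ EventuallyEq.rfl
  filter_upwards [eventually_ne_cobounded (0:ℂ)] with z hz
  have h3 : T 0 z = ∑ i, (e i : ℂ) * rC N a b (c i) (d i) z := by
    simp only [hT, rD, rC, hwdef, pow_zero, mul_one]
  rw [← h3]
  field_simp

lemma rh_exp_int {c d : ℝ} {z : ℂ} (hz : z.im ≠ 0) : exp (∫ s in c..d, ((s:ℂ) - z)⁻¹) = (z - d) / (z - c) := by
  have hs : ∀ s : ℝ, (s:ℂ) - z ∈ slitPlane := fun s => Or.inr (by simpa using hz)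
  have h1 : ∫ s in c..d, ((s:ℂ) - z)⁻¹ = Complex.log (d - z) - Complex.log (c - z) := by
    refine intervalIntegral.integral_eq_sub_of_hasDerivAt (f := fun s : ℝ => Complex.log ((s:ℂ) - z)) ?_ ?_
    · intro s _
      have h2 : HasDerivAt (fun s : ℝ => (s:ℂ) - z) 1 s := (Complex.ofRealCLM.hasDerivAt (x := s)).sub_const z
      simpa using h2.clog_real (hs s)
    · exact (rh_seg_cont (rh_im_notin hz _)).intervalIntegrable
  have n1 := slitPlane_ne_zero (hs d)
  have n2 := slitPlane_ne_zero (hs c)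
  rw [h1, Complex.exp_sub, Complex.exp_log n1, Complex.exp_log n2, ← neg_sub z, ← neg_sub z, neg_div_neg_eq]

def rLam (N : ℕ) (a b : ℕ → ℝ) (c d : ℝ) (z : ℂ) : ℂ := ∫ s in c..d, (rR N a b s)⁻¹ * (-(dslope (rR N a b) s z))

section
variable {N : ℕ} {a b : ℕ → ℝ}

lemma rh_pair_mem {c d : ℝ} (hc : b (N-1) < c) (hd : b (N-1) < d) {s : ℝ} (hs : s ∈ Set.uIcc c d) :
    (s:ℂ) ∈ (cutSet N a b)ᶜ := by
  have hs' : b (N-1) < s := lt_of_lt_of_le (lt_min hc hd) hs.1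
  exact rh_notin_seg (Or.inr hs')

lemma rLam_diff (ho : RHOrd N a b) {c d : ℝ} (hc : b (N-1) < c) (hd : b (N-1) < d) :
    DifferentiableOn ℂ (rLam N a b c d) (cutSet N a b)ᶜ := by
  have hU := isOpen_cutSet N a b
  have hR : DifferentiableOn ℂ (rR N a b) (cutSet N a b)ᶜ := fun z hz => (rR_diff ho (ho.cutSet_sub hz)).differentiableWithinAt
  refine rh_param hU (rh_pair_int ho hc hd) (k := fun z s => -(dslope (rR N a b) s z)) ?_ ?_
  · refine ContinuousOn.neg ?_
    refine (rh_continuousOn_dslope hU hR).comp (f := fun p : ℂ × ℝ => (((p.2:ℝ):ℂ), p.1)) (by fun_prop) ?_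
    intro p hp
    exact ⟨rh_pair_mem hc hd hp.2, hp.1⟩
  · intro s hs
    exact ((Complex.differentiableOn_dslope (hU.mem_nhds (rh_pair_mem hc hd hs))).2 hR).neg

lemma rLam_eq (ho : RHOrd N a b) {c d : ℝ} (hc : b (N-1) < c) (hd : b (N-1) < d) {z : ℂ}
    (hz : z ∉ Complex.ofReal '' Set.uIcc c d) :
    rLam N a b c d z = rR N a b z * rC N a b c d z - ∫ s in c..d, ((s:ℂ) - z)⁻¹ := by
  have i1 := ((rh_pair_int ho hc hd).mul_continuousOn (rh_seg_cont hz)).const_mul (rR N a b z)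
  have i2 : IntervalIntegrable (fun s : ℝ => ((s:ℂ) - z)⁻¹) MeasureTheory.volume c d := (rh_seg_cont hz).intervalIntegrable
  rw [rC, rLam, ← intervalIntegral.integral_const_mul, ← intervalIntegral.integral_sub i1 i2]
  refine intervalIntegral.integral_congr ?_
  intro s hs
  have n1 := rh_seg_ne hz hs
  have n2 : z - s ≠ 0 := by intro h; apply n1; linear_combination -h
  have n3 := rR_ne ho (ho.cutSet_sub (rh_pair_mem (a := a) hc hd hs))
  simp only
  rw [dslope_of_ne _ (fun h => n2 (by rw [h]; ring)), slope_def_field]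
  have n4 : z - s = -((s:ℂ) - z) := by ring
  rw [n4]
  field_simp

lemma rR_real_gap (ho : RHOrd N a b) {k : ℕ} (hk : k + 1 < N) {s : ℝ} (hs : s ∈ Set.Ioc (b k) (a (k+1))) :
    (((rR N a b s).re : ℝ) : ℂ) = rR N a b s := by
  rcases lt_or_eq_of_le hs.2 with h | h
  · exact rR_real ho (ho.gap_off hk ⟨hs.1, h⟩)
  · have : rR N a b s = 0 := by
      rw [rR_erase N a b hk, h]
      simp [rr]
    rw [this]; simp

lemma rM_real {c d : ℝ} (h : ∀ s ∈ Set.uIoc c d, (((rR N a b s).re : ℝ) : ℂ) = rR N a b s) (m : ℕ) :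
    rM (fun s : ℝ => (rR N a b s)⁻¹) c d m = ((∫ s in c..d, ((rR N a b s).re)⁻¹ * s ^ m : ℝ) : ℂ) := by
  rw [rM, ← intervalIntegral.integral_ofReal]
  refine intervalIntegral.integral_congr_ae (Eventually.of_forall ?_)
  intro s hs
  push_cast
  rw [h s hs]

lemma rh_ext_bdd {p : ℂ} {Λ : ℂ → ℂ} (hc : ContinuousOn Λ (cutSet N a b)ᶜ)
    (hb : Λ =O[𝓝[{z : ℂ | z.im ≠ 0}] p] fun _ => (1:ℝ)) : Λ =O[𝓝[(cutSet N a b)ᶜ] p] fun _ => (1:ℝ) := by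
  obtain ⟨C, hC⟩ := hb.bound
  refine IsBigO.of_bound C ?_
  rw [eventually_nhdsWithin_iff] at hC ⊢
  obtain ⟨V, hV, hVo, hp⟩ := eventually_nhds_iff.1 hC
  filter_upwards [hVo.mem_nhds hp] with z hz hzc
  have h1 : Tendsto Λ (𝓝[{z : ℂ | z.im ≠ 0}] z) (𝓝 (Λ z)) :=
    (hc.continuousAt ((isOpen_cutSet N a b).mem_nhds hzc)).tendsto.mono_left nhdsWithin_le_nhds
  have : (𝓝[{z : ℂ | z.im ≠ 0}] z).NeBot := rh_neBot_im z
  refine le_of_tendsto h1.norm ?_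
  filter_upwards [self_mem_nhdsWithin, nhdsWithin_le_nhds (hVo.mem_nhds hz)] with u hu1 hu2
  exact hV u hu2 hu1

lemma rh_exp_bdd {l : Filter ℂ} {Λ : ℂ → ℂ} (h : Λ =O[l] fun _ => (1:ℝ)) : (fun z => exp (Λ z)) =O[l] fun _ => (1:ℝ) := by
  obtain ⟨C, hC⟩ := h.bound
  refine IsBigO.of_bound (Real.exp C) ?_
  filter_upwards [hC] with z hz
  simp only [norm_one, mul_one] at hz ⊢
  rw [Complex.norm_exp, Real.exp_le_exp]
  exact (Complex.re_le_norm _).trans hz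

lemma rh_exists_psi (ho : RHOrd N a b) (β : ℕ → ℝ) : ∃ (n : ℕ) (x y : Fin n → ℝ) (ψ : ℂ → ℂ), RHPsi N a b β n x y ψ := by
  have hUo := isOpen_cutSet N a b
  -- choose the pairs
  have hoff : ∀ s : ℝ, b (N-1) < s → (s:ℂ) ∈ offCut N a b := fun s hs =>
    rh_real_offCut fun k hk => Or.inr ((ho.bN hk).trans_lt hs)
  obtain ⟨n, x, y, hx, hy, hm⟩ := rh_pairs (b (N-1)) (fun s => ((rR N a b s).re)⁻¹) (by
      intro s hs
      have h1 := (rR_diff ho (hoff s hs)).continuousAt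
      have h2 : ContinuousAt (fun s : ℝ => (rR N a b s)) s := ContinuousAt.comp (f := fun s : ℝ => (s:ℂ)) h1 Complex.continuous_ofReal.continuousAt
      have h3 : ContinuousAt (fun s : ℝ => (rR N a b s).re) s := Complex.continuous_re.continuousAt.comp h2
      refine (h3.inv₀ ?_).continuousWithinAt
      intro h0
      apply rR_ne ho (hoff s hs)
      rw [← rR_real ho (hoff s hs), h0]; simp) (by
      intro s hs h0
      apply rR_ne ho (hoff s hs)
      rw [← rR_real ho (hoff s hs), inv_eq_zero.1 h0]; simp) (N-1)
    (fun m => ∑ j : Fin (N-1), β j * ∫ s in (b j)..(a (j+1)), ((rR N a b s).re)⁻¹ * s ^ (m:ℕ))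
  have hjN : ∀ j : Fin (N-1), (j:ℕ) + 1 < N := fun j => by have := j.2; omega
  set e : Fin (N-1) ⊕ Fin n → ℝ := Sum.elim (fun j => -β j) (fun _ => 1) with he
  set c : Fin (N-1) ⊕ Fin n → ℝ := Sum.elim (fun j => b j) x with hc
  set d : Fin (N-1) ⊕ Fin n → ℝ := Sum.elim (fun j => a (j+1)) y with hd
  have hw : ∀ i, IntervalIntegrable (fun s : ℝ => (rR N a b s)⁻¹) MeasureTheory.volume (c i) (d i) := by
    rintro (j | i)
    · exact rh_gap_int ho (hjN j)
    · exact rh_pair_int ho (hx i) (hy i)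
  have hM : ∀ m < N - 1, ∑ i, (e i : ℂ) * rM (fun s : ℝ => (rR N a b s)⁻¹) (c i) (d i) m = 0 := by
    intro m hmN
    rw [Fintype.sum_sum_type]
    have h1 := hm ⟨m, hmN⟩
    have e1 : ∑ j : Fin (N-1), (e (Sum.inl j) : ℂ) * rM (fun s : ℝ => (rR N a b s)⁻¹) (c (Sum.inl j)) (d (Sum.inl j)) m
        = -((∑ j : Fin (N-1), β j * ∫ s in (b j)..(a (j+1)), ((rR N a b s).re)⁻¹ * s ^ m : ℝ) : ℂ) := by
      push_cast
      rw [← Finset.sum_neg_distrib]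
      refine Finset.sum_congr rfl fun j _ => ?_
      simp only [he, hc, hd, Sum.elim_inl]
      rw [rM_real]
      · push_cast; ring
      · intro s hs
        rw [Set.uIoc_of_le (ho.ba (hjN j)).le] at hs
        exact rR_real_gap ho (hjN j) hs
    have e2 : ∑ i : Fin n, (e (Sum.inr i) : ℂ) * rM (fun s : ℝ => (rR N a b s)⁻¹) (c (Sum.inr i)) (d (Sum.inr i)) m
        = ((∑ i : Fin n, ∫ s in (x i)..(y i), ((rR N a b s).re)⁻¹ * s ^ m : ℝ) : ℂ) := by
      push_cast
      refine Finset.sum_congr rfl fun j _ => ?_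
      simp only [he, hc, hd, Sum.elim_inr]
      rw [rM_real]
      · push_cast; ring
      · intro s hs
        exact rR_real ho (hoff s (lt_of_lt_of_le (lt_min (hx j) (hy j)) (Set.uIoc_subset_uIcc hs).1))
    rw [e1, e2, h1]; ring
  set Φ : ℂ → ℂ := fun z => ∑ i, (e i : ℂ) * (rR N a b z * rC N a b (c i) (d i) z) with hΦ
  have hgood : RHGood N a b (fun k => ∑ i, e i * (Sum.elim (fun (j : Fin (N-1)) (l : ℕ) => if l = j then (1:ℝ) else 0) (fun _ _ => 0) i k)) Φ := by
    refine RHGood.sum _ fun i _ => RHGood.smul (e i) (j1 := Sum.elim (fun (j : Fin (N-1)) (l : ℕ) => if l = j then (1:ℝ) else 0) (fun _ _ => 0) i) ?_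
    rcases i with j | i
    · exact rh_good_gap ho (hjN j)
    · exact rh_good_pair ho (hx i) (hy i)
  have hjump : ∀ k, k + 1 < N → ∑ i, e i * (Sum.elim (fun (j : Fin (N-1)) (l : ℕ) => if l = j then (1:ℝ) else 0) (fun _ _ => 0) i k) = -β k := by
    intro k hk
    rw [Fintype.sum_sum_type]
    simp only [Sum.elim_inl, Sum.elim_inr, mul_zero, Finset.sum_const_zero, add_zero, he]
    rw [Finset.sum_eq_single (⟨k, by omega⟩ : Fin (N-1))]
    · simp
    · intro j _ hj
      rw [if_neg, mul_zero]
      rintro rfl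
      exact hj rfl
    · intro h; exact absurd (Finset.mem_univ _) h
  set Λ : ℂ → ℂ := fun z => ∑ j : Fin (N-1), ((-β j : ℝ) : ℂ) * (rR N a b z * rC N a b (b j) (a (j+1)) z) + ∑ i, rLam N a b (x i) (y i) z with hΛ
  have hΛd : DifferentiableOn ℂ Λ (cutSet N a b)ᶜ := by
    refine DifferentiableOn.add (DifferentiableOn.fun_sum fun j _ => ?_) (DifferentiableOn.fun_sum fun i _ => rLam_diff ho (hx i) (hy i))
    intro z hz
    apply DifferentiableAt.differentiableWithinAt
    refine ((rR_diff ho (ho.cutSet_sub hz)).mul (rD_diff (rh_gap_int ho (hjN j)) ?_)).const_mul _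
    rintro ⟨s, hs, rfl⟩
    apply hz
    rw [Set.uIcc_of_le (ho.ba (hjN j)).le] at hs
    have h1 := ho.a0 (k := (j:ℕ)) (by have := j.2; omega)
    have h2 := ho.ab (k := (j:ℕ)) (by have := j.2; omega)
    have h3 := ho.ab (hjN j)
    have h4 := ho.bN (hjN j)
    exact ⟨s, ⟨by linarith [hs.1], by linarith [hs.2]⟩, rfl⟩
  have hΛΦ : ∀ z, (∀ i, z ∉ Complex.ofReal '' Set.uIcc (x i) (y i)) → Λ z = Φ z - ∑ i, ∫ s in (x i)..(y i), ((s:ℂ) - z)⁻¹ := by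
    intro z hz
    simp only [hΛ, hΦ, Fintype.sum_sum_type, he, hc, hd, Sum.elim_inl, Sum.elim_inr]
    rw [add_sub_assoc, ← Finset.sum_sub_distrib]
    congr 1
    refine Finset.sum_congr rfl fun i _ => ?_
    rw [rLam_eq ho (hx i) (hy i) (hz i)]; simp
  have hE : ∀ z : ℂ, z.im ≠ 0 → rE x y (fun z => exp (Λ z)) z = exp (Φ z) := by
    intro z hz
    have h1 := hΛΦ z fun i => rh_im_notin hz _
    have h2 : ∏ i, ((z - y i) / (z - x i)) = exp (∑ i, ∫ s in (x i)..(y i), ((s:ℂ) - z)⁻¹) := by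
      rw [Complex.exp_sum]
      exact Finset.prod_congr rfl fun i _ => (rh_exp_int hz).symm
    rw [rE, h2, ← Complex.exp_add, h1]
    congr 1; ring
  have hup : ∀ p : ℂ, rE x y (fun z => exp (Λ z)) =ᶠ[𝓝[{z : ℂ | 0 < z.im}] p] fun z => exp (Φ z) := by
    intro p; filter_upwards [self_mem_nhdsWithin] with z hz; exact hE z (ne_of_gt hz)
  have hlow : ∀ p : ℂ, rE x y (fun z => exp (Λ z)) =ᶠ[𝓝[{z : ℂ | z.im < 0}] p] fun z => exp (Φ z) := by
    intro p; filter_upwards [self_mem_nhdsWithin] with z hz; exact hE z (ne_of_lt hz)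
  have hbe : ∀ k < N, ∀ p : ℝ, p = a k ∨ p = b k → Λ =O[𝓝[(cutSet N a b)ᶜ] (p:ℂ)] fun _ => (1:ℝ) := by
    intro k hk p hp
    refine rh_ext_bdd hΛd.continuousOn ?_
    have hpb : p ≤ b (N-1) := by
      have h1 := ho.bN hk
      have h2 := ho.ab hk
      rcases hp with rfl | rfl <;> linarith
    have h1 : (fun z => ∑ i, ∫ s in (x i)..(y i), ((s:ℂ) - z)⁻¹) =O[𝓝[{z : ℂ | z.im ≠ 0}] (p:ℂ)] fun _ => (1:ℝ) := by
      refine IsBigO.fun_sum fun i _ => ?_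
      have hn : (p:ℂ) ∉ Complex.ofReal '' Set.uIcc (x i) (y i) := by
        rintro ⟨s, hs, e⟩
        have e' : s = p := by exact_mod_cast e
        have := lt_of_lt_of_le (lt_min (hx i) (hy i)) hs.1
        linarith
      have h2 := (rD_diff (w := fun _ => 1) (c := x i) (d := y i) (by simp) hn).continuousAt.tendsto.mono_left (nhdsWithin_le_nhds (s := {z : ℂ | z.im ≠ 0}))
      simp only [one_mul] at h2
      exact h2.isBigO_one ℝ
    refine ((hgood.e k hk p hp).sub h1).congr' ?_ EventuallyEq.rfl
    filter_upwards [self_mem_nhdsWithin] with z hz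
    exact (hΛΦ z fun i => rh_im_notin hz _).symm
  have hbi : Λ =O[cobounded ℂ] fun _ => (1:ℝ) := by
    have h1 := rh_inf ho e c d hw hM
    have h2 : (fun z => ∑ i, ∫ s in (x i)..(y i), ((s:ℂ) - z)⁻¹) =O[cobounded ℂ] fun _ => (1:ℝ) := by
      refine IsBigO.fun_sum fun i _ => ?_
      have h3 := rD_bdd (w := fun _ => 1) (c := x i) (d := y i) (by simp) 0
      unfold rD at h3
      simpa only [pow_zero, one_mul] using h3
    refine (h1.sub h2).congr' ?_ EventuallyEq.rfl
    have h4 : ∀ᶠ z in cobounded ℂ, ∀ i, z ∉ Complex.ofReal '' Set.uIcc (x i) (y i) := by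
      rw [eventually_all]; exact fun i => rh_cob_seg _ _
    filter_upwards [h4] with z hz
    rw [hΛΦ z hz]
    congr 1
    simp only [hΦ, Finset.mul_sum]
    exact Finset.sum_congr rfl fun i _ => by ring
  refine ⟨n, x, y, fun z => exp (Λ z), hx, hy, fun z => exp_ne_zero _, hΛd.cexp, ?_, ?_, ?_, ?_, ?_, ?_⟩
  · intro k hk t ht
    obtain ⟨L, h1, h2⟩ := hgood.cut k hk t ht
    refine ⟨exp L, exp_ne_zero _, h1.cexp.congr' (hup _).symm, ?_⟩
    rw [← Complex.exp_neg]
    exact h2.cexp.congr' (hlow _).symm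
  · intro k hk t ht
    obtain ⟨L, h1, h2⟩ := hgood.gap k hk t ht
    rw [hjump k hk] at h1
    refine ⟨exp L, exp_ne_zero _, (rh_tendsto_eq h1.cexp ?_).congr' (hup _).symm, h2.cexp.congr' (hlow _).symm⟩
    rw [← Complex.exp_add]
    congr 1
    push_cast; ring
  · exact fun k hk p hp => rh_exp_bdd (hbe k hk p hp)
  · intro k hk p hp
    simp only [← Complex.exp_neg]
    exact rh_exp_bdd (hbe k hk p hp).neg_left
  · exact rh_exp_bdd hbi
  · simp only [← Complex.exp_neg]
    exact rh_exp_bdd hbi.neg_left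

end

/-- For every integer `N ≥ 1`, all real numbers
`a₁ < b₁ < a₂ < b₂ < ⋯ < a_N < b_N`, all real numbers `α₁, …, α_{N-1}`, and every
integer `n`, there exists a solution `M` of the model Riemann-Hilbert problem. -/
theorem model_RH_problem_solvable (N : ℕ) (hN : 1 ≤ N) (a b α : ℕ → ℝ) (n : ℤ)
    (hab : ∀ k < N, a k < b k) (hba : ∀ k, k + 1 < N → b k < a (k + 1)) :
    ∃ M : ℂ → Matrix (Fin 2) (Fin 2) ℂ,
      IsModelRHSolution N a b (fun k => (n : ℝ) * α k) M := by
  have ho : RHOrd N a b := ⟨hN, hab, hba⟩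
  obtain ⟨m, x, y, ψ, hψ⟩ := rh_exists_psi ho (fun k => (n : ℝ) * α k)
  exact rh_final ho hψ
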